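/- arXiv:2108.01430 — 5 statements merged into one kernel-verified Lean document; each statement's English description precedes it below -/
import Mathlib

section
/- Let F be a forest with vertex weights w : V(F) → ℕ and let 𝒫 be a finite family of simple paths in F. If x : V(F) → ℝ is a fractional solution of the multicut LP, i.e. 0 ≤ x_v ≤ 1 for every vertex v and Σ_{v ∈ V(P)} x_v ≥ 1 for every P ∈ 𝒫, then there exists a set S ⊆ V(F) with S ∩ V(P) ≠ ∅ for every P ∈ 𝒫 and Σ_{v ∈ S} w(v) ≤ 2 · Σ_{v ∈ V(F)} w(v)·x_v. -/
open SimpleGraph MeasureTheory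

lemma fmc_adj_aux {V : Type*} [DecidableEq V] (F : SimpleGraph V) (hF : F.IsAcyclic)
    (y : V → ℝ) {r u v : V} (a : F.Walk r u) (ha : a.IsPath) (b : F.Walk r v) (hb : b.IsPath)
    (h : F.Adj u v) (hu : v ∉ a.support) :
    b.penultimate = u ∧
      ∑ t ∈ b.support.toFinset, y t = ∑ t ∈ a.support.toFinset, y t + y v := by
  have hc : (a.concat h).IsPath := ha.concat hu h
  have e : b = a.concat h := by
    have := hF.path_unique ⟨b, hb⟩ ⟨a.concat h, hc⟩
    exact congrArg Subtype.val this
  subst e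
  refine ⟨by simp, ?_⟩
  rw [Walk.support_concat, List.toFinset_append, Finset.sum_union]
  · simp
  · simpa using hu

lemma fmc_adj {V : Type*} [DecidableEq V] (F : SimpleGraph V) (hF : F.IsAcyclic)
    (y : V → ℝ) {r r' u v : V} (hr : r = r') (a : F.Walk r u) (ha : a.IsPath)
    (b : F.Walk r' v) (hb : b.IsPath) (h : F.Adj u v) :
    (b.penultimate = u ∧
      ∑ t ∈ b.support.toFinset, y t = ∑ t ∈ a.support.toFinset, y t + y v) ∨
    (a.penultimate = v ∧
      ∑ t ∈ a.support.toFinset, y t = ∑ t ∈ b.support.toFinset, y t + y u) := by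
  subst hr
  by_cases hu : v ∈ a.support
  · right
    refine fmc_adj_aux F hF y b hb a ha h.symm ?_
    have e : b = a.takeUntil v hu := by
      have := hF.path_unique ⟨b, hb⟩ ⟨a.takeUntil v hu, ha.takeUntil hu⟩
      exact congrArg Subtype.val this
    rw [e]
    exact Walk.endpoint_notMem_support_takeUntil ha hu h.ne
  · left
    exact fmc_adj_aux F hF y a ha b hb h hu

lemma fmc_parent {V : Type*} [DecidableEq V] (F : SimpleGraph V) (hF : F.IsAcyclic)
    (y : V → ℝ) : ∃ (p : V → V) (D : V → ℝ), ∀ u v, F.Adj u v →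
      (p v = u ∧ D v = D u + y v) ∨ (p u = v ∧ D u = D v + y u) := by
  have hq : ∀ v, ∃ q : F.Walk (F.connectedComponentMk v).out v, q.IsPath := by
    intro v
    have : F.Reachable (F.connectedComponentMk v).out v :=
      ConnectedComponent.exact (Quot.out_eq _)
    exact this.exists_isPath
  choose q hq using hq
  refine ⟨fun v => (q v).penultimate, fun v => ∑ t ∈ (q v).support.toFinset, y t, ?_⟩
  intro u v h
  refine fmc_adj F hF y ?_ (q u) (hq u) (q v) (hq v) h
  rw [ConnectedComponent.sound h.reachable]

lemma fmc_sum_cons {V : Type*} [DecidableEq V] (F : SimpleGraph V) (y : V → ℝ)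
    {u v t : V} (h : F.Adj u v) (P : F.Walk v t) (hu : u ∉ P.support) :
    ∑ t ∈ (Walk.cons h P).support.toFinset, y t = y u + ∑ t ∈ P.support.toFinset, y t := by
  rw [Walk.support_cons, List.toFinset_cons, Finset.sum_insert (by simpa using hu)]

lemma fmc_down {V : Type*} [DecidableEq V] (F : SimpleGraph V)
    (y : V → ℝ) (p : V → V) (D : V → ℝ) (hp : ∀ u v, F.Adj u v →
      (p v = u ∧ D v = D u + y v) ∨ (p u = v ∧ D u = D v + y u)) (f : ℝ → ℤ)
    {u v : V} (P : F.Walk u v) (hP : P.IsPath)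
    (hpar : ∀ t ∈ P.support, F.Adj u t → p u ≠ t)
    (hm : ∀ t ∈ P.support, f (D t) = f (D t - y t)) :
    f (D v) = f (D u - y u) ∧ ∑ t ∈ P.support.toFinset, y t = D v - (D u - y u) := by
  induction P with
  | nil => exact ⟨hm _ (by simp), by simp⟩
  | @cons u u' v h P ih =>
    rw [Walk.cons_isPath_iff] at hP
    rw [fmc_sum_cons F y h P hP.2]
    have h1 : p u' = u ∧ D u' = D u + y u' := by
      rcases hp u u' h with h1 | h1
      · exact h1
      · exact absurd h1.1 (hpar u' (by simp) h)
    obtain ⟨i1, i2⟩ := ih hP.1 (by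
      rintro t ht - e
      rw [h1.1] at e
      exact hP.2 (e ▸ ht)) (fun t ht => hm t (by simp [ht]))
    have h2 := hm u (by simp)
    have h3 : D u' - y u' = D u := by linarith [h1.2]
    refine ⟨by rw [i1, h3, h2], by rw [i2]; linarith⟩

lemma fmc_path {V : Type*} [DecidableEq V] (F : SimpleGraph V)
    (y : V → ℝ) (p : V → V) (D : V → ℝ) (hp : ∀ u v, F.Adj u v →
      (p v = u ∧ D v = D u + y v) ∨ (p u = v ∧ D u = D v + y u)) (f : ℝ → ℤ)
    {u v : V} (P : F.Walk u v) (hP : P.IsPath)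
    (hm : ∀ t ∈ P.support, f (D t) = f (D t - y t)) :
    ∃ a, f (D u) = f (D a - y a) ∧ f (D v) = f (D a - y a) ∧
      ∑ t ∈ P.support.toFinset, y t = (D u - (D a - y a)) + (D v - (D a - y a)) - y a := by
  induction P with
  | @nil u => exact ⟨u, hm _ (by simp), hm _ (by simp), by simp⟩
  | @cons u u' v h P ih =>
    have hP' := hP
    rw [Walk.cons_isPath_iff] at hP
    have h2 := hm u (by simp)
    rcases hp u u' h with h1 | h1
    · obtain ⟨i1, i2⟩ := fmc_down F y p D hp f P hP.1 (by
        rintro t ht - e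
        rw [h1.1] at e
        exact hP.2 (e ▸ ht)) (fun t ht => hm t (by simp [ht]))
      have h3 : D u' - y u' = D u := by linarith [h1.2]
      refine ⟨u, h2, by rw [i1, h3, h2], ?_⟩
      rw [fmc_sum_cons F y h P hP.2, i2]
      linarith
    · obtain ⟨a, i1, i2, i3⟩ := ih hP.1 (fun t ht => hm t (by simp [ht]))
      have h3 : D u - y u = D u' := by linarith [h1.2]
      refine ⟨a, by rw [h2, h3, i1], i2, ?_⟩
      rw [fmc_sum_cons F y h P hP.2, i3]
      linarith

lemma fmc_fract (a b : ℝ) : IntervalIntegrable (fun t : ℝ => Int.fract t) volume a b := by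
  refine (intervalIntegrable_const (c := (1 : ℝ))).mono_fun
    measurable_fract.aestronglyMeasurable ?_
  refine Filter.Eventually.of_forall fun t => ?_
  simp only [Real.norm_eq_abs, abs_one]
  rw [abs_of_nonneg (Int.fract_nonneg t)]
  exact (Int.fract_lt_one t).le

lemma fmc_int (a : ℝ) : IntervalIntegrable (fun θ : ℝ => ((⌊a + θ⌋ : ℤ) : ℝ)) volume 0 1 ∧
    ∫ θ in (0:ℝ)..1, ((⌊a + θ⌋ : ℤ) : ℝ) = a := by
  have e : (fun t : ℝ => ((⌊t⌋ : ℤ) : ℝ)) = fun t => t - Int.fract t := by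
    funext t; exact (Int.self_sub_fract t).symm
  have hid : ∀ a b : ℝ, IntervalIntegrable (fun t : ℝ => t) volume a b :=
    fun a b => continuous_id.intervalIntegrable a b
  have h1 : ∀ a b : ℝ, IntervalIntegrable (fun t : ℝ => ((⌊t⌋ : ℤ) : ℝ)) volume a b := by
    intro a b
    rw [e]
    exact (hid a b).sub (fmc_fract a b)
  constructor
  · have := (h1 a (a + 1)).comp_add_left a
    simpa using this
  · rw [intervalIntegral.integral_comp_add_left (fun t : ℝ => ((⌊t⌋ : ℤ) : ℝ)) a, e,
      intervalIntegral.integral_sub (hid _ _) (fmc_fract _ _)]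
    have hper : Function.Periodic (fun t : ℝ => Int.fract t) 1 := fun t => Int.fract_add_one t
    have h2 := hper.intervalIntegral_add_eq a 0
    have h3 : ∫ t in (0:ℝ)..1, Int.fract t = ∫ t in (0:ℝ)..1, t := by
      rw [intervalIntegral.integral_of_le zero_le_one, intervalIntegral.integral_of_le zero_le_one,
        ← integral_Ico_eq_integral_Ioc, ← integral_Ico_eq_integral_Ioc]
      refine setIntegral_congr_fun measurableSet_Ico fun t ht => ?_
      exact Int.fract_eq_self.2 ht
    simp only [add_zero, zero_add] at h2 ⊢
    rw [h2, h3, integral_id, integral_id]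
    ring

lemma fmc_avg {V : Type*} [Fintype V] (w y D : V → ℝ) :
    ∃ θ : ℝ, ∑ v, w v * (((⌊D v + θ⌋ : ℤ) : ℝ) - ((⌊D v - y v + θ⌋ : ℤ) : ℝ)) ≤
      ∑ v, w v * y v := by
  have hI : ∀ v, IntervalIntegrable (fun θ : ℝ =>
      w v * (((⌊D v + θ⌋ : ℤ) : ℝ) - ((⌊D v - y v + θ⌋ : ℤ) : ℝ))) volume 0 1 :=
    fun v => ((fmc_int (D v)).1.sub (fmc_int (D v - y v)).1).const_mul _
  have hS : IntervalIntegrable (fun θ : ℝ =>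
      ∑ v, w v * (((⌊D v + θ⌋ : ℤ) : ℝ) - ((⌊D v - y v + θ⌋ : ℤ) : ℝ))) volume 0 1 := by
    have := IntervalIntegrable.sum Finset.univ (fun v _ => hI v)
    have e : (fun θ : ℝ =>
        ∑ v, w v * (((⌊D v + θ⌋ : ℤ) : ℝ) - ((⌊D v - y v + θ⌋ : ℤ) : ℝ))) =
        ∑ v, fun θ : ℝ => w v * (((⌊D v + θ⌋ : ℤ) : ℝ) - ((⌊D v - y v + θ⌋ : ℤ) : ℝ)) := by
      funext θ
      simp
    rw [e]
    exact this
  have hint : ∫ θ in (0:ℝ)..1,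
      ∑ v, w v * (((⌊D v + θ⌋ : ℤ) : ℝ) - ((⌊D v - y v + θ⌋ : ℤ) : ℝ)) = ∑ v, w v * y v := by
    rw [intervalIntegral.integral_finsetSum (fun v _ => hI v)]
    refine Finset.sum_congr rfl fun v _ => ?_
    rw [intervalIntegral.integral_const_mul,
      intervalIntegral.integral_sub (fmc_int (D v)).1 (fmc_int (D v - y v)).1,
      (fmc_int (D v)).2, (fmc_int (D v - y v)).2]
    ring
  by_contra! hcon
  have h := intervalIntegral.intervalIntegral_pos_of_pos_on
    (hS.sub (intervalIntegrable_const (c := ∑ v, w v * y v)))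
    (fun θ _ => sub_pos.2 (hcon θ)) zero_lt_one
  rw [intervalIntegral.integral_sub hS intervalIntegrable_const, hint] at h
  simp at h

/-- Let `F` be a forest with vertex weights `w : V → ℕ` and let `𝒫` be a
finite family of simple paths in `F` (indexed by a finite type `ι`). If `x : V → ℝ` is a
fractional solution of the multicut LP, then there is a multicut `S` of weight at most
`2 · Σ_v w(v)·x(v)`. -/
theorem forest_multicut_two_approx
    {V : Type*} [Fintype V] [DecidableEq V]
    (F : SimpleGraph V) (hF : F.IsAcyclic)
    (w : V → ℕ)
    {ι : Type*} [Fintype ι] (e₁ e₂ : ι → V)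
    (P : ∀ i : ι, F.Walk (e₁ i) (e₂ i)) (hP : ∀ i, (P i).IsPath)
    (x : V → ℝ)
    (hx0 : ∀ v, 0 ≤ x v) (hx1 : ∀ v, x v ≤ 1)
    (hcov : ∀ i, 1 ≤ ∑ v ∈ (P i).support.toFinset, x v) :
    ∃ S : Finset V,
      (∀ i, ∃ v ∈ S, v ∈ (P i).support) ∧
      (∑ v ∈ S, (w v : ℝ)) ≤ 2 * ∑ v : V, (w v : ℝ) * x v := by
  set y : V → ℝ := fun v => 2 * x v with hy
  obtain ⟨p, D, hp⟩ := fmc_parent F hF y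
  obtain ⟨θ, hθ⟩ := fmc_avg (fun v => (w v : ℝ)) y D
  have hmono : ∀ v, ⌊D v - y v + θ⌋ ≤ ⌊D v + θ⌋ := by
    intro v
    apply Int.floor_le_floor
    have := hx0 v
    simp only [hy]
    linarith
  refine ⟨Finset.univ.filter fun v => ⌊D v - y v + θ⌋ < ⌊D v + θ⌋, ?_, ?_⟩
  · intro i
    by_contra! hcon
    obtain ⟨a, i1, i2, i3⟩ := fmc_path F y p D hp (fun t => ⌊t + θ⌋) (P i) (hP i) (by
      intro t ht
      by_contra hne
      refine hcon t ?_ ht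
      simp only [Finset.mem_filter, Finset.mem_univ, true_and]
      exact lt_of_le_of_ne (hmono t) (Ne.symm hne))
    have hsum : 2 ≤ ∑ t ∈ (P i).support.toFinset, y t := by
      simp only [hy]
      rw [← Finset.mul_sum]
      linarith [hcov i]
    have hya : 0 ≤ y a := by simp only [hy]; linarith [hx0 a]
    have key : ∀ b c : ℝ, ⌊b + θ⌋ = ⌊c + θ⌋ → b - c < 1 := by
      intro b c hbc
      have := Int.abs_sub_lt_one_of_floor_eq_floor hbc
      have := (abs_lt.1 this).2
      linarith
    have k1 := key _ _ i1
    have k2 := key _ _ i2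
    linarith
  · calc _ ≤ ∑ v, (w v : ℝ) * (((⌊D v + θ⌋ : ℤ) : ℝ) - ((⌊D v - y v + θ⌋ : ℤ) : ℝ)) := by
          rw [Finset.sum_filter]
          refine Finset.sum_le_sum fun v _ => ?_
          have hw : (0 : ℝ) ≤ w v := Nat.cast_nonneg _
          split_ifs with hlt
          · have h1 : ((⌊D v - y v + θ⌋ : ℤ) : ℝ) + 1 ≤ ((⌊D v + θ⌋ : ℤ) : ℝ) := by
              exact_mod_cast hlt
            nlinarith
          · have h1 : ((⌊D v - y v + θ⌋ : ℤ) : ℝ) ≤ ((⌊D v + θ⌋ : ℤ) : ℝ) := by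
              exact_mod_cast hmono v
            exact mul_nonneg hw (by linarith)
      _ ≤ _ := hθ
      _ = _ := by
          rw [Finset.mul_sum]
          refine Finset.sum_congr rfl fun v _ => ?_
          simp only [hy]
          ring
end

section
/- Let G be a finite simple chordal graph with vertex weights w : V(G) → ℕ and terminal pairs (s_1,t_1), …, (s_ℓ,t_ℓ). Suppose x : V(G) → ℝ satisfies 0 ≤ x_v ≤ 1 for every vertex v and Σ_{v ∈ V(P)} x_v ≥ 1 for every index i and every simple path P in G from s_i to t_i. Then there exists a set S ⊆ V(G) such that for every i the graph G − S contains no path from s_i to t_i, and Σ_{v ∈ S} w(v) ≤ 4 · Σ_{v ∈ V(G)} w(v)·x_v. -/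
/-- A finite simple graph is chordal if every cycle with at least 4 vertices has a chord,
i.e. an edge of the graph joining two vertices of the cycle that are not consecutive on the
cycle (equivalently, an edge between cycle vertices that is not an edge of the cycle). -/
def IsChordal {V : Type*} (G : SimpleGraph V) : Prop :=
  ∀ ⦃v : V⦄ (c : G.Walk v v), c.IsCycle → 4 ≤ c.length →
    ∃ a b : V, a ∈ c.support ∧ b ∈ c.support ∧ G.Adj a b ∧ s(a, b) ∉ c.edges

namespace ChordalMC

open SimpleGraph

variable {V : Type*}

/-- Total weight of a walk (with multiplicity). -/
noncomputable def F {G : SimpleGraph V} (y : V → ℝ) {a b : V} (p : G.Walk a b) : ℝ :=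
  (p.support.map y).sum

lemma F_nil {G : SimpleGraph V} (y : V → ℝ) (a : V) :
    F y (Walk.nil : G.Walk a a) = y a := by simp [F]

lemma F_cons {G : SimpleGraph V} (y : V → ℝ) {a b c : V} (h : G.Adj a b) (p : G.Walk b c) :
    F y (Walk.cons h p) = y a + F y p := by simp [F]

lemma F_append {G : SimpleGraph V} (y : V → ℝ) {a b c : V} (p : G.Walk a b) (q : G.Walk b c) :
    F y (p.append q) = F y p + F y q - y b := by
  induction p with
  | nil => simp [F_nil]
  | cons h p ih => rw [Walk.cons_append, F_cons, F_cons, ih]; ring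

lemma F_reverse {G : SimpleGraph V} (y : V → ℝ) {a b : V} (p : G.Walk a b) :
    F y p.reverse = F y p := by
  simp [F, List.sum_reverse, List.map_reverse]

lemma toFinset_sum_le [DecidableEq V] (y : V → ℝ) (hy : ∀ v, 0 ≤ y v) (l : List V) :
    ∑ v ∈ l.toFinset, y v ≤ (l.map y).sum := by
  induction l with
  | nil => simp
  | cons a l ih =>
    rw [List.toFinset_cons, List.map_cons, List.sum_cons]
    by_cases h : a ∈ l.toFinset
    · rw [Finset.insert_eq_of_mem h]; linarith [hy a]
    · rw [Finset.sum_insert h]; linarith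

lemma sum_path [DecidableEq V] {G : SimpleGraph V} (y : V → ℝ) {a b : V} (p : G.Walk a b)
    (hp : p.IsPath) : ∑ v ∈ p.support.toFinset, y v = F y p := by
  rw [F, List.sum_toFinset _ hp.support_nodup]

lemma F_bypass [DecidableEq V] {G : SimpleGraph V} (y : V → ℝ) (hy : ∀ v, 0 ≤ y v) {a b : V}
    (p : G.Walk a b) : F y p.bypass ≤ F y p := by
  rw [← sum_path y _ p.bypass_isPath]
  refine le_trans ?_ (toFinset_sum_le y hy p.support)
  apply Finset.sum_le_sum_of_subset_of_nonneg
  · intro z hz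
    simp only [List.mem_toFinset] at hz ⊢
    exact p.support_bypass_subset_support hz
  · intros; exact hy _

lemma exists_min_walk [Fintype V] (G : SimpleGraph V) (y : V → ℝ)
    (hy : ∀ v, 0 ≤ y v) {a b : V} (h : G.Reachable a b) :
    ∃ p : G.Walk a b, ∀ q : G.Walk a b, F y p ≤ F y q := by
  classical
  obtain ⟨q⟩ := h
  have : Nonempty (G.Path a b) := ⟨q.toPath⟩
  obtain ⟨p, hp⟩ := Finite.exists_min (fun p : G.Path a b => F y p.1)
  exact ⟨p.1, fun q => (hp q.toPath).trans (F_bypass y hy q)⟩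

/-- Existence of the distance function. -/
lemma exists_dist [Fintype V] (G : SimpleGraph V) (y : V → ℝ) (hy : ∀ v, 0 ≤ y v) :
    ∃ (rt : V → V) (d : V → ℝ), (∀ a b, G.Adj a b → rt a = rt b) ∧ (∀ v, d (rt v) = 0) ∧
      (∀ a b, G.Adj a b → d b ≤ d a + y b) ∧
      (∀ v, ∃ p : G.Walk (rt v) v, F y p ≤ d v + y (rt v)) := by
  classical
  let rt : V → V := fun v => (G.connectedComponentMk v).out
  have hrt : ∀ v, G.Reachable (rt v) v := fun v =>
    ConnectedComponent.exact (Quot.out_eq (G.connectedComponentMk v))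
  have hadj : ∀ a b, G.Reachable a b → rt a = rt b := by
    intro a b h
    simp only [rt]
    rw [ConnectedComponent.sound h]
  choose p hp using fun v => exists_min_walk G y hy (hrt v)
  have key : ∀ v r, r = rt v → ∀ q : G.Walk r v, F y (p v) ≤ F y q := by
    rintro v r rfl q; exact hp v q
  refine ⟨rt, fun v => F y (p v) - y (rt v), fun a b h => hadj a b h.reachable, ?_, ?_, ?_⟩
  · intro v
    have e : rt (rt v) = rt v := hadj _ _ (hrt v)
    have h1 := key (rt v) (rt v) e.symm Walk.nil
    rw [F_nil] at h1
    have h2 : y (rt (rt v)) ≤ F y (p (rt v)) := by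
      generalize p (rt v) = q
      have : ∀ {a b : V} (q : G.Walk a b), y a ≤ F y q := by
        intro a b q
        cases q with
        | nil => rw [F_nil]
        | cons h q =>
          rw [F_cons]
          have : 0 ≤ F y q := List.sum_nonneg (by simp only [List.mem_map]; rintro _ ⟨v, _, rfl⟩; exact hy v)
          linarith
      exact this q
    have e2 : y (rt (rt v)) = y (rt v) := by rw [e]
    simp only
    linarith
  · intro a b h
    have e := hadj a b h.reachable
    have h1 := key b (rt a) e ((p a).append (Walk.cons h Walk.nil))
    rw [F_append, F_cons, F_nil] at h1
    simp only [← e]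
    linarith
  · intro v
    exact ⟨p v, by linarith⟩

section geo

variable {G : SimpleGraph V} {y d : V → ℝ}

lemma d_le (hst : ∀ a b, G.Adj a b → d b ≤ d a + y b) {a v : V} (p : G.Walk a v) :
    d v ≤ d a + F y p - y a := by
  induction p with
  | nil => rw [F_nil]; linarith
  | cons h p ih => rw [F_cons]; linarith [hst _ _ h]

lemma geo_step (hst : ∀ a b, G.Adj a b → d b ≤ d a + y b) {a b v : V} (h : G.Adj a b)
    (p : G.Walk b v) (hp : F y (Walk.cons h p) ≤ d v - d a + y a) :
    d b = d a + y b ∧ F y p ≤ d v - d b + y b := by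
  rw [F_cons] at hp
  have h1 := d_le hst p
  have h2 := hst _ _ h
  constructor <;> linarith

lemma geo_mono (hy : ∀ v, 0 ≤ y v) (hst : ∀ a b, G.Adj a b → d b ≤ d a + y b)
    {a v : V} (p : G.Walk a v) (hp : F y p ≤ d v - d a + y a) :
    ∀ z ∈ p.support, z = a ∨ d a ≤ d z - y z := by
  induction p with
  | nil => intro z hz; left; simpa using hz
  | @cons a b v h p ih =>
    obtain ⟨h1, h2⟩ := geo_step hst h p hp
    intro z hz
    rw [Walk.support_cons, List.mem_cons] at hz
    rcases hz with rfl | hz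
    · left; rfl
    · right
      rcases ih h2 z hz with rfl | h3
      · linarith
      · linarith [hy b]

lemma geo_mono2 (hy : ∀ v, 0 ≤ y v) (hst : ∀ a b, G.Adj a b → d b ≤ d a + y b)
    {a v : V} (p : G.Walk a v) (hp : F y p ≤ d v - d a + y a) :
    ∀ z ∈ p.support, z = v ∨ d z ≤ d v - y v := by
  induction p with
  | nil => intro z hz; left; simpa using hz
  | @cons a b v h p ih =>
    obtain ⟨h1, h2⟩ := geo_step hst h p hp
    intro z hz
    rw [Walk.support_cons, List.mem_cons] at hz
    rcases hz with rfl | hz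
    · right
      rcases geo_mono hy hst p h2 v p.end_mem_support with rfl | h3
      · linarith
      · linarith [hy b]
    · exact ih h2 z hz

lemma geo_split (hy : ∀ v, 0 ≤ y v) (hst : ∀ a b, G.Adj a b → d b ≤ d a + y b) (τ : ℝ)
    {a v : V} (p : G.Walk a v) (hp : F y p ≤ d v - d a + y a) (ha : d a - y a ≤ τ)
    (hv : τ < d v - y v) :
    ∃ (u : V) (q : G.Walk u v), d u - y u ≤ τ ∧ τ < d u ∧ F y q ≤ d v - d u + y u ∧
      ∀ z ∈ q.support, z = u ∨ τ < d z - y z := by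
  induction p with
  | nil => linarith
  | @cons a b v h p ih =>
    obtain ⟨h1, h2⟩ := geo_step hst h p hp
    by_cases hb : d b - y b ≤ τ
    · exact ih h2 hb hv
    · push Not at hb
      refine ⟨a, Walk.cons h p, ha, by linarith, hp, ?_⟩
      intro z hz
      rcases geo_mono hy hst _ hp z hz with h3 | h3
      · left; exact h3
      · right; linarith

end geo

lemma exists_chordless (G : SimpleGraph V) (Q : V → Prop) {u v : V} (p : G.Walk u v)
    (hp : ∀ z ∈ p.support, Q z) :
    ∃ q : G.Walk u v, (∀ z ∈ q.support, Q z) ∧ q.IsPath ∧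
      ∀ a ∈ q.support, ∀ b ∈ q.support, G.Adj a b → s(a, b) ∈ q.edges := by
  classical
  have hex : ∃ n, ∃ q : G.Walk u v, (∀ z ∈ q.support, Q z) ∧ q.length = n := ⟨_, p, hp, rfl⟩
  obtain ⟨q, hq, hn⟩ := Nat.find_spec hex
  have hmin : ∀ q' : G.Walk u v, (∀ z ∈ q'.support, Q z) → q.length ≤ q'.length := by
    intro q' hq'
    rw [hn]
    exact Nat.find_min' hex ⟨q', hq', rfl⟩
  have main : ∀ (a b : V) (q1 : G.Walk u a) (m : G.Walk a b) (q3 : G.Walk b v),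
      q = q1.append (m.append q3) → G.Adj a b → s(a, b) ∈ q.edges := by
    intro a b q1 m q3 e hab
    have h1 := hmin (q1.append (Walk.cons hab q3)) (by
      intro z hz
      apply hq
      rw [e]
      simp only [Walk.mem_support_append_iff, Walk.support_cons, List.mem_cons] at hz ⊢
      rcases hz with hz | rfl | hz
      · tauto
      · left; simp
      · tauto)
    rw [e] at h1
    simp only [Walk.length_append, Walk.length_cons] at h1
    rw [e]
    simp only [Walk.edges_append, List.mem_append]
    right; left
    cases m with
    | nil => exact absurd hab (G.loopless.irrefl _)
    | cons h m =>
      cases m with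
      | nil => simp
      | cons h' m => simp at h1; omega
  refine ⟨q, hq, ?_, ?_⟩
  · have h1 := hmin q.bypass (fun z hz => hq z (q.support_bypass_subset_support hz))
    have h2 : q.bypass = q := by
      exact Walk.bypass_eq_self_of_length_le_length_bypass q h1
    rw [← h2]; exact q.bypass_isPath
  · intro a ha b hb hab
    obtain ⟨q1, q2, e⟩ := Walk.mem_support_iff_exists_append.1 ha
    rw [e, Walk.mem_support_append_iff] at hb
    rcases hb with hb | hb
    · obtain ⟨r1, r2, e'⟩ := Walk.mem_support_iff_exists_append.1 hb
      rw [Sym2.eq_swap]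
      refine main b a r1 r2 q2 ?_ hab.symm
      rw [e, e', Walk.append_assoc]
    · obtain ⟨r1, r2, e'⟩ := Walk.mem_support_iff_exists_append.1 hb
      refine main a b q1 r1 r2 ?_ hab
      rw [e, e']

lemma clique_sep {G : SimpleGraph V} (hG : IsChordal G) (A B : V → Prop)
    (hAB : ∀ a b, A a → B b → ¬ G.Adj a b) (hd : ∀ a, A a → ¬ B a) {u v : V} (huv : u ≠ v)
    (huA : ¬ A u) (huB : ¬ B u) (hvA : ¬ A v) (hvB : ¬ B v)
    (p : G.Walk u v) (hp : ∀ z ∈ p.support, z = u ∨ z = v ∨ A z)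
    (q : G.Walk u v) (hq : ∀ z ∈ q.support, z = u ∨ z = v ∨ B z) : G.Adj u v := by
  by_contra hn
  obtain ⟨p, hpA, hpp, hpc⟩ := exists_chordless G _ p hp
  obtain ⟨q, hqB, hqp, hqc⟩ := exists_chordless G _ q hq
  have hlen : ∀ r : G.Walk u v, 2 ≤ r.length := by
    intro r
    cases r with
    | nil => exact absurd rfl huv
    | cons h r =>
      cases r with
      | nil => exact absurd h hn
      | cons h' r => simp
  have hl1 := hlen p
  have hl2 := hlen q
  have hqr : q.reverse.IsPath := hqp.reverse
  have hcyc : (p.append q.reverse).IsCycle := by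
    cases p with
    | nil => exact absurd rfl huv
    | @cons _ b _ h p =>
      rw [Walk.cons_append, Walk.cons_isCycle_iff]
      rw [Walk.cons_isPath_iff] at hpp
      constructor
      · rw [Walk.isPath_def, Walk.support_append, List.nodup_append]
        refine ⟨hpp.1.support_nodup, hqr.support_nodup.tail, ?_⟩
        rintro z hz z' hz' rfl
        have hzv : z ≠ v := by
          rintro rfl
          have := hqr.support_nodup
          rw [← Walk.cons_tail_support, List.nodup_cons] at this
          exact this.1 hz'
        have hzq : z ∈ q.support := by
          have := List.mem_of_mem_tail hz'
          simpa using this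
        have h1 := hpA z (by rw [Walk.support_cons]; exact List.mem_cons_of_mem _ hz)
        have h2 := hqB z hzq
        have hzu : z ≠ u := by rintro rfl; exact hpp.2 hz
        have := hd z
        tauto
      · rw [Walk.edges_append, List.mem_append, not_or]
        constructor
        · intro he
          exact hpp.2 (Walk.fst_mem_support_of_mem_edges _ he)
        · intro he
          have hb : b ∈ q.support := by
            have := Walk.snd_mem_support_of_mem_edges _ he
            simpa using this
          have h1 := hpA b (by simp)
          have h2 := hqB b hb
          have hbv : b ≠ v := by rintro rfl; exact hn h
          have hbu : b ≠ u := h.ne'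
          have := hd b
          tauto
  obtain ⟨a, b, ha, hb, hab, hne⟩ := hG _ hcyc (by simp; omega)
  rw [Walk.edges_append, List.mem_append, not_or, Walk.edges_reverse, List.mem_reverse] at hne
  rw [Walk.mem_support_append_iff, Walk.support_reverse, List.mem_reverse] at ha hb
  have hcross : ∀ a b, a ∈ p.support → b ∈ q.support → G.Adj a b →
      s(a, b) ∈ p.edges ∨ s(a, b) ∈ q.edges := by
    intro a b ha hb hab
    rcases hpA a ha with h | h | h
    · right; exact hqc a (h ▸ q.start_mem_support) b hb hab
    · right; exact hqc a (h ▸ q.end_mem_support) b hb hab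
    · rcases hqB b hb with h' | h' | h'
      · left; exact hpc a ha b (h' ▸ p.start_mem_support) hab
      · left; exact hpc a ha b (h' ▸ p.end_mem_support) hab
      · exact absurd hab (hAB a b h h')
  rcases ha with ha | ha <;> rcases hb with hb | hb
  · exact hne.1 (hpc a ha b hb hab)
  · rcases hcross a b ha hb hab with h | h
    · exact hne.1 h
    · exact hne.2 h
  · rcases hcross b a hb ha hab.symm with h | h
    · rw [Sym2.eq_swap] at h; exact hne.1 h
    · rw [Sym2.eq_swap] at h; exact hne.2 h
  · exact hne.2 (hqc a ha b hb hab)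

/-- The subgraph of edges between vertices of weight less than one. -/
def small (G : SimpleGraph V) (y : V → ℝ) : SimpleGraph V where
  Adj a b := G.Adj a b ∧ y a < 1 ∧ y b < 1
  symm := ⟨fun _ _ h => ⟨h.1.symm, h.2.2, h.2.1⟩⟩
  loopless := ⟨fun _ h => G.loopless.irrefl _ h.1⟩

lemma small_le (G : SimpleGraph V) (y : V → ℝ) : small G y ≤ G := fun _ _ h => h.1

lemma small_support {G : SimpleGraph V} {y : V → ℝ} {a b : V} (p : (small G y).Walk a b)
    (ha : y a < 1) : ∀ z ∈ p.support, y z < 1 := by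
  induction p with
  | nil => intro z hz; simp at hz; rw [hz]; exact ha
  | cons h p ih =>
    intro z hz
    rw [Walk.support_cons, List.mem_cons] at hz
    rcases hz with rfl | hz
    · exact ha
    · exact ih h.2.2 z hz

lemma small_chordal {G : SimpleGraph V} (hG : IsChordal G) (y : V → ℝ) :
    IsChordal (small G y) := by
  intro v c hc hl
  have hv : y v < 1 := by
    cases c with
    | nil => simp at hl
    | cons h p => exact h.2.1
  obtain ⟨a, b, ha, hb, hab, hne⟩ := hG (c.mapLe (small_le G y)) (hc.mapLe _) (by
    rwa [Walk.length_mapLe])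
  rw [Walk.support_mapLe_eq_support] at ha hb
  rw [Walk.edges_mapLe_eq_edges] at hne
  exact ⟨a, b, ha, hb, ⟨hab, small_support c hv a ha, small_support c hv b hb⟩, hne⟩

lemma exists_small_walk {G : SimpleGraph V} {y : V → ℝ} {a b : V} (p : G.Walk a b)
    (hp : ∀ z ∈ p.support, y z < 1) :
    ∃ q : (small G y).Walk a b, q.support = p.support := by
  induction p with
  | nil => exact ⟨Walk.nil, by simp⟩
  | cons h p ih =>
    obtain ⟨q, hq⟩ := ih (fun z hz => hp z (by simp [hz]))
    have h' : (small G y).Adj _ _ := ⟨h, hp _ (by simp), hp _ (by simp)⟩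
    exact ⟨Walk.cons h' q, by rw [Walk.support_cons, Walk.support_cons, hq]⟩

lemma const_on_walk {G : SimpleGraph V} {α : Type*} (f : V → α) {a b : V} (p : G.Walk a b)
    (h : ∀ u ∈ p.support, ∀ v ∈ p.support, G.Adj u v → f u = f v) :
    ∀ z ∈ p.support, f z = f a := by
  induction p with
  | nil => intro z hz; simp at hz; rw [hz]
  | cons hab p ih =>
    intro z hz
    rw [Walk.support_cons, List.mem_cons] at hz
    rcases hz with rfl | hz
    · rfl
    · rw [ih (fun u hu v hv => h u (by simp [hu]) v (by simp [hv])) z hz]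
      exact h _ (by simp) _ (by simp) hab.symm

lemma short_walk {G : SimpleGraph V} (hG : IsChordal G) {y d : V → ℝ} {rt : V → V}
    (hy : ∀ v, 0 ≤ y v) (hrt : ∀ a b, G.Adj a b → rt a = rt b) (h0 : ∀ v, d (rt v) = 0)
    (hst : ∀ a b, G.Adj a b → d b ≤ d a + y b)
    (hat : ∀ v, ∃ p : G.Walk (rt v) v, F y p ≤ d v + y (rt v))
    (φ : ℝ) (hφ0 : 0 ≤ φ) (hφ1 : φ ≤ 1) {s t : V} (P : G.Walk s t)
    (hsm : ∀ v, G.Reachable s v → y v < 1)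
    (hP : ∀ z ∈ P.support, y z ≤ Int.fract (φ - (d z - y z))) :
    ∃ Q : G.Walk s t, F y Q < 4 := by
  have hrtR : ∀ a b, G.Walk a b → rt a = rt b := by
    intro a b p
    exact (const_on_walk rt p (fun u _ v _ h => hrt u v h) b p.end_mem_support).symm
  let c : V → ℤ := fun z => ⌊φ - (d z - y z)⌋
  have hc1 : ∀ z, φ - (d z - y z) - 1 < c z := fun z => Int.sub_one_lt_floor _
  have hc2 : ∀ z ∈ P.support, d z ≤ φ - c z := by
    intro z hz
    have := hP z hz
    rw [Int.fract] at this
    simp only [c]; linarith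
  have hle : ∀ u ∈ P.support, ∀ v, G.Adj u v → c u ≤ c v := by
    intro u hu v h
    apply Int.le_floor.2
    have := hc2 u hu
    linarith [hst u v h]
  have hcc := const_on_walk c P (fun u hu v hv h =>
    le_antisymm (hle u hu v h) (hle v hv u h.symm))
  have hgeo : ∀ v, ∃ p : G.Walk (rt v) v, F y p ≤ d v - d (rt v) + y (rt v) := by
    intro v
    obtain ⟨p, hp⟩ := hat v
    exact ⟨p, by rw [h0 v]; linarith⟩
  have hs := P.start_mem_support
  have ht := P.end_mem_support
  have est : rt s = rt t := hrtR _ _ P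
  obtain ⟨ps, hps⟩ := hgeo s
  obtain ⟨pt, hpt⟩ : ∃ pt : G.Walk (rt s) t, F y pt ≤ d t - d (rt s) + y (rt s) := by
    rw [est]; exact hgeo t
  have hr0 := h0 s
  have hr1 : y (rt s) < 1 := hsm _ ps.reverse.reachable
  have hct := hcc t ht
  by_cases hk : 0 ≤ c s
  · refine ⟨ps.reverse.append pt, ?_⟩
    rw [F_append, F_reverse]
    have h1 := hc2 s hs
    have h2 := hc2 t ht
    rw [hct] at h2
    have : (0 : ℝ) ≤ c s := by exact_mod_cast hk
    linarith
  · have hk' : c s ≤ -1 := by omega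
    have hkr : (c s : ℝ) ≤ -1 := by exact_mod_cast hk'
    let τ : ℝ := φ - c s - 1
    have hτ : 0 ≤ τ := by simp only [τ]; linarith
    have hA : ∀ z ∈ P.support, τ < d z - y z := by
      intro z hz
      have h1 := hc1 z
      rw [hcc z hz] at h1
      simp only [τ]; linarith
    have hra : d (rt s) - y (rt s) ≤ τ := by linarith [hy (rt s)]
    obtain ⟨u, qu, hu1, hu2, hu3, hu4⟩ := geo_split hy hst τ ps hps hra (hA s hs)
    obtain ⟨v, qv, hv1, hv2, hv3, hv4⟩ := geo_split hy hst τ pt hpt hra (hA t ht)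
    have hdu := hc2 s hs
    have hdv := hc2 t ht
    rw [hct] at hdv
    have hyu : y u < 1 := hsm _ qu.reverse.reachable
    have hyv : y v < 1 := hsm _ (P.append qv.reverse).reachable
    by_cases huv : u = v
    · subst huv
      refine ⟨qu.reverse.append qv, ?_⟩
      rw [F_append, F_reverse]
      simp only [τ] at hu2
      linarith [hy u]
    · have hru : rt u = rt s := hrtR _ _ qu
      have hrv : rt v = rt s := (hrtR _ _ qv).trans est.symm
      obtain ⟨bu, hbu⟩ : ∃ p : G.Walk (rt s) u, ∀ z ∈ p.support, z = u ∨ d z ≤ τ := by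
        obtain ⟨p, hp⟩ := hgeo u
        rw [← hru]
        refine ⟨p, fun z hz => ?_⟩
        rcases geo_mono2 hy hst p hp z hz with h | h
        · left; exact h
        · right; linarith
      obtain ⟨bv, hbv⟩ : ∃ p : G.Walk (rt s) v, ∀ z ∈ p.support, z = v ∨ d z ≤ τ := by
        obtain ⟨p, hp⟩ := hgeo v
        rw [← hrv]
        refine ⟨p, fun z hz => ?_⟩
        rcases geo_mono2 hy hst p hp z hz with h | h
        · left; exact h
        · right; linarith
      have hadj : G.Adj u v := by
        refine clique_sep hG (fun z => τ < d z - y z) (fun z => d z ≤ τ) ?_ ?_ huv ?_ ?_ ?_ ?_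
          (qu.append (P.append qv.reverse)) ?_ (bu.reverse.append bv) ?_
        · intro a b ha hb hab
          have := hst b a hab.symm
          linarith
        · intro a ha hb
          linarith [hy a]
        · linarith
        · linarith
        · linarith
        · linarith
        · intro z hz
          simp only [Walk.mem_support_append_iff, Walk.support_reverse, List.mem_reverse] at hz
          rcases hz with hz | hz | hz
          · have := hu4 z hz; tauto
          · have := hA z hz; tauto
          · have := hv4 z hz; tauto
        · intro z hz
          simp only [Walk.mem_support_append_iff, Walk.support_reverse, List.mem_reverse] at hz
          rcases hz with hz | hz
          · have := hbu z hz; tauto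
          · have := hbv z hz; tauto
      refine ⟨qu.reverse.append (Walk.cons hadj qv), ?_⟩
      rw [F_append, F_reverse, F_cons]
      simp only [τ] at hu2 hv2
      linarith

open MeasureTheory in
lemma exists_phase [Fintype V] (w e y : V → ℝ) (hw : ∀ v, 0 ≤ w v) (hy : ∀ v, 0 ≤ y v) :
    ∃ φ : ℝ, 0 ≤ φ ∧ φ ≤ 1 ∧
      ∑ v, (if Int.fract (φ - e v) < y v then w v else 0) ≤ ∑ v, w v * y v := by
  classical
  let g : V → ℝ → ℝ := fun v φ => if Int.fract φ < y v then w v else 0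
  have hgm : ∀ v, Measurable (g v) := fun v =>
    Measurable.ite (measurableSet_lt measurable_fract measurable_const)
      measurable_const measurable_const
  have hgb : ∀ v φ, ‖g v φ‖ ≤ w v := by
    intro v φ
    simp only [g]
    split_ifs
    · rw [Real.norm_of_nonneg (hw v)]
    · simpa using hw v
  have hint : ∀ v c, IntegrableOn (fun φ => g v (φ - c)) (Set.Ioc 0 1) := by
    intro v c
    refine Measure.integrableOn_of_bounded (M := w v) (by simp) ?_ ?_
    · exact ((hgm v).comp (measurable_id.sub_const c)).aestronglyMeasurable
    · exact Filter.Eventually.of_forall (fun φ => hgb v _)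
  have hper : ∀ v, Function.Periodic (g v) 1 := by
    intro v φ
    simp only [g, Int.fract_add_one]
  have hval : ∀ v, ∫ φ in Set.Ioc (0:ℝ) 1, g v (φ - e v) ≤ w v * y v := by
    intro v
    rw [← intervalIntegral.integral_of_le zero_le_one, intervalIntegral.integral_comp_sub_right]
    have h1 := (hper v).intervalIntegral_add_eq (0 - e v) 0
    have e1 : (0 - e v) + 1 = 1 - e v := by ring
    rw [e1, zero_add] at h1
    rw [h1, intervalIntegral.integral_of_le zero_le_one, integral_Ioc_eq_integral_Ioo]
    have h2 : ∫ φ in Set.Ioo (0:ℝ) 1, g v φ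
        = ∫ φ in Set.Ioo (0:ℝ) 1, (Set.Iio (y v)).indicator (fun _ => w v) φ := by
      refine setIntegral_congr_fun measurableSet_Ioo ?_
      intro φ hφ
      simp only [g, Set.indicator, Set.mem_Iio]
      rw [Int.fract_eq_self.2 ⟨hφ.1.le, hφ.2⟩]
    rw [h2, setIntegral_indicator measurableSet_Iio, setIntegral_const, smul_eq_mul, mul_comm]
    refine mul_le_mul_of_nonneg_left ?_ (hw v)
    have h3 : Set.Ioo (0:ℝ) 1 ∩ Set.Iio (y v) ⊆ Set.Ioo 0 (y v) := fun z hz => ⟨hz.1.1, hz.2⟩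
    refine (measureReal_mono h3 (by simp)).trans ?_
    rw [Real.volume_real_Ioo_of_le (hy v)]
    linarith
  obtain ⟨φ, hφ, hle⟩ := exists_le_setAverage (μ := volume) (s := Set.Ioc (0:ℝ) 1)
    (f := fun φ => ∑ v, g v (φ - e v)) (by simp) (by simp)
    (integrable_finsetSum _ (fun v _ => hint v (e v)))
  refine ⟨φ, hφ.1.le, hφ.2, ?_⟩
  refine hle.trans ?_
  rw [setAverage_eq, integral_finsetSum _ (fun v _ => hint v (e v))]
  simp only [Real.volume_real_Ioc_of_le zero_le_one, sub_zero, inv_one, one_smul]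
  exact Finset.sum_le_sum (fun v _ => hval v)

end ChordalMC

/-- For a chordal graph with terminal pairs and a fractional multicut
solution `x`, there is a multicut `S` of weight at most `4 · Σ_v w(v)·x(v)`. -/
theorem chordal_multicut_four_approx
    {V : Type*} [Fintype V] [DecidableEq V]
    (G : SimpleGraph V) (hG : IsChordal G) (w : V → ℕ)
    {ℓ : ℕ} (s t : Fin ℓ → V)
    (x : V → ℝ) (hx0 : ∀ v, 0 ≤ x v) (hx1 : ∀ v, x v ≤ 1)
    (hcov : ∀ (i : Fin ℓ) (P : G.Walk (s i) (t i)), P.IsPath →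
      1 ≤ ∑ v ∈ P.support.toFinset, x v) :
    ∃ S : Finset V,
      (∀ (i : Fin ℓ) (P : G.Walk (s i) (t i)), P.IsPath → ∃ v ∈ S, v ∈ P.support) ∧
      (∑ v ∈ S, (w v : ℝ)) ≤ 4 * ∑ v : V, (w v : ℝ) * x v := by
  classical
  let y : V → ℝ := fun v => 4 * x v
  have hy : ∀ v, 0 ≤ y v := fun v => mul_nonneg (by norm_num) (hx0 v)
  let H := ChordalMC.small G y
  obtain ⟨rt, d, hrt, h0, hst, hat⟩ := ChordalMC.exists_dist H y hy
  obtain ⟨φ, hφ0, hφ1, hφ⟩ := ChordalMC.exists_phase (fun v => (w v : ℝ)) (fun v => d v - y v) y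
    (fun v => Nat.cast_nonneg _) hy
  refine ⟨Finset.univ.filter (fun v => Int.fract (φ - (d v - y v)) < y v), ?_, ?_⟩
  · intro i P hP
    by_contra hcon
    push Not at hcon
    have hcut : ∀ z ∈ P.support, y z ≤ Int.fract (φ - (d z - y z)) := by
      intro z hz
      by_contra h
      push Not at h
      exact hcon z (by simpa using h) hz
    have hsmall : ∀ z ∈ P.support, y z < 1 := fun z hz =>
      (hcut z hz).trans_lt (Int.fract_lt_one _)
    obtain ⟨P', hP'⟩ := ChordalMC.exists_small_walk P hsmall
    obtain ⟨Q, hQ⟩ := ChordalMC.short_walk (ChordalMC.small_chordal hG y) hy hrt h0 hst hat φ hφ0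
      hφ1 P' (by
        rintro v ⟨q⟩
        exact ChordalMC.small_support q (hsmall _ P.start_mem_support) v q.end_mem_support)
      (by rw [hP']; exact hcut)
    have h1 := hcov i (Q.mapLe (ChordalMC.small_le G y)).bypass (SimpleGraph.Walk.bypass_isPath _)
    rw [ChordalMC.sum_path _ _ (SimpleGraph.Walk.bypass_isPath _)] at h1
    have h2 := ChordalMC.F_bypass x hx0 (Q.mapLe (ChordalMC.small_le G y))
    have h3 : ChordalMC.F y Q = 4 * ChordalMC.F x (Q.mapLe (ChordalMC.small_le G y)) := by
      simp only [ChordalMC.F, SimpleGraph.Walk.support_mapLe_eq_support, y]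
      rw [List.sum_map_mul_left]
    linarith
  · rw [Finset.sum_filter]
    refine hφ.trans (le_of_eq ?_)
    rw [Finset.mul_sum]
    refine Finset.sum_congr rfl (fun v _ => ?_)
    simp only [y]; ring
end

section
/- Fix an integer r ≥ 2 and let G be a finite simple graph with m edges. Let G' be the graph obtained from G by the following construction (with ℓ = ⌈r/2⌉ + 1): for every edge e = {u,v} of G, delete e and add a path u, a^e_1, a^e_2, …, a^e_{r−1}, v on r−1 new internal vertices; add two new paths P^b_e on vertices b^e_1, …, b^e_ℓ and P^c_e on vertices c^e_1, …, c^e_ℓ together with the edges {a^e_1, b^e_1}, {a^e_{⌊r/2⌋}, b^e_ℓ}, {a^e_{⌈r/2⌉}, c^e_1}, {a^e_{r−1}, c^e_ℓ}; finally add a cycle X on r+1 new vertices x_1, …, x_{r+1} and add the edge {x_1, v} for every original vertex v ∈ V(G). Then for every integer k, the graph G has a vertex cover of size at most k if and only if G' has an r-fault tolerant feedback vertex set of size at most k + (r + 1) + m·(2ℓ + r − 1). -/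
namespace FTFVSHardness

/-- Vertex type of the constructed graph `G'`: original vertices, gadget vertices
(indexed by the oriented edge `p`, a tag `0`/`1`/`2` for the `a`/`b`/`c` paths, and a
positive index), and the cycle vertices `x_1, …, x_{r+1}`. -/
abbrev W (V : Type*) := V ⊕ ((V × V) × ℕ × ℕ) ⊕ ℕ

variable {V : Type*}

/-- An original vertex of `G`. -/
def vo (u : V) : W V := Sum.inl u
/-- The vertex `a^e_i` (for `1 ≤ i ≤ r−1`) of the gadget of the oriented edge `p`. -/
def va (p : V × V) (i : ℕ) : W V := Sum.inr (Sum.inl (p, 0, i))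
/-- The vertex `b^e_j` (for `1 ≤ j ≤ ℓ`) of the gadget of the oriented edge `p`. -/
def vb (p : V × V) (j : ℕ) : W V := Sum.inr (Sum.inl (p, 1, j))
/-- The vertex `c^e_j` (for `1 ≤ j ≤ ℓ`) of the gadget of the oriented edge `p`. -/
def vc (p : V × V) (j : ℕ) : W V := Sum.inr (Sum.inl (p, 2, j))
/-- The vertex `x_k` (for `1 ≤ k ≤ r+1`) of the cycle `X`. -/
def vx (k : ℕ) : W V := Sum.inr (Sum.inr k)

/-- The edge set of the constructed graph `G'`: for each oriented edge `p = (u,v) ∈ D`,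
the path `u, a^e_1, …, a^e_{r−1}, v`, the paths `P^b_e` on `b^e_1, …, b^e_ℓ` and `P^c_e`
on `c^e_1, …, c^e_ℓ`, the connector edges `{a^e_1, b^e_1}`, `{a^e_{⌊r/2⌋}, b^e_ℓ}`,
`{a^e_{⌈r/2⌉}, c^e_1}`, `{a^e_{r−1}, c^e_ℓ}`; the cycle `X` on `x_1, …, x_{r+1}`; and the
edges `{x_1, u}` for every original vertex `u`. -/
def gadgetEdges (r ℓ : ℕ) (D : Set (V × V)) : Set (Sym2 (W V)) :=
  {e | ∃ p ∈ D,
      e = s(vo p.1, va p 1) ∨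
      (∃ i, 1 ≤ i ∧ i + 1 ≤ r - 1 ∧ e = s(va p i, va p (i + 1))) ∨
      e = s(va p (r - 1), vo p.2) ∨
      (∃ j, 1 ≤ j ∧ j + 1 ≤ ℓ ∧ e = s(vb p j, vb p (j + 1))) ∨
      (∃ j, 1 ≤ j ∧ j + 1 ≤ ℓ ∧ e = s(vc p j, vc p (j + 1))) ∨
      e = s(va p 1, vb p 1) ∨ e = s(va p (r / 2), vb p ℓ) ∨
      e = s(va p ((r + 1) / 2), vc p 1) ∨ e = s(va p (r - 1), vc p ℓ)} ∪
  {e | ∃ k, 1 ≤ k ∧ k + 1 ≤ r + 1 ∧ e = s((vx k : W V), vx (k + 1))} ∪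
  {s((vx (r + 1) : W V), vx 1)} ∪
  {e | ∃ u : V, e = s((vx 1 : W V), vo u)}

/-- The constructed graph `G'`. -/
def gadgetGraph (r ℓ : ℕ) (D : Set (V × V)) : SimpleGraph (W V) :=
  SimpleGraph.fromEdgeSet (gadgetEdges r ℓ D)


theorem vo_inj {u v : V} : (vo u : W V) = vo v ↔ u = v := by simp [vo]
theorem va_inj {p q : V × V} {i j : ℕ} : va p i = va q j ↔ p = q ∧ i = j := by simp [va]
theorem vb_inj {p q : V × V} {i j : ℕ} : vb p i = vb q j ↔ p = q ∧ i = j := by simp [vb]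
theorem vc_inj {p q : V × V} {i j : ℕ} : vc p i = vc q j ↔ p = q ∧ i = j := by simp [vc]
theorem vx_inj {i j : ℕ} : (vx i : W V) = vx j ↔ i = j := by simp [vx]
theorem vo_ne_va (u : V) (p : V × V) (i : ℕ) : vo u ≠ va p i := by simp [vo, va]
theorem vo_ne_vb (u : V) (p : V × V) (i : ℕ) : vo u ≠ vb p i := by simp [vo, vb]
theorem vo_ne_vc (u : V) (p : V × V) (i : ℕ) : vo u ≠ vc p i := by simp [vo, vc]
theorem vo_ne_vx (u : V) (i : ℕ) : vo u ≠ vx i := by simp [vo, vx]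
theorem va_ne_vb (q p : V × V) (j i : ℕ) : va q j ≠ vb p i := by simp [va, vb]
theorem va_ne_vc (q p : V × V) (j i : ℕ) : va q j ≠ vc p i := by simp [va, vc]
theorem va_ne_vx (p : V × V) (j i : ℕ) : va p j ≠ vx i := by simp [va, vx]
theorem vb_ne_vc (q p : V × V) (j i : ℕ) : vb q j ≠ vc p i := by simp [vb, vc]
theorem vb_ne_vx (p : V × V) (j i : ℕ) : vb p j ≠ vx i := by simp [vb, vx]
theorem vc_ne_vx (p : V × V) (j i : ℕ) : vc p j ≠ vx i := by simp [vc, vx]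

/-- The adjacency of the gadget graph, spelled out up to symmetry. -/
inductive Link (r ℓ : ℕ) (D : Set (V × V)) : W V → W V → Prop
  | ua (p) (hp : p ∈ D) : Link r ℓ D (vo p.1) (va p 1)
  | aa (p) (hp : p ∈ D) (i) (h1 : 1 ≤ i) (h2 : i + 1 ≤ r - 1) : Link r ℓ D (va p i) (va p (i+1))
  | av (p) (hp : p ∈ D) : Link r ℓ D (va p (r-1)) (vo p.2)
  | bb (p) (hp : p ∈ D) (i) (h1 : 1 ≤ i) (h2 : i + 1 ≤ ℓ) : Link r ℓ D (vb p i) (vb p (i+1))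
  | cc (p) (hp : p ∈ D) (i) (h1 : 1 ≤ i) (h2 : i + 1 ≤ ℓ) : Link r ℓ D (vc p i) (vc p (i+1))
  | ab1 (p) (hp : p ∈ D) : Link r ℓ D (va p 1) (vb p 1)
  | abl (p) (hp : p ∈ D) : Link r ℓ D (va p (r/2)) (vb p ℓ)
  | ac1 (p) (hp : p ∈ D) : Link r ℓ D (va p ((r+1)/2)) (vc p 1)
  | acl (p) (hp : p ∈ D) : Link r ℓ D (va p (r-1)) (vc p ℓ)
  | xx (k) (h1 : 1 ≤ k) (h2 : k + 1 ≤ r + 1) : Link r ℓ D (vx k) (vx (k+1))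
  | xend : Link r ℓ D (vx (r+1)) (vx 1)
  | xu (u) : Link r ℓ D (vx 1) (vo u)

theorem mem_edges_of_link {r ℓ : ℕ} {D : Set (V × V)} {x y : W V} (h : Link r ℓ D x y) :
    s(x, y) ∈ gadgetEdges r ℓ D := by
  unfold gadgetEdges
  cases h with
  | ua p hp => exact Or.inl (Or.inl (Or.inl ⟨p, hp, by simp⟩))
  | aa p hp i h1 h2 => exact Or.inl (Or.inl (Or.inl ⟨p, hp, Or.inr (Or.inl ⟨i, h1, h2, rfl⟩)⟩))
  | av p hp => exact Or.inl (Or.inl (Or.inl ⟨p, hp, by simp⟩))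
  | bb p hp i h1 h2 =>
    exact Or.inl (Or.inl (Or.inl ⟨p, hp, Or.inr (Or.inr (Or.inr (Or.inl ⟨i, h1, h2, rfl⟩)))⟩))
  | cc p hp i h1 h2 =>
    exact Or.inl (Or.inl (Or.inl
      ⟨p, hp, Or.inr (Or.inr (Or.inr (Or.inr (Or.inl ⟨i, h1, h2, rfl⟩))))⟩))
  | ab1 p hp => exact Or.inl (Or.inl (Or.inl ⟨p, hp, by simp⟩))
  | abl p hp => exact Or.inl (Or.inl (Or.inl ⟨p, hp, by simp⟩))
  | ac1 p hp => exact Or.inl (Or.inl (Or.inl ⟨p, hp, by simp⟩))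
  | acl p hp => exact Or.inl (Or.inl (Or.inl ⟨p, hp, by simp⟩))
  | xx k h1 h2 => exact Or.inl (Or.inl (Or.inr ⟨k, h1, h2, rfl⟩))
  | xend => exact Or.inl (Or.inr rfl)
  | xu u => exact Or.inr ⟨u, rfl⟩

theorem link_of_mem_edges {r ℓ : ℕ} {D : Set (V × V)} {e : Sym2 (W V)}
    (h : e ∈ gadgetEdges r ℓ D) : ∃ x y, e = s(x, y) ∧ Link r ℓ D x y := by
  rcases h with ((⟨p, hp, h | ⟨i, h1, h2, h⟩ | h | ⟨i, h1, h2, h⟩ | ⟨i, h1, h2, h⟩ | h | h | h | h⟩ |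
    ⟨k, h1, h2, h⟩) | h) | ⟨u, h⟩
  · exact ⟨_, _, h, .ua p hp⟩
  · exact ⟨_, _, h, .aa p hp i h1 h2⟩
  · exact ⟨_, _, h, .av p hp⟩
  · exact ⟨_, _, h, .bb p hp i h1 h2⟩
  · exact ⟨_, _, h, .cc p hp i h1 h2⟩
  · exact ⟨_, _, h, .ab1 p hp⟩
  · exact ⟨_, _, h, .abl p hp⟩
  · exact ⟨_, _, h, .ac1 p hp⟩
  · exact ⟨_, _, h, .acl p hp⟩
  · exact ⟨_, _, h, .xx k h1 h2⟩
  · exact ⟨_, _, h, .xend⟩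
  · exact ⟨_, _, h, .xu u⟩

theorem adj_iff {r ℓ : ℕ} {D : Set (V × V)} {x y : W V} :
    (gadgetGraph r ℓ D).Adj x y ↔ (Link r ℓ D x y ∨ Link r ℓ D y x) ∧ x ≠ y := by
  unfold gadgetGraph
  rw [SimpleGraph.fromEdgeSet_adj]
  refine and_congr_left fun _ => ⟨fun h => ?_, fun h => ?_⟩
  · obtain ⟨a, b, hab, hl⟩ := link_of_mem_edges h
    rcases Sym2.eq_iff.1 hab with ⟨rfl, rfl⟩ | ⟨rfl, rfl⟩
    · exact Or.inl hl
    · exact Or.inr hl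
  · rcases h with h | h
    · exact mem_edges_of_link h
    · rw [Sym2.eq_swap]; exact mem_edges_of_link h

section Nbr
variable {r ℓ : ℕ} {D : Set (V × V)}

theorem adj_vo {u : V} {z : W V} (h : (gadgetGraph r ℓ D).Adj (vo u) z) :
    z = vx 1 ∨ (∃ p ∈ D, p.1 = u ∧ z = va p 1) ∨ (∃ p ∈ D, p.2 = u ∧ z = va p (r-1)) := by
  obtain ⟨h, -⟩ := adj_iff.1 h
  generalize hw : (vo u : W V) = w at h
  rcases h with h | h <;> cases h <;>
    simp_all [vo, va, vb, vc, vx] <;> grind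

theorem adj_va {p : V × V} {i : ℕ} {z : W V} (hr : 2 ≤ r)
    (h : (gadgetGraph r ℓ D).Adj (va p i) z) :
    p ∈ D ∧ 1 ≤ i ∧ i ≤ r - 1 ∧ ((i + 1 ≤ r - 1 ∧ z = va p (i+1)) ∨ (2 ≤ i ∧ z = va p (i-1)) ∨
      (i = 1 ∧ z = vo p.1) ∨ (i = r - 1 ∧ z = vo p.2) ∨ (i = 1 ∧ z = vb p 1) ∨
      (i = r / 2 ∧ z = vb p ℓ) ∨ (i = (r+1)/2 ∧ z = vc p 1) ∨ (i = r - 1 ∧ z = vc p ℓ)) := by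
  obtain ⟨h, -⟩ := adj_iff.1 h
  generalize hw : (va p i : W V) = w at h
  rcases h with h | h <;> cases h <;>
    simp_all [vo, va, vb, vc, vx] <;> grind

theorem adj_vb {p : V × V} {i : ℕ} {z : W V} (hl : 2 ≤ ℓ)
    (h : (gadgetGraph r ℓ D).Adj (vb p i) z) :
    p ∈ D ∧ 1 ≤ i ∧ i ≤ ℓ ∧ ((i + 1 ≤ ℓ ∧ z = vb p (i+1)) ∨ (2 ≤ i ∧ z = vb p (i-1)) ∨
      (i = 1 ∧ z = va p 1) ∨ (i = ℓ ∧ z = va p (r/2))) := by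
  obtain ⟨h, -⟩ := adj_iff.1 h
  generalize hw : (vb p i : W V) = w at h
  rcases h with h | h <;> cases h <;>
    simp_all [vo, va, vb, vc, vx] <;> grind

theorem adj_vc {p : V × V} {i : ℕ} {z : W V} (hl : 2 ≤ ℓ)
    (h : (gadgetGraph r ℓ D).Adj (vc p i) z) :
    p ∈ D ∧ 1 ≤ i ∧ i ≤ ℓ ∧ ((i + 1 ≤ ℓ ∧ z = vc p (i+1)) ∨ (2 ≤ i ∧ z = vc p (i-1)) ∨
      (i = 1 ∧ z = va p ((r+1)/2)) ∨ (i = ℓ ∧ z = va p (r-1))) := by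
  obtain ⟨h, -⟩ := adj_iff.1 h
  generalize hw : (vc p i : W V) = w at h
  rcases h with h | h <;> cases h <;>
    simp_all [vo, va, vb, vc, vx] <;> grind

theorem adj_vx {i : ℕ} {z : W V}
    (h : (gadgetGraph r ℓ D).Adj (vx i) z) :
    1 ≤ i ∧ i ≤ r + 1 ∧ ((i + 1 ≤ r + 1 ∧ z = vx (i+1)) ∨ (2 ≤ i ∧ z = vx (i-1)) ∨
      (i = 1 ∧ z = vx (r+1)) ∨ (i = r+1 ∧ z = vx 1) ∨ (i = 1 ∧ ∃ u, z = vo u)) := by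
  obtain ⟨h, -⟩ := adj_iff.1 h
  generalize hw : (vx i : W V) = w at h
  rcases h with h | h <;> cases h <;>
    simp_all [vo, va, vb, vc, vx] <;> grind

end Nbr

/-- A closed injective sequence of adjacent vertices gives a cycle. -/
theorem exists_path_of_seq {U : Type*} {H : SimpleGraph U} (f : ℕ → U) (n : ℕ)
    (hadj : ∀ i < n, H.Adj (f i) (f (i+1))) :
    ∃ p : H.Walk (f n) (f 0), p.support = ((List.range (n+1)).map f).reverse ∧
      ∀ e ∈ p.edges, ∃ i < n, e = s(f i, f (i+1)) := by
  induction n with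
  | zero => exact ⟨SimpleGraph.Walk.nil, by simp, by simp⟩
  | succ n ih =>
    obtain ⟨p, hp, he⟩ := ih fun i hi => hadj i (by omega)
    refine ⟨SimpleGraph.Walk.cons (hadj n (by omega)).symm p, ?_, ?_⟩
    · rw [SimpleGraph.Walk.support_cons, hp, List.range_succ (n := n+1)]
      simp
    · intro e h
      rw [SimpleGraph.Walk.edges_cons, List.mem_cons] at h
      rcases h with rfl | h
      · exact ⟨n, by omega, Sym2.eq_swap⟩
      · obtain ⟨i, hi, rfl⟩ := he e h
        exact ⟨i, by omega, rfl⟩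

theorem exists_cycle_of_seq {U : Type*} [DecidableEq U] {H : SimpleGraph U} (f : ℕ → U) (n : ℕ)
    (hn : 2 ≤ n)
    (hadj : ∀ i < n, H.Adj (f i) (f (i+1))) (hend : H.Adj (f n) (f 0))
    (hinj : ∀ i ≤ n, ∀ j ≤ n, f i = f j → i = j) :
    ∃ (w : U) (c : H.Walk w w), c.IsCycle ∧
      c.support.toFinset = (Finset.range (n+1)).image f := by
  obtain ⟨p, hp, he⟩ := exists_path_of_seq f n hadj
  refine ⟨f 0, SimpleGraph.Walk.cons hend.symm p, ?_, ?_⟩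
  · rw [SimpleGraph.Walk.cons_isCycle_iff]
    constructor
    · rw [SimpleGraph.Walk.isPath_def, hp, List.nodup_reverse]
      refine List.Nodup.map_on ?_ List.nodup_range
      intro i hi j hj h
      simp only [List.mem_range] at hi hj
      exact hinj i (by omega) j (by omega) h
    · intro h
      obtain ⟨i, hi, h⟩ := he _ h
      rcases Sym2.eq_iff.1 h with ⟨h1, h2⟩ | ⟨h1, h2⟩
      · have := hinj _ (by omega) _ (by omega) h1
        have := hinj _ (by omega) _ (by omega) h2
        omega
      · have := hinj _ (by omega) _ (by omega) h1
        omega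
  · ext x
    simp only [SimpleGraph.Walk.support_cons, hp, List.mem_toFinset, List.mem_cons,
      List.mem_reverse, List.mem_map, List.mem_range, Finset.mem_image, Finset.mem_range]
    constructor
    · rintro (rfl | h)
      · exact ⟨0, by omega, rfl⟩
      · exact h
    · exact fun h => Or.inr h

theorem cycle_two_nbrs {U : Type*} {H : SimpleGraph U} {w : U} (c : H.Walk w w) (hc : c.IsCycle)
    {x : U} (hx : x ∈ c.support) (y : U) : ∃ z ∈ c.support, H.Adj x z ∧ z ≠ y := by
  have h := hc.ncard_neighborSet_toSubgraph_eq_two hx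
  obtain ⟨a, b, hab, hs⟩ := Set.ncard_eq_two.1 h
  have key : ∀ z ∈ c.toSubgraph.neighborSet x, z ∈ c.support ∧ H.Adj x z := by
    intro z hz
    refine ⟨?_, c.toSubgraph.adj_sub hz⟩
    have := c.toSubgraph.edge_vert (SimpleGraph.Subgraph.Adj.symm hz)
    simpa using this
  have ha := key a (by rw [hs]; simp)
  have hb := key b (by rw [hs]; simp)
  by_cases hay : a = y
  · exact ⟨b, hb.1, hb.2, fun h => hab (by rw [hay, h])⟩
  · exact ⟨a, ha.1, ha.2, hay⟩

theorem prop_up {Q : ℕ → Prop} {a b : ℕ} (h : ∀ j, a ≤ j → j + 1 ≤ b → Q j → Q (j+1))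
    (ha : Q a) : ∀ j, a ≤ j → j ≤ b → Q j := by
  intro j hj
  induction j, hj using Nat.le_induction with
  | base => exact fun _ => ha
  | succ j hj ih => exact fun hb => h j hj hb (ih (by omega))

theorem prop_down {Q : ℕ → Prop} {a b : ℕ} (h : ∀ j, a ≤ j → j + 1 ≤ b → Q (j+1) → Q j)
    (hb : Q b) : ∀ j, a ≤ j → j ≤ b → Q j := by
  have key : ∀ d j, a ≤ j → j + d = b → Q j := by
    intro d
    induction d with
    | zero => intro j _ hd; have : j = b := by omega
              rwa [this]
    | succ d ih => exact fun j hj hd => h j hj (by omega) (ih (j+1) (by omega) (by omega))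
  exact fun j hj hjb => key (b - j) j hj (by omega)

section Core
variable {r ℓ : ℕ} {D : Set (V × V)} {C : Finset (W V)}

/-- Every vertex of `C` has a neighbour in `C` avoiding any prescribed vertex. -/
def MinTwo (r ℓ : ℕ) (D : Set (V × V)) (C : Finset (W V)) : Prop :=
  ∀ x ∈ C, ∀ y, ∃ z ∈ C, (gadgetGraph r ℓ D).Adj x z ∧ z ≠ y

theorem x_all (hr : 2 ≤ r) (hC : MinTwo r ℓ D C) {k : ℕ} (hk : 2 ≤ k) (h : vx k ∈ C) :
    ∀ j, 1 ≤ j → j ≤ r + 1 → (vx j : W V) ∈ C := by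
  have hkr : k ≤ r + 1 := by
    obtain ⟨z, _, hz, _⟩ := hC _ h (vx 0)
    exact (adj_vx hz).2.1
  have hup : ∀ j, k ≤ j → j ≤ r + 1 → (vx j : W V) ∈ C := by
    refine prop_up (fun j hj hj1 hx => ?_) h
    obtain ⟨z, hzC, hz, hne⟩ := hC _ hx (vx (j-1))
    obtain ⟨_, _, h⟩ := adj_vx hz
    rcases h with ⟨_, rfl⟩ | ⟨_, rfl⟩ | ⟨_, rfl⟩ | ⟨_, rfl⟩ | ⟨_, _, rfl⟩
    · exact hzC
    · exact absurd rfl hne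
    all_goals omega
  have hlast := hup (r+1) hkr le_rfl
  have hdown : ∀ j, 2 ≤ j → j ≤ r + 1 → (vx j : W V) ∈ C := by
    refine prop_down (fun j hj hj1 hx => ?_) hlast
    obtain ⟨z, hzC, hz, hne⟩ := hC _ hx (if j = r then vx 1 else vx (j+1+1))
    obtain ⟨_, _, h⟩ := adj_vx hz
    rcases h with ⟨_, rfl⟩ | ⟨_, rfl⟩ | ⟨_, rfl⟩ | ⟨_, rfl⟩ | ⟨_, _, rfl⟩
    · rw [if_neg (by omega)] at hne; exact absurd rfl hne
    · exact hzC
    · omega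
    · rw [if_pos (by omega)] at hne; exact absurd rfl hne
    · omega
  intro j hj hjr
  rcases Nat.lt_or_ge 1 j with h2 | h2
  · exact hdown j h2 hjr
  · obtain rfl : j = 1 := by omega
    obtain ⟨z, hzC, hz, hne⟩ := hC _ hlast (vx r)
    obtain ⟨_, _, h⟩ := adj_vx hz
    rcases h with ⟨_, rfl⟩ | ⟨_, rfl⟩ | ⟨_, rfl⟩ | ⟨_, rfl⟩ | ⟨_, _, rfl⟩
    · omega
    · exact absurd rfl hne
    · omega
    · exact hzC
    · omega

theorem b_all (hl : 2 ≤ ℓ) (hC : MinTwo r ℓ D C) {p : V × V} {k : ℕ} (h : vb p k ∈ C) :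
    (∀ j, 1 ≤ j → j ≤ ℓ → vb p j ∈ C) ∧ va p (r/2) ∈ C := by
  obtain ⟨hk1, hkr⟩ : 1 ≤ k ∧ k ≤ ℓ := by
    obtain ⟨z, _, hz, _⟩ := hC _ h (vx 0)
    exact ⟨(adj_vb hl hz).2.1, (adj_vb hl hz).2.2.1⟩
  have hup : ∀ j, k ≤ j → j ≤ ℓ → vb p j ∈ C := by
    refine prop_up (fun j hj hj1 hx => ?_) h
    obtain ⟨z, hzC, hz, hne⟩ := hC _ hx (if j = 1 then va p 1 else vb p (j-1))
    obtain ⟨_, _, _, h⟩ := adj_vb hl hz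
    rcases h with ⟨_, rfl⟩ | ⟨_, rfl⟩ | ⟨_, rfl⟩ | ⟨_, rfl⟩
    · exact hzC
    · rw [if_neg (by omega)] at hne; exact absurd rfl hne
    · rw [if_pos (by omega)] at hne; exact absurd rfl hne
    · omega
  have hlast := hup ℓ hkr le_rfl
  constructor
  · refine prop_down (fun j hj hj1 hx => ?_) hlast
    obtain ⟨z, hzC, hz, hne⟩ := hC _ hx (if j + 1 = ℓ then va p (r/2) else vb p (j+1+1))
    obtain ⟨_, _, _, h⟩ := adj_vb hl hz
    rcases h with ⟨_, rfl⟩ | ⟨_, rfl⟩ | ⟨_, rfl⟩ | ⟨_, rfl⟩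
    · rw [if_neg (by omega)] at hne; exact absurd rfl hne
    · exact hzC
    · omega
    · rw [if_pos (by omega)] at hne; exact absurd rfl hne
  · obtain ⟨z, hzC, hz, hne⟩ := hC _ hlast (vb p (ℓ-1))
    obtain ⟨_, _, _, h⟩ := adj_vb hl hz
    rcases h with ⟨_, rfl⟩ | ⟨_, rfl⟩ | ⟨_, rfl⟩ | ⟨_, rfl⟩
    · omega
    · exact absurd rfl hne
    · omega
    · exact hzC

theorem c_all (hl : 2 ≤ ℓ) (hC : MinTwo r ℓ D C) {p : V × V} {k : ℕ} (h : vc p k ∈ C) :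
    (∀ j, 1 ≤ j → j ≤ ℓ → vc p j ∈ C) ∧ va p ((r+1)/2) ∈ C := by
  obtain ⟨hk1, hkr⟩ : 1 ≤ k ∧ k ≤ ℓ := by
    obtain ⟨z, _, hz, _⟩ := hC _ h (vx 0)
    exact ⟨(adj_vc hl hz).2.1, (adj_vc hl hz).2.2.1⟩
  have hup : ∀ j, k ≤ j → j ≤ ℓ → vc p j ∈ C := by
    refine prop_up (fun j hj hj1 hx => ?_) h
    obtain ⟨z, hzC, hz, hne⟩ := hC _ hx (if j = 1 then va p ((r+1)/2) else vc p (j-1))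
    obtain ⟨_, _, _, h⟩ := adj_vc hl hz
    rcases h with ⟨_, rfl⟩ | ⟨_, rfl⟩ | ⟨_, rfl⟩ | ⟨_, rfl⟩
    · exact hzC
    · rw [if_neg (by omega)] at hne; exact absurd rfl hne
    · rw [if_pos (by omega)] at hne; exact absurd rfl hne
    · omega
  have hlast := hup ℓ hkr le_rfl
  have hall : ∀ j, 1 ≤ j → j ≤ ℓ → vc p j ∈ C := by
    refine prop_down (fun j hj hj1 hx => ?_) hlast
    obtain ⟨z, hzC, hz, hne⟩ := hC _ hx (if j + 1 = ℓ then va p (r-1) else vc p (j+1+1))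
    obtain ⟨_, _, _, h⟩ := adj_vc hl hz
    rcases h with ⟨_, rfl⟩ | ⟨_, rfl⟩ | ⟨_, rfl⟩ | ⟨_, rfl⟩
    · rw [if_neg (by omega)] at hne; exact absurd rfl hne
    · exact hzC
    · omega
    · rw [if_pos (by omega)] at hne; exact absurd rfl hne
  refine ⟨hall, ?_⟩
  obtain ⟨z, hzC, hz, hne⟩ := hC _ (hall 1 le_rfl (by omega)) (vc p 2)
  obtain ⟨_, _, _, h⟩ := adj_vc hl hz
  rcases h with ⟨_, rfl⟩ | ⟨_, rfl⟩ | ⟨_, rfl⟩ | ⟨_, rfl⟩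
  · exact absurd rfl hne
  · omega
  · exact hzC
  · omega

/-- `a_i` has no neighbour on the `b`- and `c`-paths inside `C`. -/
def Clean (r ℓ : ℕ) (D : Set (V × V)) (C : Finset (W V)) (p : V × V) (i : ℕ) : Prop :=
  ∀ z ∈ C, (gadgetGraph r ℓ D).Adj (va p i) z → ∀ j, z ≠ vb p j ∧ z ≠ vc p j

theorem clean_adj (hr : 2 ≤ r) {p : V × V} {i : ℕ} (hcl : Clean r ℓ D C p i) {z : W V}
    (hz : z ∈ C) (h : (gadgetGraph r ℓ D).Adj (va p i) z) :
    (i + 1 ≤ r - 1 ∧ z = va p (i+1)) ∨ (2 ≤ i ∧ z = va p (i-1)) ∨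
      (i = 1 ∧ z = vo p.1) ∨ (i = r - 1 ∧ z = vo p.2) := by
  have hcl := hcl z hz h
  obtain ⟨_, _, _, h⟩ := adj_va hr h
  rcases h with h | h | h | h | h | h | h | h
  · exact Or.inl h
  · exact Or.inr (Or.inl h)
  · exact Or.inr (Or.inr (Or.inl h))
  · exact Or.inr (Or.inr (Or.inr h))
  · exact absurd h.2 (hcl _).1
  · exact absurd h.2 (hcl _).1
  · exact absurd h.2 (hcl _).2
  · exact absurd h.2 (hcl _).2

theorem clean_next (hr : 2 ≤ r) (hC : MinTwo r ℓ D C) {p : V × V} {i : ℕ}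
    (hcl : Clean r ℓ D C p i) (hi : va p i ∈ C) :
    (i + 1 ≤ r - 1 → va p (i+1) ∈ C) ∧ (i = r - 1 → vo p.2 ∈ C) := by
  obtain ⟨z, hzC, hz, hne⟩ := hC _ hi (if i = 1 then vo p.1 else va p (i-1))
  rcases clean_adj hr hcl hzC hz with ⟨h, rfl⟩ | ⟨h, rfl⟩ | ⟨h, rfl⟩ | ⟨h, rfl⟩
  · exact ⟨fun _ => hzC, fun _ => by omega⟩
  · rw [if_neg (by omega)] at hne; exact absurd rfl hne
  · rw [if_pos (by omega)] at hne; exact absurd rfl hne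
  · exact ⟨fun _ => by omega, fun _ => hzC⟩

theorem clean_prev (hr : 2 ≤ r) (hC : MinTwo r ℓ D C) {p : V × V} {i : ℕ}
    (hcl : Clean r ℓ D C p i) (hi : va p i ∈ C) :
    (2 ≤ i → va p (i-1) ∈ C) ∧ (i = 1 → vo p.1 ∈ C) := by
  obtain ⟨z, hzC, hz, hne⟩ := hC _ hi (if i = r - 1 then vo p.2 else va p (i+1))
  rcases clean_adj hr hcl hzC hz with ⟨h, rfl⟩ | ⟨h, rfl⟩ | ⟨h, rfl⟩ | ⟨h, rfl⟩
  · rw [if_neg (by omega)] at hne; exact absurd rfl hne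
  · exact ⟨fun _ => hzC, fun _ => by omega⟩
  · exact ⟨fun _ => by omega, fun _ => hzC⟩
  · rw [if_pos (by omega)] at hne; exact absurd rfl hne

theorem a_up (hr : 2 ≤ r) (hC : MinTwo r ℓ D C) {p : V × V} {s : ℕ} (hs : va p s ∈ C)
    (hcl : ∀ i, s ≤ i → i + 1 ≤ r - 1 → Clean r ℓ D C p i) :
    ∀ j, s ≤ j → j ≤ r - 1 → va p j ∈ C :=
  prop_up (fun j hj hj1 hx => (clean_next hr hC (hcl j hj hj1) hx).1 hj1) hs

theorem a_down (hr : 2 ≤ r) (hC : MinTwo r ℓ D C) {p : V × V} {t : ℕ} (ht : va p t ∈ C)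
    (hcl : ∀ i, 2 ≤ i → i ≤ t → Clean r ℓ D C p i) :
    ∀ j, 1 ≤ j → j ≤ t → va p j ∈ C :=
  prop_down (fun j hj hj1 hx =>
    (clean_prev hr hC (hcl (j+1) (by omega) hj1) hx).1 (by omega)) ht

theorem a_all (hr : 2 ≤ r) (hC : MinTwo r ℓ D C) {p : V × V} {k : ℕ} (h : va p k ∈ C)
    (hb : ∀ j, vb p j ∉ C) (hc : ∀ j, vc p j ∉ C) :
    (∀ j, 1 ≤ j → j ≤ r - 1 → va p j ∈ C) ∧ vo p.1 ∈ C ∧ vo p.2 ∈ C := by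
  have hcl : ∀ i, Clean r ℓ D C p i := fun i z hz _ j =>
    ⟨fun h => hb j (h ▸ hz), fun h => hc j (h ▸ hz)⟩
  obtain ⟨hk1, hkr⟩ : 1 ≤ k ∧ k ≤ r - 1 := by
    obtain ⟨z, _, hz, _⟩ := hC _ h (vx 0)
    exact ⟨(adj_va hr hz).2.1, (adj_va hr hz).2.2.1⟩
  have h1 := a_up hr hC h fun i _ _ => hcl i
  have h2 := a_down hr hC h fun i _ _ => hcl i
  refine ⟨fun j hj hjr => ?_, (clean_prev hr hC (hcl 1) (h2 1 le_rfl hk1)).2 rfl,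
    (clean_next hr hC (hcl _) (h1 (r-1) hkr le_rfl)).2 rfl⟩
  rcases le_total j k with h | h
  · exact h2 j hj h
  · exact h1 j h hjr

/-- If only the `b`-path is in `C`, many `a`-vertices are. -/
theorem a_of_b (hr : 2 ≤ r) (hC : MinTwo r ℓ D C) {p : V × V} (h : va p (r/2) ∈ C)
    (hc : ∀ j, vc p j ∉ C) :
    ∃ s, 1 ≤ s ∧ s + r / 2 ≤ r ∧ ∀ j, s ≤ j → j < s + r / 2 → va p j ∈ C := by
  rcases Nat.lt_or_ge (r/2) 2 with h1 | h2
  · exact ⟨r/2, by omega, by omega, fun j _ _ => by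
      obtain rfl : j = r/2 := by omega
      exact h⟩
  have hcl : ∀ i, 1 < i → i ≠ r/2 → Clean r ℓ D C p i := by
    intro i hi1 hi2 z hz hadj j
    refine ⟨?_, fun h => hc j (h ▸ hz)⟩
    rintro rfl
    obtain ⟨_, _, _, h⟩ := adj_va hr hadj
    simp [va, vb, vc, vo] at h
    omega
  obtain ⟨z, hzC, hz, hne⟩ := hC _ h (vb p ℓ)
  obtain ⟨_, _, _, hh⟩ := adj_va hr hz
  rcases hh with ⟨_, rfl⟩ | ⟨_, rfl⟩ | ⟨_, rfl⟩ | ⟨_, rfl⟩ | ⟨_, rfl⟩ | ⟨_, rfl⟩ | ⟨_, rfl⟩ | ⟨_, rfl⟩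
  · have := a_up hr hC hzC fun i _ _ => hcl i (by omega) (by omega)
    refine ⟨r/2, by omega, by omega, fun j hj1 hj2 => ?_⟩
    rcases eq_or_lt_of_le hj1 with rfl | hj
    · exact h
    · exact this j hj (by omega)
  · have := a_down hr hC hzC fun i _ _ => hcl i (by omega) (by omega)
    refine ⟨1, by omega, by omega, fun j hj1 hj2 => ?_⟩
    rcases eq_or_lt_of_le (show j ≤ r/2 by omega) with rfl | hj
    · exact h
    · exact this j hj1 (by omega)
  · omega
  · omega
  · omega
  · exact absurd rfl hne
  · exact absurd hzC (hc _)
  · exact absurd hzC (hc _)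

theorem a_of_c (hr : 2 ≤ r) (hC : MinTwo r ℓ D C) {p : V × V} (h : va p ((r+1)/2) ∈ C)
    (hb : ∀ j, vb p j ∉ C) :
    ∃ s, 1 ≤ s ∧ s + r / 2 ≤ r ∧ ∀ j, s ≤ j → j < s + r / 2 → va p j ∈ C := by
  rcases Nat.lt_or_ge (r/2) 2 with h1 | h2
  · exact ⟨(r+1)/2, by omega, by omega, fun j _ _ => by
      obtain rfl : j = (r+1)/2 := by omega
      exact h⟩
  have hcl : ∀ i, i < r - 1 → i ≠ (r+1)/2 → Clean r ℓ D C p i := by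
    intro i hi1 hi2 z hz hadj j
    refine ⟨fun h => hb j (h ▸ hz), ?_⟩
    rintro rfl
    obtain ⟨_, _, _, h⟩ := adj_va hr hadj
    simp [va, vb, vc, vo] at h
    omega
  obtain ⟨z, hzC, hz, hne⟩ := hC _ h (vc p 1)
  obtain ⟨_, _, _, hh⟩ := adj_va hr hz
  rcases hh with ⟨_, rfl⟩ | ⟨_, rfl⟩ | ⟨_, rfl⟩ | ⟨_, rfl⟩ | ⟨_, rfl⟩ | ⟨_, rfl⟩ | ⟨_, rfl⟩ | ⟨_, rfl⟩
  · have := a_up hr hC hzC fun i _ _ => hcl i (by omega) (by omega)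
    refine ⟨(r+1)/2, by omega, by omega, fun j hj1 hj2 => ?_⟩
    rcases eq_or_lt_of_le hj1 with rfl | hj
    · exact h
    · exact this j hj (by omega)
  · have := a_down hr hC hzC fun i _ _ => hcl i (by omega) (by omega)
    refine ⟨1, by omega, by omega, fun j hj1 hj2 => ?_⟩
    rcases eq_or_lt_of_le (show j ≤ (r+1)/2 by omega) with rfl | hj
    · exact h
    · exact this j hj1 (by omega)
  · omega
  · omega
  · exact absurd hzC (hb _)
  · exact absurd hzC (hb _)
  · exact absurd rfl hne
  · omega

theorem card_im_le {U : Type*} [DecidableEq U] {f g : ℕ → U} {s t s' t' n : ℕ} {T : Finset U}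
    (hf : Function.Injective f) (hg : Function.Injective g) (hfg : ∀ i j, f i ≠ g j)
    (h1 : ∀ j, s ≤ j → j < t → f j ∈ T) (h2 : ∀ j, s' ≤ j → j < t' → g j ∈ T)
    (hn : n ≤ (t - s) + (t' - s')) : n ≤ T.card := by
  have hsub : (Finset.Ico s t).image f ∪ (Finset.Ico s' t').image g ⊆ T := by
    intro x hx
    simp only [Finset.mem_union, Finset.mem_image, Finset.mem_Ico] at hx
    rcases hx with ⟨j, hj, rfl⟩ | ⟨j, hj, rfl⟩
    · exact h1 j hj.1 hj.2
    · exact h2 j hj.1 hj.2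
  have hd : Disjoint ((Finset.Ico s t).image f) ((Finset.Ico s' t').image g) := by
    rw [Finset.disjoint_left]
    intro x hx hy
    simp only [Finset.mem_image] at hx hy
    obtain ⟨i, _, rfl⟩ := hx
    obtain ⟨j, _, h⟩ := hy
    exact hfg i j h.symm
  have := Finset.card_le_card hsub
  rw [Finset.card_union_of_disjoint hd, Finset.card_image_of_injective _ hf,
    Finset.card_image_of_injective _ hg, Nat.card_Ico, Nat.card_Ico] at this
  omega

theorem edge_unique {p q : V × V} (h0 : p.1 ≠ p.2) (h3 : (p.2, p.1) ∉ D) (hq : q ∈ D)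
    (hqp : q ≠ p) (h1 : q.1 = p.1 ∨ q.2 = p.1) (h2 : q.1 = p.2 ∨ q.2 = p.2) : False := by
  obtain ⟨a, b⟩ := p
  obtain ⟨c, d⟩ := q
  dsimp only at *
  rcases h1 with rfl | rfl <;> rcases h2 with rfl | rfl
  · exact h0 rfl
  · exact hqp rfl
  · exact h3 hq
  · exact h0 rfl

theorem core [DecidableEq V] (hr : 2 ≤ r) (hℓ : ℓ = (r + 1) / 2 + 1)
    (hD0 : ∀ p ∈ D, p.1 ≠ p.2) (hD3 : ∀ u v : V, (u, v) ∈ D → (v, u) ∉ D)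
    (hC : MinTwo r ℓ D C) (hne : C.Nonempty) (T : Finset (W V))
    (hA : ∀ p ∈ D, ∀ i, 1 ≤ i → i ≤ r - 1 → va p i ∈ T)
    (hB : ∀ p ∈ D, ∀ i, 1 ≤ i → i ≤ ℓ → vb p i ∈ T)
    (hCC : ∀ p ∈ D, ∀ i, 1 ≤ i → i ≤ ℓ → vc p i ∈ T)
    (hX : ∀ i, 1 ≤ i → i ≤ r + 1 → vx i ∈ T)
    (hcov : ∀ p ∈ D, vo p.1 ∈ T ∨ vo p.2 ∈ T) : r + 1 ≤ (C ∩ T).card := by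
  have hl : 2 ≤ ℓ := by omega
  have ia : ∀ p : V × V, Function.Injective (va p) := fun p i j h => (va_inj.1 h).2
  have ib : ∀ p : V × V, Function.Injective (vb p) := fun p i j h => (vb_inj.1 h).2
  have ic : ∀ p : V × V, Function.Injective (vc p) := fun p i j h => (vc_inj.1 h).2
  by_contra hcon
  -- no cycle vertex other than `x_1`
  have hx : ∀ k, (vx k : W V) ∈ C → k = 1 := by
    intro k hk
    by_contra hk1
    have : 1 ≤ k := by
      obtain ⟨z, _, hz, _⟩ := hC _ hk (vx 0)
      exact (adj_vx hz).1
    have hall := x_all hr hC (show 2 ≤ k by omega) hk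
    have hsub : (Finset.Icc 1 (r+1)).image (vx : ℕ → W V) ⊆ C ∩ T := by
      intro x hx
      simp only [Finset.mem_image, Finset.mem_Icc] at hx
      obtain ⟨j, hj, rfl⟩ := hx
      exact Finset.mem_inter.2 ⟨hall j hj.1 hj.2, hX j hj.1 hj.2⟩
    have := Finset.card_le_card hsub
    rw [Finset.card_image_of_injective _ (fun i j h => vx_inj.1 h), Nat.card_Icc] at this
    omega
  have hbc : ∀ p, (∀ j, vb p j ∉ C) ∧ (∀ j, vc p j ∉ C) := by
    intro p
    have hpD : ∀ i, va p i ∈ C → p ∈ D := by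
      intro i hi
      obtain ⟨z, _, hz, _⟩ := hC _ hi (vx 0)
      exact (adj_va hr hz).1
    by_cases h1 : ∀ j, vb p j ∉ C
    · by_cases h2 : ∀ j, vc p j ∉ C
      · exact ⟨h1, h2⟩
      · push Not at h2
        obtain ⟨j, hj⟩ := h2
        obtain ⟨hall, ha⟩ := c_all hl hC hj
        have hp := hpD _ ha
        obtain ⟨s, hs1, hs2, hs⟩ := a_of_c hr hC ha h1
        exact absurd (card_im_le (f := va p) (g := vc p) (s := s) (t := s + r/2) (s' := 1)
          (t' := ℓ + 1) (T := C ∩ T) (n := r+1) (ia p) (ic p) (va_ne_vc p p)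
          (fun j h1 h2 => Finset.mem_inter.2 ⟨hs j h1 h2, hA p hp j (by omega) (by omega)⟩)
          (fun j h1 h2 => Finset.mem_inter.2 ⟨hall j h1 (by omega), hCC p hp j h1 (by omega)⟩)
          (by omega)) hcon
    · push Not at h1
      obtain ⟨j, hj⟩ := h1
      obtain ⟨hall, ha⟩ := b_all hl hC hj
      have hp := hpD _ ha
      by_cases h2 : ∀ j, vc p j ∉ C
      · obtain ⟨s, hs1, hs2, hs⟩ := a_of_b hr hC ha h2
        exact absurd (card_im_le (f := va p) (g := vb p) (s := s) (t := s + r/2) (s' := 1)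
          (t' := ℓ + 1) (T := C ∩ T) (n := r+1) (ia p) (ib p) (va_ne_vb p p)
          (fun j h1 h2 => Finset.mem_inter.2 ⟨hs j h1 h2, hA p hp j (by omega) (by omega)⟩)
          (fun j h1 h2 => Finset.mem_inter.2 ⟨hall j h1 (by omega), hB p hp j h1 (by omega)⟩)
          (by omega)) hcon
      · push Not at h2
        obtain ⟨j, hj⟩ := h2
        obtain ⟨hall', -⟩ := c_all hl hC hj
        exact absurd (card_im_le (f := vb p) (g := vc p) (s := 1) (t := ℓ + 1) (s' := 1)
          (t' := ℓ + 1) (T := C ∩ T) (n := r+1) (ib p) (ic p) (vb_ne_vc p p)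
          (fun j h1 h2 => Finset.mem_inter.2 ⟨hall j h1 (by omega), hB p hp j h1 (by omega)⟩)
          (fun j h1 h2 => Finset.mem_inter.2 ⟨hall' j h1 (by omega), hCC p hp j h1 (by omega)⟩)
          (by omega)) hcon
  have haC : ∀ p i, va p i ∈ C → p ∈ D ∧ (∀ j, 1 ≤ j → j ≤ r - 1 → va p j ∈ C) ∧
      vo p.1 ∈ C ∧ vo p.2 ∈ C := by
    intro p i hi
    refine ⟨?_, a_all hr hC hi (hbc p).1 (hbc p).2⟩
    obtain ⟨z, _, hz, _⟩ := hC _ hi (vx 0)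
    exact (adj_va hr hz).1
  -- an original vertex has, for each vertex to avoid, ...
  have hvo : ∀ u, vo u ∈ C → ∀ y, ∃ z ∈ C, z ≠ y ∧ (z = vx 1 ∨ ∃ p ∈ D, (p.1 = u ∨ p.2 = u) ∧
      ∃ i, z = va p i ∧ 1 ≤ i ∧ i ≤ r - 1 ∧ (p.1 = u → i = 1) ∧ (p.2 = u → i = r - 1)) := by
    intro u hu y
    obtain ⟨z, hzC, hz, hzy⟩ := hC _ hu y
    refine ⟨z, hzC, hzy, ?_⟩
    rcases adj_vo hz with h | ⟨p, hp, h1, h⟩ | ⟨p, hp, h1, h⟩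
    · exact Or.inl h
    · refine Or.inr ⟨p, hp, Or.inl h1, 1, h, le_rfl, by omega, fun _ => rfl, fun h2 => ?_⟩
      exact absurd (h1.trans h2.symm) (hD0 p hp)
    · refine Or.inr ⟨p, hp, Or.inr h1, r-1, h, by omega, le_rfl, fun h2 => ?_, fun _ => rfl⟩
      exact absurd (h2.trans h1.symm) (hD0 p hp)
  have hone : ∃ p i, va p i ∈ C := by
    have h1 : ∀ u, vo u ∈ C → ∃ p i, va p i ∈ C := by
      intro u hu
      obtain ⟨z, hzC, hzy, rfl | ⟨p, _, _, i, rfl, _⟩⟩ := hvo u hu (vx 1)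
      · exact absurd rfl hzy
      · exact ⟨p, i, hzC⟩
    obtain ⟨x, hxC⟩ := hne
    rcases x with u | ⟨p, t, i⟩ | k
    · exact h1 u hxC
    · obtain ⟨z, hzC, hz, -⟩ := hC _ hxC (vx 0)
      rcases (adj_iff.1 hz).1 with h | h
      all_goals
        generalize hw : (Sum.inr (Sum.inl (p, t, i)) : W V) = w at h hxC
        cases h
        all_goals first
          | exact absurd hzC ((hbc _).1 _)
          | exact absurd hzC ((hbc _).2 _)
          | exact absurd hxC ((hbc _).1 _)
          | exact absurd hxC ((hbc _).2 _)
          | exact ⟨_, _, hxC⟩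
          | exact ⟨_, _, hzC⟩
          | simp [vx, vo] at hw
    · obtain rfl := hx k hxC
      obtain ⟨z, hzC, hz, -⟩ := hC _ hxC (vx 0)
      obtain ⟨_, _, h⟩ := adj_vx hz
      rcases h with ⟨_, rfl⟩ | ⟨_, rfl⟩ | ⟨_, rfl⟩ | ⟨_, rfl⟩ | ⟨_, u, rfl⟩
      · have := hx _ hzC; omega
      · omega
      · have := hx _ hzC; omega
      · omega
      · exact h1 u hzC
  obtain ⟨p, i, hi⟩ := hone
  obtain ⟨hp, hpa, hp1, hp2⟩ := haC p i hi
  have icard : ∀ q ∈ D, ((Finset.Icc 1 (r-1)).image (va q)).card = r - 1 := by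
    intro q _
    rw [Finset.card_image_of_injective _ (ia q), Nat.card_Icc]; omega
  have isub : ∀ q i, va q i ∈ C → (Finset.Icc 1 (r-1)).image (va q) ⊆ C ∩ T := by
    intro q i hi x hx
    simp only [Finset.mem_image, Finset.mem_Icc] at hx
    obtain ⟨j, hj, rfl⟩ := hx
    obtain ⟨hq, hqa, _⟩ := haC q i hi
    exact Finset.mem_inter.2 ⟨hqa j hj.1 hj.2, hA q hq j hj.1 hj.2⟩
  by_cases hx1 : (vx 1 : W V) ∈ C
  · obtain ⟨u, huC, huT⟩ : ∃ u, vo u ∈ C ∧ vo u ∈ T := by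
      rcases hcov p hp with h | h
      · exact ⟨_, hp1, h⟩
      · exact ⟨_, hp2, h⟩
    have hsub : insert (vo u) (insert (vx 1) ((Finset.Icc 1 (r-1)).image (va p))) ⊆ C ∩ T := by
      rw [Finset.insert_subset_iff, Finset.insert_subset_iff]
      exact ⟨Finset.mem_inter.2 ⟨huC, huT⟩,
        Finset.mem_inter.2 ⟨hx1, hX 1 le_rfl (by omega)⟩, isub p i hi⟩
    have := Finset.card_le_card hsub
    rw [Finset.card_insert_of_notMem, Finset.card_insert_of_notMem, icard p hp] at this
    · omega
    · simp [va, vx]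
    · simp [va, vx, vo]
  · have hsecond : ∀ u, vo u ∈ C → (p.1 = u ∨ p.2 = u) → ∃ q ∈ D, q ≠ p ∧ (q.1 = u ∨ q.2 = u) ∧
        ∃ i, va q i ∈ C := by
      intro u hu hpu
      obtain ⟨z, hzC, hzy, rfl | ⟨q, hq, hqu, j, rfl, _, _, h1, h2⟩⟩ :=
        hvo u hu (if p.1 = u then va p 1 else va p (r-1))
      · exact absurd hzC hx1
      · refine ⟨q, hq, ?_, hqu, j, hzC⟩
        rintro rfl
        apply hzy
        split_ifs with h
        · rw [h1 h]
        · rw [h2 (by tauto)]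
    obtain ⟨q, hq, hqp, hqu, j, hj⟩ := hsecond p.1 hp1 (Or.inl rfl)
    obtain ⟨q', hq', hqp', hqu', j', hj'⟩ := hsecond p.2 hp2 (Or.inr rfl)
    have hqq : q ≠ q' := by
      rintro rfl
      exact edge_unique (hD0 p hp) (hD3 _ _ hp) hq hqp hqu hqu'
    have hdis : ∀ q q' : V × V, q ≠ q' → Disjoint ((Finset.Icc 1 (r-1)).image (va q))
        ((Finset.Icc 1 (r-1)).image (va q')) := by
      intro q q' h
      rw [Finset.disjoint_left]
      intro x hx hy
      simp only [Finset.mem_image] at hx hy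
      obtain ⟨i, _, rfl⟩ := hx
      obtain ⟨j, _, h'⟩ := hy
      exact h (va_inj.1 h').1.symm
    have hsub : ((Finset.Icc 1 (r-1)).image (va p) ∪ (Finset.Icc 1 (r-1)).image (va q)) ∪
        (Finset.Icc 1 (r-1)).image (va q') ⊆ C ∩ T :=
      Finset.union_subset (Finset.union_subset (isub p i hi) (isub q j hj)) (isub q' j' hj')
    have := Finset.card_le_card hsub
    rw [Finset.card_union_of_disjoint, Finset.card_union_of_disjoint (hdis _ _ hqp.symm),
      icard p hp, icard q hq, icard q' hq'] at this
    · omega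
    · rw [Finset.disjoint_union_left]
      exact ⟨hdis _ _ hqp'.symm, hdis _ _ hqq⟩

end Core

section Back
variable {r ℓ : ℕ} {D : Set (V × V)}

theorem adj_of_link {x y : W V} (h : Link r ℓ D x y) (hne : x ≠ y) :
    (gadgetGraph r ℓ D).Adj x y := adj_iff.2 ⟨Or.inl h, hne⟩

theorem adj_of_link' {x y : W V} (h : Link r ℓ D y x) (hne : x ≠ y) :
    (gadgetGraph r ℓ D).Adj x y := adj_iff.2 ⟨Or.inr h, hne⟩

/-- Every cycle through `r+1` vertices is contained in a fault tolerant set. -/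
theorem seq_mem [DecidableEq V] (hr : 2 ≤ r) {T : Finset (W V)}
    (hT : ∀ ⦃w : W V⦄ (c : (gadgetGraph r ℓ D).Walk w w), c.IsCycle →
          r + 1 ≤ (c.support.toFinset ∩ T).card)
    (f : ℕ → W V) (hadj : ∀ i < r, (gadgetGraph r ℓ D).Adj (f i) (f (i+1)))
    (hend : (gadgetGraph r ℓ D).Adj (f r) (f 0))
    (hinj : ∀ i ≤ r, ∀ j ≤ r, f i = f j → i = j) : ∀ i ≤ r, f i ∈ T := by
  obtain ⟨w, c, hc, hs⟩ := exists_cycle_of_seq f r hr hadj hend hinj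
  have h := hT c hc
  rw [hs] at h
  have hcard : ((Finset.range (r+1)).image f).card ≤ r + 1 := by
    simpa using Finset.card_image_le (s := Finset.range (r+1)) (f := f)
  have heq := Finset.eq_of_subset_of_card_le
    (Finset.inter_subset_left (s₁ := (Finset.range (r+1)).image f) (s₂ := T)) (by omega)
  intro i hi
  have : f i ∈ (Finset.range (r+1)).image f :=
    Finset.mem_image_of_mem _ (Finset.mem_range.2 (by omega))
  rw [← heq] at this
  exact (Finset.mem_inter.1 this).2

theorem back_x [DecidableEq V] (hr : 2 ≤ r) {T : Finset (W V)}
    (hT : ∀ ⦃w : W V⦄ (c : (gadgetGraph r ℓ D).Walk w w), c.IsCycle →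
          r + 1 ≤ (c.support.toFinset ∩ T).card) :
    ∀ i, 1 ≤ i → i ≤ r + 1 → vx i ∈ T := by
  have := seq_mem hr hT (fun i => vx (i+1))
    (fun i hi => adj_of_link (.xx (i+1) (by omega) (by omega)) (by simp [vx]))
    (adj_of_link .xend (by simp [vx]; omega))
    (fun i _ j _ h => by simpa [vx] using h)
  intro i h1 h2
  have h := this (i-1) (by omega)
  rwa [show i - 1 + 1 = i by omega] at h

theorem back_b [DecidableEq V] (hr : 2 ≤ r) (hℓ : ℓ = (r + 1) / 2 + 1) {T : Finset (W V)}
    (hT : ∀ ⦃w : W V⦄ (c : (gadgetGraph r ℓ D).Walk w w), c.IsCycle →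
          r + 1 ≤ (c.support.toFinset ∩ T).card) {p : V × V} (hp : p ∈ D) :
    (∀ i, 1 ≤ i → i ≤ r / 2 → va p i ∈ T) ∧ (∀ i, 1 ≤ i → i ≤ ℓ → vb p i ∈ T) := by
  have := seq_mem hr hT (fun i => if i < r / 2 then va p (i+1) else vb p (ℓ - (i - r/2))) ?_ ?_ ?_
  · constructor
    · intro i h1 h2
      have h := this (i-1) (by omega)
      rwa [if_pos (by omega), show i - 1 + 1 = i by omega] at h
    · intro i h1 h2
      have h := this (r/2 + (ℓ - i)) (by omega)
      rwa [if_neg (by omega), show ℓ - (r/2 + (ℓ - i) - r/2) = i by omega] at h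
  · intro i hi
    rcases Nat.lt_or_ge (i+1) (r/2) with h | h
    · rw [if_pos (by omega), if_pos h]
      exact adj_of_link (.aa p hp (i+1) (by omega) (by omega)) (by simp [va])
    · rw [if_neg (show ¬ (i+1 < r/2) by omega)]
      rcases Nat.lt_or_ge i (r/2) with h' | h'
      · rw [if_pos h', show i + 1 = r/2 by omega, show ℓ - (r/2 - r/2) = ℓ by omega]
        exact adj_of_link (.abl p hp) (va_ne_vb _ _ _ _)
      · rw [if_neg (by omega)]
        have e : ℓ - (i - r/2) = ℓ - (i + 1 - r/2) + 1 := by omega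
        rw [e]
        exact adj_of_link' (.bb p hp _ (by omega) (by omega)) (by simp [vb])
  · rw [if_neg (by omega), if_pos (by omega), show ℓ - (r - r/2) = 1 by omega]
    exact adj_of_link' (.ab1 p hp) (va_ne_vb _ _ _ _).symm
  · intro i hi j hj h
    split_ifs at h <;> simp [va, vb] at h <;> omega

theorem back_c [DecidableEq V] (hr : 2 ≤ r) (hℓ : ℓ = (r + 1) / 2 + 1) {T : Finset (W V)}
    (hT : ∀ ⦃w : W V⦄ (c : (gadgetGraph r ℓ D).Walk w w), c.IsCycle →
          r + 1 ≤ (c.support.toFinset ∩ T).card) {p : V × V} (hp : p ∈ D) :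
    (∀ i, (r+1)/2 ≤ i → i ≤ r - 1 → va p i ∈ T) ∧ (∀ i, 1 ≤ i → i ≤ ℓ → vc p i ∈ T) := by
  have := seq_mem hr hT
    (fun i => if i < r / 2 then va p ((r+1)/2 + i) else vc p (ℓ - (i - r/2))) ?_ ?_ ?_
  · constructor
    · intro i h1 h2
      have h := this (i-(r+1)/2) (by omega)
      rwa [if_pos (by omega), show (r+1)/2 + (i - (r+1)/2) = i by omega] at h
    · intro i h1 h2
      have h := this (r/2 + (ℓ - i)) (by omega)
      rwa [if_neg (by omega), show ℓ - (r/2 + (ℓ - i) - r/2) = i by omega] at h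
  · intro i hi
    rcases Nat.lt_or_ge (i+1) (r/2) with h | h
    · rw [if_pos (by omega), if_pos h]
      exact adj_of_link (.aa p hp ((r+1)/2+i) (by omega) (by omega)) (by simp [va])
    · rw [if_neg (show ¬ (i+1 < r/2) by omega)]
      rcases Nat.lt_or_ge i (r/2) with h' | h'
      · rw [if_pos h', show (r+1)/2 + i = r - 1 by omega, show ℓ - (i + 1 - r/2) = ℓ by omega]
        exact adj_of_link (.acl p hp) (va_ne_vc _ _ _ _)
      · rw [if_neg (by omega)]
        have e : ℓ - (i - r/2) = ℓ - (i + 1 - r/2) + 1 := by omega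
        rw [e]
        exact adj_of_link' (.cc p hp _ (by omega) (by omega)) (by simp [vc])
  · rw [if_neg (by omega), if_pos (by omega), show ℓ - (r - r/2) = 1 by omega]
    exact adj_of_link' (.ac1 p hp) (va_ne_vc _ _ _ _).symm
  · intro i hi j hj h
    split_ifs at h <;> simp [va, vc] at h <;> omega

theorem back_cover [DecidableEq V] (hr : 2 ≤ r) {T : Finset (W V)}
    (hT : ∀ ⦃w : W V⦄ (c : (gadgetGraph r ℓ D).Walk w w), c.IsCycle →
          r + 1 ≤ (c.support.toFinset ∩ T).card) {p : V × V} (hp : p ∈ D) (hne : p.1 ≠ p.2) :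
    vo p.1 ∈ T ∨ vo p.2 ∈ T := by
  have hcyc := exists_cycle_of_seq (H := gadgetGraph r ℓ D)
    (fun i => if i = 0 then vx 1 else if i = 1 then vo p.1 else
      if i ≤ r then va p (i-1) else vo p.2) (r+1) (by omega) ?_ ?_ ?_
  · obtain ⟨w, c, hc, hs⟩ := hcyc
    by_contra hcon
    push Not at hcon
    have h := hT c hc
    have hsub : c.support.toFinset ∩ T ⊆ insert (vx 1) ((Finset.Icc 1 (r-1)).image (va p)) := by
      intro x hx
      rw [Finset.mem_inter, hs, Finset.mem_image] at hx
      obtain ⟨⟨i, hi, rfl⟩, hxT⟩ := hx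
      rw [Finset.mem_range] at hi
      split_ifs at hxT ⊢ with h1 h2 h3
      · simp
      · exact absurd hxT hcon.1
      · refine Finset.mem_insert_of_mem (Finset.mem_image_of_mem _ (Finset.mem_Icc.2 ?_))
        omega
      · exact absurd hxT hcon.2
    have h1 := Finset.card_le_card hsub
    have h2 := Finset.card_insert_le (vx 1) ((Finset.Icc 1 (r-1)).image (va p))
    have h3 := Finset.card_image_le (s := Finset.Icc 1 (r-1)) (f := va p)
    rw [Nat.card_Icc] at h3
    omega
  · intro i hi
    rcases Nat.eq_zero_or_pos i with rfl | h0
    · simp only [if_true, zero_add, one_ne_zero, if_false]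
      exact adj_of_link (.xu _) (vo_ne_vx _ _).symm
    · rw [if_neg (by omega), if_neg (show ¬ (i+1 = 0) by omega), if_neg (show ¬ (i+1 = 1) by omega)]
      rcases Nat.lt_or_ge i 2 with h | h
      · obtain rfl : i = 1 := by omega
        rw [if_pos rfl, if_pos (by omega)]
        exact adj_of_link (.ua p hp) (vo_ne_va _ _ _)
      · rw [if_neg (by omega), if_pos (show i ≤ r by omega)]
        rcases Nat.lt_or_ge i r with h' | h'
        · rw [if_pos (by omega), show i + 1 - 1 = i - 1 + 1 by omega]
          exact adj_of_link (.aa p hp (i-1) (by omega) (by omega)) (by simp [va])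
        · obtain rfl : i = r := by omega
          rw [if_neg (by omega)]
          exact adj_of_link (.av p hp) (vo_ne_va _ _ _).symm
  · rw [if_neg (by omega), if_neg (by omega), if_neg (by omega), if_pos rfl]
    exact adj_of_link' (.xu _) (vo_ne_vx _ _)
  · intro i hi j hj h
    split_ifs at h <;> simp [va, vx, vo, hne, hne.symm] at h <;> omega

end Back

section Count

/-- The vertices of the gadget of one edge. -/
def gad [DecidableEq V] (r ℓ : ℕ) (p : V × V) : Finset (W V) :=
  (Finset.Icc 1 (r-1)).image (va p) ∪ ((Finset.Icc 1 ℓ).image (vb p) ∪ (Finset.Icc 1 ℓ).image (vc p))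

theorem mem_gad [DecidableEq V] {r ℓ : ℕ} {p : V × V} {x : W V} : x ∈ gad r ℓ p ↔
    (∃ i, (1 ≤ i ∧ i ≤ r - 1) ∧ va p i = x) ∨ (∃ i, (1 ≤ i ∧ i ≤ ℓ) ∧ vb p i = x) ∨
      (∃ i, (1 ≤ i ∧ i ≤ ℓ) ∧ vc p i = x) := by
  simp [gad]

theorem card_gad [DecidableEq V] {r ℓ : ℕ} (hr : 2 ≤ r) (p : V × V) :
    (gad r ℓ p).card = 2 * ℓ + r - 1 := by
  unfold gad
  rw [Finset.card_union_of_disjoint, Finset.card_union_of_disjoint,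
    Finset.card_image_of_injective _ (fun i j h => (va_inj.1 h).2),
    Finset.card_image_of_injective _ (fun i j h => (vb_inj.1 h).2),
    Finset.card_image_of_injective _ (fun i j h => (vc_inj.1 h).2), Nat.card_Icc, Nat.card_Icc]
  · omega
  · rw [Finset.disjoint_left]
    intro x hx hy
    simp only [Finset.mem_image] at hx hy
    obtain ⟨i, _, rfl⟩ := hx
    obtain ⟨j, _, h⟩ := hy
    exact vb_ne_vc _ _ _ _ h.symm
  · rw [Finset.disjoint_left]
    intro x hx hy
    simp only [Finset.mem_image, Finset.mem_union] at hx hy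
    obtain ⟨i, _, rfl⟩ := hx
    rcases hy with ⟨j, _, h⟩ | ⟨j, _, h⟩
    · exact va_ne_vb _ _ _ _ h.symm
    · exact va_ne_vc _ _ _ _ h.symm

/-- Original vertices `S`, the cycle `X`, and the gadgets of the edges in `E`. -/
def full [DecidableEq V] (r ℓ : ℕ) (E : Finset (V × V)) (S : Finset V) : Finset (W V) :=
  S.image vo ∪ ((Finset.Icc 1 (r+1)).image vx ∪ E.biUnion (gad r ℓ))

theorem card_full [DecidableEq V] {r ℓ : ℕ} (hr : 2 ≤ r) (E : Finset (V × V)) (S : Finset V) :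
    (full r ℓ E S).card = S.card + (r + 1) + E.card * (2 * ℓ + r - 1) := by
  unfold full
  have hE : (E.biUnion (gad r ℓ)).card = E.card * (2 * ℓ + r - 1) := by
    rw [Finset.card_biUnion]
    · simp [card_gad hr]
    · intro p _ q _ hpq
      change Disjoint (gad r ℓ p) (gad r ℓ q)
      rw [Finset.disjoint_left]
      intro x hx hy
      rw [mem_gad] at hx hy
      rcases hx with ⟨i, _, rfl⟩ | ⟨i, _, rfl⟩ | ⟨i, _, rfl⟩ <;>
      rcases hy with ⟨j, _, h⟩ | ⟨j, _, h⟩ | ⟨j, _, h⟩ <;>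
      simp [va, vb, vc] at h <;> exact hpq h.1.symm
  rw [Finset.card_union_of_disjoint, Finset.card_union_of_disjoint, hE,
    Finset.card_image_of_injective _ (fun i j h => vo_inj.1 h),
    Finset.card_image_of_injective _ (fun i j h => vx_inj.1 h), Nat.card_Icc]
  · omega
  · rw [Finset.disjoint_left]
    intro x hx hy
    simp only [Finset.mem_image, Finset.mem_biUnion, mem_gad] at hx hy
    obtain ⟨i, _, rfl⟩ := hx
    obtain ⟨p, _, h⟩ := hy
    simp [va, vb, vc, vx] at h
  · rw [Finset.disjoint_left]
    intro x hx hy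
    simp only [Finset.mem_image, Finset.mem_union, Finset.mem_biUnion, mem_gad] at hx hy
    obtain ⟨i, _, rfl⟩ := hx
    simp [va, vb, vc, vx, vo] at hy

end Count

theorem card_orient [Fintype V] [DecidableEq V] (G : SimpleGraph V) [DecidableRel G.Adj]
    (D : Set (V × V)) (E : Finset (V × V)) (hE : ∀ p, p ∈ E ↔ p ∈ D)
    (hD1 : ∀ p ∈ D, G.Adj p.1 p.2)
    (hD2 : ∀ u v : V, G.Adj u v → (u, v) ∈ D ∨ (v, u) ∈ D)
    (hD3 : ∀ u v : V, (u, v) ∈ D → (v, u) ∉ D) : E.card = G.edgeFinset.card := by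
  refine Finset.card_bij (fun p _ => s(p.1, p.2)) ?_ ?_ ?_
  · intro p hp
    rw [SimpleGraph.mem_edgeFinset, SimpleGraph.mem_edgeSet]
    exact hD1 p ((hE p).1 hp)
  · rintro ⟨a, b⟩ hp ⟨c, d⟩ hq h
    rcases Sym2.eq_iff.1 h with ⟨h1, h2⟩ | ⟨h1, h2⟩
    · exact Prod.ext h1 h2
    · dsimp only at h1 h2
      subst h1 h2
      exact absurd ((hE _).1 hq) (hD3 _ _ ((hE _).1 hp))
  · intro e he
    induction e using Sym2.ind with
    | _ u v =>
      rw [SimpleGraph.mem_edgeFinset, SimpleGraph.mem_edgeSet] at he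
      rcases hD2 u v he with h | h
      · exact ⟨(u, v), (hE _).2 h, rfl⟩
      · exact ⟨(v, u), (hE _).2 h, Sym2.eq_swap⟩

/-- For `r ≥ 2`, `ℓ = ⌈r/2⌉ + 1` and `D` an orientation of the edges of a
finite simple graph `G` with `m` edges, `G` has a vertex cover of size at most `k` iff the
constructed graph `G'` has an `r`-fault tolerant feedback vertex set of size at most
`k + (r + 1) + m·(2ℓ + r − 1)`. -/
theorem vertexCover_iff_gadget_rftfvs
    {V : Type*} [Fintype V] [DecidableEq V]
    (r : ℕ) (hr : 2 ≤ r) (G : SimpleGraph V) [DecidableRel G.Adj]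
    (ℓ : ℕ) (hℓ : ℓ = (r + 1) / 2 + 1)
    (D : Set (V × V))
    (hD1 : ∀ p ∈ D, G.Adj p.1 p.2)
    (hD2 : ∀ u v : V, G.Adj u v → (u, v) ∈ D ∨ (v, u) ∈ D)
    (hD3 : ∀ u v : V, (u, v) ∈ D → (v, u) ∉ D)
    (k : ℕ) :
    (∃ S : Finset V, (∀ u v : V, G.Adj u v → u ∈ S ∨ v ∈ S) ∧ S.card ≤ k) ↔
      (∃ S' : Finset (W V),
        (∀ ⦃w : W V⦄ (c : (gadgetGraph r ℓ D).Walk w w), c.IsCycle →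
          r + 1 ≤ (c.support.toFinset ∩ S').card) ∧
        S'.card ≤ k + (r + 1) + G.edgeFinset.card * (2 * ℓ + r - 1)) := by

  classical
  obtain ⟨E, hE⟩ : ∃ E : Finset (V × V), ∀ p, p ∈ E ↔ p ∈ D :=
    ⟨(Set.toFinite D).toFinset, fun p => by simp⟩
  have hcard := card_orient G D E hE hD1 hD2 hD3
  have hD0 : ∀ p ∈ D, p.1 ≠ p.2 := fun p hp => (hD1 p hp).ne
  constructor
  · rintro ⟨S, hS, hk⟩
    refine ⟨full r ℓ E S, ?_, ?_⟩
    · intro w c hc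
      refine core hr hℓ hD0 hD3 ?_ ⟨w, by simp⟩ _ ?_ ?_ ?_ ?_ ?_
      · intro x hx y
        obtain ⟨z, hz, h⟩ := cycle_two_nbrs c hc (List.mem_toFinset.1 hx) y
        exact ⟨z, List.mem_toFinset.2 hz, h⟩
      · intro p hp i h1 h2
        refine Finset.mem_union_right _ (Finset.mem_union_right _
          (Finset.mem_biUnion.2 ⟨p, (hE p).2 hp, mem_gad.2 (Or.inl ⟨i, ⟨h1, h2⟩, rfl⟩)⟩))
      · intro p hp i h1 h2
        refine Finset.mem_union_right _ (Finset.mem_union_right _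
          (Finset.mem_biUnion.2 ⟨p, (hE p).2 hp, mem_gad.2 (Or.inr (Or.inl ⟨i, ⟨h1, h2⟩, rfl⟩))⟩))
      · intro p hp i h1 h2
        refine Finset.mem_union_right _ (Finset.mem_union_right _
          (Finset.mem_biUnion.2 ⟨p, (hE p).2 hp, mem_gad.2 (Or.inr (Or.inr ⟨i, ⟨h1, h2⟩, rfl⟩))⟩))
      · intro i h1 h2
        exact Finset.mem_union_right _ (Finset.mem_union_left _
          (Finset.mem_image_of_mem _ (Finset.mem_Icc.2 ⟨h1, h2⟩)))
      · intro p hp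
        rcases hS _ _ (hD1 p hp) with h | h
        · exact Or.inl (Finset.mem_union_left _ (Finset.mem_image_of_mem _ h))
        · exact Or.inr (Finset.mem_union_left _ (Finset.mem_image_of_mem _ h))
    · rw [card_full hr, hcard]
      omega
  · rintro ⟨T, hT, hk⟩
    refine ⟨Finset.univ.filter fun u => vo u ∈ T, ?_, ?_⟩
    · intro u v huv
      simp only [Finset.mem_filter, Finset.mem_univ, true_and]
      rcases hD2 u v huv with h | h
      · exact back_cover hr hT h (hD0 _ h)
      · exact (back_cover hr hT h (hD0 _ h)).symm
    · have hsub : full r ℓ E (Finset.univ.filter fun u => vo u ∈ T) ⊆ T := by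
        intro x hx
        simp only [full, Finset.mem_union, Finset.mem_image, Finset.mem_biUnion, mem_gad,
          Finset.mem_filter, Finset.mem_univ, true_and, Finset.mem_Icc] at hx
        rcases hx with ⟨u, hu, rfl⟩ | ⟨i, ⟨h1, h2⟩, rfl⟩ | ⟨p, hp, h⟩
        · exact hu
        · exact back_x hr hT i h1 h2
        · have hb := back_b hr hℓ hT ((hE p).1 hp)
          have hc := back_c hr hℓ hT ((hE p).1 hp)
          rcases h with ⟨i, ⟨h1, h2⟩, rfl⟩ | ⟨i, ⟨h1, h2⟩, rfl⟩ | ⟨i, ⟨h1, h2⟩, rfl⟩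
          · rcases Nat.lt_or_ge (r/2) i with h | h
            · exact hc.1 i (by omega) h2
            · exact hb.1 i h1 h
          · exact hb.2 i h1 h2
          · exact hc.2 i h1 h2
      have := Finset.card_le_card hsub
      rw [card_full hr, hcard] at this
      omega

end FTFVSHardness
end

section
/- Let G be a finite simple graph with distinguished vertices s and t, and let T ⊆ V(G). If T is not a tracking set for G, then there exist two distinct simple s-t paths P_1 ≠ P_2 with equal tracker sequences with respect to T, and a cycle C in G with V(C) ⊆ V(P_1) ∪ V(P_2), such that C has a local s-t pair (a, b) and T ∩ (V(C) \ {a,b}) = ∅. -/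
/-- The tracker sequence of a walk `p` with respect to a tracker set `T`: the subsequence of
the vertex sequence of `p` consisting of the vertices lying in `T`. -/
def trackerSeq {V : Type*} [DecidableEq V] {G : SimpleGraph V} {s t : V}
    (T : Finset V) (p : G.Walk s t) : List V :=
  p.support.filter (· ∈ T)

/-- `T` is a tracking set for `G` (with source `s` and target `t`) if any two distinct
simple `s`-`t` paths have distinct tracker sequences. -/
def IsTrackingSet {V : Type*} [DecidableEq V] (G : SimpleGraph V) (s t : V)
    (T : Finset V) : Prop :=
  ∀ P₁ P₂ : G.Walk s t, P₁.IsPath → P₂.IsPath → trackerSeq T P₁ = trackerSeq T P₂ → P₁ = P₂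

/-- Vertices `a, b` of a subgraph with vertex set `U` form a local `s`-`t` pair for it if
there are simple paths `P_sa` from `s` to `a` and `P_bt` from `b` to `t` in `G` with
`V(P_sa) ∩ V(P_bt) = ∅`, `V(P_sa) ∩ U = {a}` and `V(P_bt) ∩ U = {b}`. -/
def LocalSTPair {V : Type*} (G : SimpleGraph V) (s t : V) (U : Set V) (a b : V) : Prop :=
  a ∈ U ∧ b ∈ U ∧
  ∃ (Psa : G.Walk s a) (Pbt : G.Walk b t),
    Psa.IsPath ∧ Pbt.IsPath ∧
    {v | v ∈ Psa.support} ∩ {v | v ∈ Pbt.support} = (∅ : Set V) ∧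
    {v | v ∈ Psa.support} ∩ U = {a} ∧
    {v | v ∈ Pbt.support} ∩ U = {b}


namespace TrackAux

open SimpleGraph

variable {V : Type*} [DecidableEq V] {G : SimpleGraph V}

theorem append_isPath_iff {u v w : V} (a : G.Walk u v) (b : G.Walk v w) :
    (a.append b).IsPath ↔ a.IsPath ∧ b.IsPath ∧ ∀ x ∈ a.support, x ∈ b.support → x = v := by
  have hb : b.support = v :: b.support.tail := b.support_eq_cons
  rw [Walk.isPath_def, Walk.isPath_def, Walk.isPath_def, Walk.support_append, List.nodup_append']
  constructor
  · rintro ⟨h1, h2, h3⟩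
    refine ⟨h1, ?_, ?_⟩
    · rw [hb, List.nodup_cons]
      exact ⟨fun h => h3 a.end_mem_support h, h2⟩
    · intro x hx hxb
      rw [hb, List.mem_cons] at hxb
      rcases hxb with h | h
      · exact h
      · exact (h3 hx h).elim
  · rintro ⟨h1, h2, h3⟩
    rw [hb, List.nodup_cons] at h2
    refine ⟨h1, h2.2, ?_⟩
    intro x hx hxb
    have : x = v := h3 x hx (by rw [hb]; exact List.mem_cons_of_mem _ hxb)
    subst this
    exact h2.1 hxb

theorem first_split {u v : V} (p : G.Walk u v) (Pr : V → Prop) (h : ∃ x ∈ p.support, Pr x) :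
    ∃ (w : V) (a : G.Walk u w) (b : G.Walk w v), p = a.append b ∧ Pr w ∧
      ∀ x ∈ a.support, Pr x → x = w := by
  induction p with
  | nil =>
    obtain ⟨x, hx, hP⟩ := h
    simp at hx
    subst hx
    exact ⟨x, Walk.nil, Walk.nil, rfl, hP, by simp⟩
  | @cons u u' v hadj p ih =>
    by_cases hu : Pr u
    · exact ⟨u, Walk.nil, Walk.cons hadj p, rfl, hu, by simp⟩
    · have h' : ∃ x ∈ p.support, Pr x := by
        obtain ⟨x, hx, hP⟩ := h
        rw [Walk.support_cons, List.mem_cons] at hx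
        rcases hx with rfl | hx
        · exact (hu hP).elim
        · exact ⟨x, hx, hP⟩
      obtain ⟨w, a, b, hab, hw, hf⟩ := ih h'
      refine ⟨w, Walk.cons hadj a, b, by rw [hab]; rfl, hw, ?_⟩
      intro x hx hP
      rw [Walk.support_cons, List.mem_cons] at hx
      rcases hx with rfl | hx
      · exact (hu hP).elim
      · exact hf x hx hP

theorem split_at {u v w : V} (p : G.Walk u v) (h : w ∈ p.support) :
    ∃ (a : G.Walk u w) (b : G.Walk w v), p = a.append b :=
  ⟨p.takeUntil w h, p.dropUntil w h, (p.take_spec h).symm⟩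

theorem trackerSeq_cons (T : Finset V) {u v w : V} (h : G.Adj u v) (p : G.Walk v w) :
    trackerSeq T (Walk.cons h p) = (if u ∈ T then [u] else []) ++ trackerSeq T p := by
  unfold trackerSeq
  rw [Walk.support_cons, List.filter_cons]
  split_ifs <;> simp_all

theorem trackerSeq_append (T : Finset V) {u v w : V} (a : G.Walk u v) (b : G.Walk v w) :
    trackerSeq T (a.append b) = trackerSeq T a ++ b.support.tail.filter (· ∈ T) := by
  unfold trackerSeq
  rw [Walk.support_append, List.filter_append]

theorem trackerSeq_eq (T : Finset V) {u v : V} (a : G.Walk u v) :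
    trackerSeq T a = (if u ∈ T then [u] else []) ++ a.support.tail.filter (· ∈ T) := by
  unfold trackerSeq
  rw [Walk.support_eq_cons, List.filter_cons]
  split_ifs <;> simp_all

theorem trackerSeq_append_right (T : Finset V) {u v w : V} (a : G.Walk u v) (b b' : G.Walk v w)
    (h : trackerSeq T b = trackerSeq T b') :
    trackerSeq T (a.append b) = trackerSeq T (a.append b') := by
  rw [trackerSeq_append, trackerSeq_append]
  rw [trackerSeq_eq, trackerSeq_eq] at h
  rw [List.append_cancel_left h]

theorem trackerSeq_append_left (T : Finset V) {u v w : V} (a a' : G.Walk u v) (b : G.Walk v w)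
    (h : trackerSeq T (a.append b) = trackerSeq T (a'.append b)) :
    trackerSeq T a = trackerSeq T a' := by
  rw [trackerSeq_append, trackerSeq_append] at h
  exact List.append_cancel_right h

theorem length_trackerSeq_append (T : Finset V) {u v w : V} (a : G.Walk u v) (b : G.Walk v w) :
    (trackerSeq T b).length ≤ (trackerSeq T (a.append b)).length := by
  induction a with
  | nil => exact le_rfl
  | cons h a ih =>
    rw [Walk.cons_append, trackerSeq_cons]
    have := ih b
    simp only [List.length_append]
    omega

theorem mem_trackerSeq (T : Finset V) {u v x : V} (a : G.Walk u v) :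
    x ∈ trackerSeq T a ↔ x ∈ a.support ∧ x ∈ T := by
  simp [trackerSeq]

theorem list_split {α : Type*} {w : α} : ∀ {l₁ r₁ l₂ r₂ : List α}, (l₁ ++ w :: r₁).Nodup →
    l₁ ++ w :: r₁ = l₂ ++ w :: r₂ → r₁ = r₂
  | [], r₁, [], r₂, _, h => by simpa using h
  | [], r₁, y :: l₂, r₂, hn, h => by
    simp only [List.nil_append, List.cons_append, List.cons.injEq] at h
    obtain ⟨rfl, rfl⟩ := h
    simp at hn
  | y :: l₁, r₁, [], r₂, hn, h => by
    simp only [List.nil_append, List.cons_append, List.cons.injEq] at h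
    obtain ⟨rfl, rfl⟩ := h
    simp at hn
  | y :: l₁, r₁, z :: l₂, r₂, hn, h => by
    simp only [List.cons_append, List.cons.injEq] at h
    simp only [List.cons_append, List.nodup_cons] at hn
    exact list_split hn.2 h.2

/-- Tails from a common tracker agree. -/
theorem tail_eq (T : Finset V) {s t w : V} (hw : w ∈ T) (a a' : G.Walk s w) (b b' : G.Walk w t)
    (hp : (a.append b).IsPath)
    (h : trackerSeq T (a.append b) = trackerSeq T (a'.append b')) :
    trackerSeq T b = trackerSeq T b' := by
  have key : ∀ (a : G.Walk s w) (b : G.Walk w t), ∃ l, trackerSeq T (a.append b) =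
      l ++ w :: b.support.tail.filter (· ∈ T) := by
    intro a b
    rw [trackerSeq_append]
    refine ⟨trackerSeq T a |>.dropLast, ?_⟩
    have : trackerSeq T a = (trackerSeq T a).dropLast ++ [w] := by
      have h1 : a.support = a.support.dropLast ++ [w] := by
        conv_lhs => rw [← List.dropLast_append_getLast a.support_ne_nil, a.getLast_support]
      unfold trackerSeq
      rw [h1, List.filter_append]
      simp [hw]
    conv_lhs => rw [this]
    simp
  obtain ⟨l, hl⟩ := key a b
  obtain ⟨l', hl'⟩ := key a' b'
  have hn : (trackerSeq T (a.append b)).Nodup := by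
    unfold trackerSeq
    exact ((Walk.isPath_def _).1 hp).filter _
  rw [hl] at hn
  rw [hl, hl'] at h
  rw [trackerSeq_eq, trackerSeq_eq, list_split hn h]

/-- Conclusion, inside a vertex set `S`. -/
def Concl (G : SimpleGraph V) (T : Finset V) (S : Finset V) (s t : V) : Prop :=
  ∃ (v : V) (C : G.Walk v v) (a b : V) (A : G.Walk s a) (B : G.Walk b t),
    C.IsCycle ∧ (∀ x ∈ C.support, x ∈ S) ∧ a ∈ C.support ∧ b ∈ C.support ∧
    A.IsPath ∧ B.IsPath ∧ (∀ x ∈ A.support, x ∈ S) ∧ (∀ x ∈ B.support, x ∈ S) ∧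
    (∀ x ∈ A.support, x ∉ B.support) ∧ (∀ x ∈ A.support, x ∈ C.support → x = a) ∧
    (∀ x ∈ B.support, x ∈ C.support → x = b) ∧ (∀ x ∈ C.support, x ∈ T → x = a ∨ x = b)

theorem Concl.front {T S S' : Finset V} {s x t : V} (h : G.Adj s x) (hs : s ∉ S')
    (hS : S' ⊆ S) (hsS : s ∈ S) (hc : Concl G T S' x t) : Concl G T S s t := by
  obtain ⟨v, C, a, b, A, B, h1, h2, h3, h4, h5, h6, h7, h8, h9, h10, h11, h12⟩ := hc
  refine ⟨v, C, a, b, Walk.cons h A, B, h1, fun x hx => hS (h2 x hx), h3, h4, ?_, h6, ?_,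
    fun x hx => hS (h8 x hx), ?_, ?_, h11, h12⟩
  · rw [Walk.cons_isPath_iff]
    exact ⟨h5, fun hh => hs (h7 _ hh)⟩
  all_goals
    intro y hy
    rw [Walk.support_cons, List.mem_cons] at hy
    rcases hy with rfl | hy
  · exact hsS
  · exact hS (h7 y hy)
  · exact fun hh => hs (h8 _ hh)
  · exact h9 y hy
  · exact fun hh => (hs (h2 _ hh)).elim
  · exact h10 y hy

theorem Concl.back {T S S' : Finset V} {s w t : V} (Q : G.Walk w t) (hQ : Q.IsPath)
    (hQS : ∀ x ∈ Q.support, x ∈ S) (hQS' : ∀ x ∈ Q.support, x ∈ S' → x = w)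
    (hS : S' ⊆ S) (hc : Concl G T S' s w) : Concl G T S s t := by
  obtain ⟨v, C, a, b, A, B, h1, h2, h3, h4, h5, h6, h7, h8, h9, h10, h11, h12⟩ := hc
  refine ⟨v, C, a, b, A, B.append Q, h1, fun x hx => hS (h2 x hx), h3, h4, h5, ?_,
    fun x hx => hS (h7 x hx), ?_, ?_, h10, ?_, h12⟩
  · rw [append_isPath_iff]
    exact ⟨h6, hQ, fun x hx hxQ => hQS' x hxQ (h8 x hx)⟩
  · intro x hx
    rw [Walk.mem_support_append_iff] at hx
    rcases hx with hx | hx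
    · exact hS (h8 x hx)
    · exact hQS x hx
  · intro x hx hxB
    rw [Walk.mem_support_append_iff] at hxB
    rcases hxB with hxB | hxB
    · exact h9 x hx hxB
    · have := hQS' x hxB (h7 x hx)
      subst this
      exact h9 _ hx B.end_mem_support
  · intro x hx hxC
    rw [Walk.mem_support_append_iff] at hx
    rcases hx with hx | hx
    · exact h11 x hx hxC
    · have := hQS' x hx (h2 x hxC)
      subst this
      exact h11 _ B.end_mem_support hxC

/-- Rerouting. -/
theorem reroute {T S : Finset V} {x t : V}
    (uniq : ∀ p q : G.Walk x t, p.IsPath → q.IsPath → (∀ y ∈ p.support, y ∈ S) →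
      (∀ y ∈ q.support, y ∈ S) → trackerSeq T p = trackerSeq T q → p = q) :
    ∀ (n : ℕ) (F F' : ∀ w, G.Walk w t → Prop),
      (∀ w q, F w q → q.IsPath ∧ ∀ y ∈ q.support, y ∈ S) →
      (∀ w q, F' w q → q.IsPath ∧ ∀ y ∈ q.support, y ∈ S) →
      (∀ w w' (a : G.Walk w w') b, F w (a.append b) → F w' b) →
      (∀ w w' (a : G.Walk w w') b, F' w (a.append b) → F' w' b) →
      (∀ w q, w ∈ T → w ≠ t → F w q → ∃ q', F' w q' ∧ trackerSeq T q = trackerSeq T q' ∧ q ≠ q') →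
      (∀ w q, w ∈ T → w ≠ t → F' w q → ∃ q', F w q' ∧ trackerSeq T q = trackerSeq T q' ∧ q ≠ q') →
      ∀ (c : V) (U : G.Walk x c) (Q : G.Walk c t), F c Q → (U.append Q).IsPath →
        (∀ y ∈ U.support, y ∈ S) → (∀ y ∈ U.support, y ∈ T → y = c) →
        (trackerSeq T Q).length ≤ n →
        ∃ W : G.Walk x t, W.IsPath ∧ (∀ y ∈ W.support, y ∈ S) ∧
          ∀ y ∈ W.support, y ∈ T → y = t := by
  intro n
  induction n with
  | zero =>
    intro F F' hF hF' sF sF' ex ex' c U Q hQ hp hUS hUT hn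
    refine ⟨U.append Q, hp, ?_, ?_⟩
    · intro y hy
      rw [Walk.mem_support_append_iff] at hy
      exact hy.elim (hUS y) ((hF _ _ hQ).2 y)
    · have hno : ∀ y ∈ Q.support, y ∉ T := by
        intro y hy hyT
        have : y ∈ trackerSeq T Q := (mem_trackerSeq T Q).2 ⟨hy, hyT⟩
        rw [List.length_eq_zero_iff.1 (Nat.le_zero.1 hn)] at this
        simp at this
      intro y hy hyT
      rw [Walk.mem_support_append_iff] at hy
      rcases hy with hy | hy
      · have := hUT y hy hyT
        subst this
        exact (hno _ Q.start_mem_support hyT).elim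
      · exact (hno y hy hyT).elim
  | succ n ih =>
    intro F F' hF hF' sF sF' ex ex' c U Q hQ hp hUS hUT hn
    by_cases hno : ∀ y ∈ Q.support, y ∈ T → y = t
    · refine ⟨U.append Q, hp, ?_, ?_⟩
      · intro y hy
        rw [Walk.mem_support_append_iff] at hy
        exact hy.elim (hUS y) ((hF _ _ hQ).2 y)
      · intro y hy hyT
        rw [Walk.mem_support_append_iff] at hy
        rcases hy with hy | hy
        · have := hUT y hy hyT
          subst this
          exact hno _ Q.start_mem_support hyT
        · exact hno y hy hyT
    push Not at hno
    obtain ⟨w, a, b, rfl, ⟨hwT, hwt⟩, hfirst⟩ := first_split Q (fun y => y ∈ T ∧ y ≠ t) hno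
    have hb := sF _ _ _ _ hQ
    obtain ⟨b', hb', hseq, hne⟩ := ex w b hwT hwt hb
    rw [Walk.append_assoc] at hp
    have hpp := (append_isPath_iff _ _).1 hp
    have haT : ∀ y ∈ a.support, y ∈ T → y = w := by
      intro y hy hyT
      by_cases hyt : y = t
      · subst hyt
        exact hpp.2.2 y ((Walk.mem_support_append_iff _ _).2 (Or.inr hy)) b.end_mem_support
      · exact hfirst y hy ⟨hyT, hyt⟩
    have hU'T : ∀ y ∈ (U.append a).support, y ∈ T → y = w := by
      intro y hy hyT
      rw [Walk.mem_support_append_iff] at hy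
      rcases hy with hy | hy
      · have := hUT y hy hyT
        subst this
        exact haT _ a.start_mem_support hyT
      · exact haT y hy hyT
    have hU'S : ∀ y ∈ (U.append a).support, y ∈ S := by
      intro y hy
      rw [Walk.mem_support_append_iff] at hy
      rcases hy with hy | hy
      · exact hUS y hy
      · exact (hF _ _ hQ).2 y ((Walk.mem_support_append_iff _ _).2 (Or.inl hy))
    generalize U.append a = U' at hp hpp hU'T hU'S
    by_cases hd : ∀ y ∈ U'.support, y ∈ b'.support → y = w
    · exfalso
      have hp' : (U'.append b').IsPath :=
        (append_isPath_iff _ _).2 ⟨hpp.1, (hF' _ _ hb').1, hd⟩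
      have heq := uniq (U'.append b) (U'.append b') hp hp'
        (by
          intro y hy
          rw [Walk.mem_support_append_iff] at hy
          exact hy.elim (hU'S y) ((hF _ _ hb).2 y))
        (by
          intro y hy
          rw [Walk.mem_support_append_iff] at hy
          exact hy.elim (hU'S y) ((hF' _ _ hb').2 y))
        (trackerSeq_append_right T U' b b' hseq)
      apply hne
      apply Walk.ext_support
      have h2 := congrArg Walk.support heq
      rw [Walk.support_append, Walk.support_append] at h2
      rw [b.support_eq_cons, b'.support_eq_cons, List.append_cancel_left h2]
    · push Not at hd
      obtain ⟨c', e, f, rfl, ⟨hcb, hcw⟩, hfc⟩ :=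
        first_split U' (fun y => y ∈ b'.support ∧ y ≠ w) hd
      obtain ⟨a', b'', rfl⟩ := split_at b' hcb
      have hef := (append_isPath_iff _ _).1 hpp.1
      have hwe : w ∉ e.support := fun h => hcw (hef.2.2 w h f.end_mem_support).symm
      refine ih F' F hF' hF sF' sF ex' ex c' e b'' (sF' _ _ _ _ hb') ?_ ?_ ?_ ?_
      · rw [append_isPath_iff]
        refine ⟨hef.1, (hF' _ _ (sF' _ _ _ _ hb')).1, ?_⟩
        intro y hy hyb
        apply hfc y hy
        refine ⟨(Walk.mem_support_append_iff _ _).2 (Or.inr hyb), ?_⟩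
        rintro rfl
        exact hwe hy
      · intro y hy
        exact hU'S y ((Walk.mem_support_append_iff _ _).2 (Or.inl hy))
      · intro y hy hyT
        have := hU'T y ((Walk.mem_support_append_iff _ _).2 (Or.inl hy)) hyT
        subst this
        exact (hwe hy).elim
      · have h1 := length_trackerSeq_append T a b
        rw [hseq] at h1
        cases a' with
        | nil => exact (hcw rfl).elim
        | cons hadj a' =>
          rw [Walk.cons_append, trackerSeq_cons] at h1
          have h2 := length_trackerSeq_append T a' b''
          simp only [hwT, if_true, List.length_append, List.length_singleton] at h1
          omega

theorem final {T S : Finset V} {s t x₁ x₂ : V} (h₁ : G.Adj s x₁) (h₂ : G.Adj s x₂)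
    (hx : x₁ ≠ x₂) (hs : s ∈ S) (U₁ : G.Walk x₁ t) (U₂ : G.Walk x₂ t)
    (hp₁ : U₁.IsPath) (hp₂ : U₂.IsPath)
    (hS₁ : ∀ y ∈ U₁.support, y ∈ S.erase s) (hS₂ : ∀ y ∈ U₂.support, y ∈ S.erase s)
    (hT₁ : ∀ y ∈ U₁.support, y ∈ T → y = t) (hT₂ : ∀ y ∈ U₂.support, y ∈ T → y = t) :
    Concl G T S s t := by
  obtain ⟨b, e, f, rfl, hb, hfirst⟩ := first_split U₁ (fun y => y ∈ U₂.support)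
    ⟨t, U₁.end_mem_support, U₂.end_mem_support⟩
  obtain ⟨g, k, rfl⟩ := split_at U₂ hb
  simp only [Walk.mem_support_append_iff] at hS₁ hS₂ hT₁ hT₂ hfirst
  rw [append_isPath_iff] at hp₁ hp₂
  have hse : s ∉ e.support := fun h => by simpa using hS₁ s (Or.inl h)
  have hsg : s ∉ g.support := fun h => by simpa using hS₂ s (Or.inl h)
  have hsk : s ∉ k.support := fun h => by simpa using hS₂ s (Or.inr h)
  have hmem : ∀ y, y ∈ (Walk.cons h₁ (e.append (Walk.cons h₂ g).reverse)).support ↔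
      y = s ∨ y ∈ e.support ∨ y ∈ g.support := by
    intro y
    simp only [Walk.support_cons, List.mem_cons, Walk.mem_support_append_iff,
      Walk.support_reverse, List.mem_reverse]
    tauto
  refine ⟨s, Walk.cons h₁ (e.append (Walk.cons h₂ g).reverse), s, b, Walk.nil, k,
    ?_, ?_, ?_, ?_, Walk.IsPath.nil, hp₂.2.1, ?_, ?_, ?_, ?_, ?_, ?_⟩
  · rw [Walk.cons_isCycle_iff]
    constructor
    · rw [append_isPath_iff]
      refine ⟨hp₁.1, ?_, ?_⟩
      · rw [Walk.isPath_reverse_iff, Walk.cons_isPath_iff]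
        exact ⟨hp₂.1, hsg⟩
      · intro y hy hy'
        simp only [Walk.support_cons, List.mem_cons, Walk.support_reverse, List.mem_reverse] at hy'
        rcases hy' with rfl | hy'
        · exact (hse hy).elim
        · exact hfirst y hy (Or.inl hy')
    · intro h
      simp only [Walk.edges_append, Walk.edges_reverse, Walk.edges_cons, List.mem_append,
        List.mem_reverse, List.mem_cons] at h
      rcases h with h | h | h
      · exact hse (e.fst_mem_support_of_mem_edges h)
      · rw [Sym2.eq_iff] at h
        rcases h with h | h
        · exact hx h.2
        · exact h₂.ne h.1
      · exact hsg (g.fst_mem_support_of_mem_edges h)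
  · intro y hy
    rw [hmem] at hy
    rcases hy with rfl | hy | hy
    · exact hs
    · exact Finset.mem_of_mem_erase (hS₁ y (Or.inl hy))
    · exact Finset.mem_of_mem_erase (hS₂ y (Or.inl hy))
  · exact Walk.start_mem_support _
  · exact (hmem b).2 (Or.inr (Or.inl e.end_mem_support))
  · intro y hy
    simp at hy
    exact hy ▸ hs
  · intro y hy
    exact Finset.mem_of_mem_erase (hS₂ y (Or.inr hy))
  · intro y hy
    simp at hy
    exact hy ▸ hsk
  · intro y hy _
    simpa using hy
  · intro y hy hyC
    rw [hmem] at hyC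
    rcases hyC with rfl | h | h
    · exact (hsk hy).elim
    · exact hfirst y h (Or.inr hy)
    · exact hp₂.2.2 y h hy
  · intro y hy hyT
    rw [hmem] at hy
    rcases hy with rfl | h | h
    · exact Or.inl rfl
    · have := hT₁ y (Or.inl h) hyT
      subst this
      exact Or.inr (hfirst y h (Or.inr k.end_mem_support))
    · have := hT₂ y (Or.inl h) hyT
      subst this
      exact Or.inr (hp₂.2.2 y h k.end_mem_support)

/-- Exchange of suffixes at a tracker. -/
theorem exchange {T : Finset V} {s t x₁ x₂ : V} (h₁ : G.Adj s x₁) (h₂ : G.Adj s x₂)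
    (p₁ : G.Walk x₁ t) (p₂ : G.Walk x₂ t)
    (hp₁ : (Walk.cons h₁ p₁).IsPath)
    (hseq : trackerSeq T (Walk.cons h₁ p₁) = trackerSeq T (Walk.cons h₂ p₂))
    (hstrip : ∀ (w : V) (a a' : G.Walk s w) (b : G.Walk w t), w ≠ t →
      Walk.cons h₁ p₁ = a.append b → Walk.cons h₂ p₂ = a'.append b → False)
    (w : V) (q : G.Walk w t) (hw : w ∈ T) (hwt : w ≠ t) (hq : ∃ a, p₁ = Walk.append a q) :
    ∃ q', (∃ a, p₂ = Walk.append a q') ∧ trackerSeq T q = trackerSeq T q' ∧ q ≠ q' := by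
  obtain ⟨a, rfl⟩ := hq
  have hw1 : w ∈ (a.append q).support :=
    (Walk.mem_support_append_iff _ _).2 (Or.inl a.end_mem_support)
  have hws : w ≠ s := by
    rintro rfl
    exact ((Walk.cons_isPath_iff _ _).1 hp₁).2 hw1
  have hw2 : w ∈ trackerSeq T (Walk.cons h₂ p₂) := by
    rw [← hseq, mem_trackerSeq]
    exact ⟨by rw [Walk.support_cons]; exact List.mem_cons_of_mem _ hw1, hw⟩
  have hw3 : w ∈ p₂.support := by
    have := ((mem_trackerSeq _ _).1 hw2).1
    rw [Walk.support_cons, List.mem_cons] at this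
    exact this.resolve_left hws
  obtain ⟨a', q', rfl⟩ := split_at p₂ hw3
  refine ⟨q', ⟨a', rfl⟩, ?_, ?_⟩
  · exact tail_eq T hw (Walk.cons h₁ a) (Walk.cons h₂ a') q q' hp₁ hseq
  · rintro rfl
    exact hstrip w (Walk.cons h₁ a) (Walk.cons h₂ a') q hwt rfl rfl

theorem main (T : Finset V) : ∀ (n : ℕ) (S : Finset V), S.card ≤ n →
    ∀ (s t : V) (P₁ P₂ : G.Walk s t), P₁.IsPath → P₂.IsPath →
    (∀ y ∈ P₁.support, y ∈ S) → (∀ y ∈ P₂.support, y ∈ S) →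
    trackerSeq T P₁ = trackerSeq T P₂ → P₁ ≠ P₂ → Concl G T S s t := by
  intro n
  induction n with
  | zero =>
    intro S hS s t P₁ P₂ _ _ hS₁
    have h0 := hS₁ s P₁.start_mem_support
    rw [Finset.card_eq_zero.1 (Nat.le_zero.1 hS)] at h0
    simp at h0
  | succ n ih =>
    intro S hS s t P₁ P₂ hp₁ hp₂ hS₁ hS₂ hseq hne
    by_cases hstrip : ∃ (w : V) (a a' : G.Walk s w) (b : G.Walk w t), w ≠ t ∧
      P₁ = a.append b ∧ P₂ = a'.append b
    · obtain ⟨w, a, a', b, hwt, rfl, rfl⟩ := hstrip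
      simp only [Walk.mem_support_append_iff] at hS₁ hS₂
      rw [append_isPath_iff] at hp₁ hp₂
      have hsub : S.filter (fun y => y ∈ b.support → y = w) ⊆ S := Finset.filter_subset _ _
      refine Concl.back (S' := S.filter (fun y => y ∈ b.support → y = w)) b hp₁.2.1
        (fun x hx => hS₁ x (Or.inr hx)) (fun x hx hx' => (Finset.mem_filter.1 hx').2 hx) hsub ?_
      refine ih _ ?_ s w a a' hp₁.1 hp₂.1
        (fun y hy => Finset.mem_filter.2 ⟨hS₁ y (Or.inl hy), hp₁.2.2 y hy⟩)
        (fun y hy => Finset.mem_filter.2 ⟨hS₂ y (Or.inl hy), hp₂.2.2 y hy⟩)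
        (trackerSeq_append_left T _ _ _ hseq) ?_
      · have : (S.filter (fun y => y ∈ b.support → y = w)).card < S.card := by
          apply Finset.card_lt_card
          refine ⟨hsub, fun h => ?_⟩
          have ht := h (hS₁ t (Or.inr b.end_mem_support))
          exact hwt ((Finset.mem_filter.1 ht).2 b.end_mem_support).symm
        omega
      · rintro rfl
        exact hne rfl
    have hcard : s ∈ S := hS₁ s P₁.start_mem_support
    have hcard' : (S.erase s).card ≤ n := by
      rw [Finset.card_erase_of_mem hcard]; omega
    cases P₁ with
    | nil =>
      exact (hne ((Walk.isPath_iff_eq_nil).1 hp₂).symm).elim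
    | @cons _ x₁ _ h₁ p₁ =>
      cases P₂ with
      | nil => exact (hne ((Walk.isPath_iff_eq_nil).1 hp₁)).elim
      | @cons _ x₂ _ h₂ p₂ =>
        have hp₁' := (Walk.cons_isPath_iff _ _).1 hp₁
        have hp₂' := (Walk.cons_isPath_iff _ _).1 hp₂
        have hS₁' : ∀ y ∈ p₁.support, y ∈ S.erase s := fun y hy => Finset.mem_erase.2
          ⟨fun h => hp₁'.2 (h ▸ hy), hS₁ y (by rw [Walk.support_cons]; exact List.mem_cons_of_mem _ hy)⟩
        have hS₂' : ∀ y ∈ p₂.support, y ∈ S.erase s := fun y hy => Finset.mem_erase.2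
          ⟨fun h => hp₂'.2 (h ▸ hy), hS₂ y (by rw [Walk.support_cons]; exact List.mem_cons_of_mem _ hy)⟩
        by_contra hcon
        have uniq : ∀ x, G.Adj s x → ∀ p q : G.Walk x t, p.IsPath → q.IsPath →
            (∀ y ∈ p.support, y ∈ S.erase s) → (∀ y ∈ q.support, y ∈ S.erase s) →
            trackerSeq T p = trackerSeq T q → p = q := by
          intro x hx p q hp hq hpS hqS hpq
          by_contra hpq'
          exact hcon (Concl.front hx (Finset.notMem_erase s S) (Finset.erase_subset s S) hcard
            (ih _ hcard' x t p q hp hq hpS hqS hpq hpq'))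
        by_cases hx : x₁ = x₂
        · subst hx
          apply hne
          rw [trackerSeq_cons, trackerSeq_cons] at hseq
          rw [uniq x₁ h₁ p₁ p₂ hp₁'.1 hp₂'.1 hS₁' hS₂' (List.append_cancel_left hseq)]
        · have ex := exchange h₁ h₂ p₁ p₂ hp₁ hseq
            (fun w a a' b hw e e' => hstrip ⟨w, a, a', b, hw, e, e'⟩)
          have ex' := exchange h₂ h₁ p₂ p₁ hp₂ hseq.symm
            (fun w a a' b hw e e' => hstrip ⟨w, a', a, b, hw, e', e⟩)
          have good : ∀ {x : V} (p : G.Walk x t), p.IsPath → (∀ y ∈ p.support, y ∈ S.erase s) →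
              ∀ w (q : G.Walk w t), (∃ a, p = Walk.append a q) →
              q.IsPath ∧ ∀ y ∈ q.support, y ∈ S.erase s := by
            rintro x p hp hpS w q ⟨a, rfl⟩
            exact ⟨((append_isPath_iff _ _).1 hp).2.1,
              fun y hy => hpS y ((Walk.mem_support_append_iff _ _).2 (Or.inr hy))⟩
          have suf : ∀ {x : V} (p : G.Walk x t) (w w' : V) (a : G.Walk w w') (b : G.Walk w' t),
              (∃ c, p = Walk.append c (a.append b)) → ∃ c, p = Walk.append c b := by
            rintro x p w w' a b ⟨c, rfl⟩
            exact ⟨c.append a, by rw [Walk.append_assoc]⟩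
          obtain ⟨U₁, u1, u2, u3⟩ := reroute (uniq x₁ h₁) _
            (fun w q => ∃ a, p₁ = Walk.append a q) (fun w q => ∃ a, p₂ = Walk.append a q)
            (good p₁ hp₁'.1 hS₁') (good p₂ hp₂'.1 hS₂') (suf p₁) (suf p₂) ex ex'
            x₁ Walk.nil p₁ ⟨Walk.nil, rfl⟩ hp₁'.1
            (by intro y hy; simp at hy; subst hy; exact hS₁' _ p₁.start_mem_support)
            (by intro y hy _; simpa using hy) le_rfl
          obtain ⟨U₂, v1, v2, v3⟩ := reroute (uniq x₂ h₂) _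
            (fun w q => ∃ a, p₂ = Walk.append a q) (fun w q => ∃ a, p₁ = Walk.append a q)
            (good p₂ hp₂'.1 hS₂') (good p₁ hp₁'.1 hS₁') (suf p₂) (suf p₁) ex' ex
            x₂ Walk.nil p₂ ⟨Walk.nil, rfl⟩ hp₂'.1
            (by intro y hy; simp at hy; subst hy; exact hS₂' _ p₂.start_mem_support)
            (by intro y hy _; simpa using hy) le_rfl
          exact hcon (final h₁ h₂ hx hcard U₁ U₂ u1 v1 u2 v2 u3 v3)

end TrackAux

/-- If `T` is not a tracking set for `G`, then there are two distinct
simple `s`-`t` paths with equal tracker sequences, and a cycle `C` with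
`V(C) ⊆ V(P₁) ∪ V(P₂)` having a local `s`-`t` pair `(a, b)` with
`T ∩ (V(C) \ {a,b}) = ∅`. -/
theorem exists_untracked_cycle_of_not_trackingSet
    {V : Type*} [Fintype V] [DecidableEq V]
    (G : SimpleGraph V) (s t : V)
    (T : Finset V) (hT : ¬ IsTrackingSet G s t T) :
    ∃ P₁ P₂ : G.Walk s t, P₁.IsPath ∧ P₂.IsPath ∧ P₁ ≠ P₂ ∧
      trackerSeq T P₁ = trackerSeq T P₂ ∧
      ∃ (v : V) (C : G.Walk v v), C.IsCycle ∧
        {x | x ∈ C.support} ⊆ {x | x ∈ P₁.support} ∪ {x | x ∈ P₂.support} ∧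
        ∃ a b : V, LocalSTPair G s t {x | x ∈ C.support} a b ∧
          ↑T ∩ ({x | x ∈ C.support} \ {a, b}) = (∅ : Set V) := by
  unfold IsTrackingSet at hT
  push Not at hT
  obtain ⟨P₁, P₂, hp₁, hp₂, hseq, hne⟩ := hT
  refine ⟨P₁, P₂, hp₁, hp₂, hne, hseq, ?_⟩
  obtain ⟨v, C, a, b, A, B, h1, h2, h3, h4, h5, h6, h7, h8, h9, h10, h11, h12⟩ :=
    TrackAux.main T _ (P₁.support.toFinset ∪ P₂.support.toFinset) le_rfl s t P₁ P₂ hp₁ hp₂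
      (by intro y hy; simp [hy]) (by intro y hy; simp [hy]) hseq hne
  refine ⟨v, C, h1, ?_, a, b, ⟨h3, h4, A, B, h5, h6, ?_, ?_, ?_⟩, ?_⟩
  · intro x hx
    simpa using h2 x hx
  · ext x
    simpa using h9 x
  · ext x
    simp only [Set.mem_inter_iff, Set.mem_setOf_eq, Set.mem_singleton_iff]
    exact ⟨fun h => h10 x h.1 h.2, by rintro rfl; exact ⟨A.end_mem_support, h3⟩⟩
  · ext x
    simp only [Set.mem_inter_iff, Set.mem_setOf_eq, Set.mem_singleton_iff]
    exact ⟨fun h => h11 x h.1 h.2, by rintro rfl; exact ⟨B.start_mem_support, h4⟩⟩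
  · ext x
    simp only [Set.mem_inter_iff, Set.mem_sdiff, Set.mem_setOf_eq, Set.mem_insert_iff,
      Set.mem_singleton_iff, Set.mem_empty_iff_false, iff_false, Finset.mem_coe]
    rintro ⟨hxT, hxC, hx⟩
    exact hx (h12 x hxC hxT)
end

section
/- Let G be a finite simple graph with distinguished vertices s and t, let S ⊆ V(G) be a feedback vertex set of G, and let T ⊆ V(G) with S ⊆ T. Suppose that for every cycle C of G and every local s-t pair (a, b) for C with V(C) ∩ S ⊆ {a, b}, the set T ∩ (V(C) \ {a,b}) is nonempty. Then T is a tracking set for G. -/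
namespace TrackAux
open SimpleGraph

variable {V : Type*} {G : SimpleGraph V}

lemma app_disj {x y z : V} {p : G.Walk x y} {q : G.Walk y z} (h : (p.append q).IsPath) :
    ∀ w, w ∈ p.support → w ∈ q.support → w = y := by
  intro w hp hq
  rw [Walk.isPath_def, Walk.support_append] at h
  rw [Walk.mem_support_iff] at hq
  rcases hq with hq | hq
  · exact hq
  · exact absurd hq (List.disjoint_of_nodup_append h hp)

lemma app_path {x y z : V} {p : G.Walk x y} {q : G.Walk y z} (hp : p.IsPath) (hq : q.IsPath)
    (h : ∀ w, w ∈ p.support → w ∈ q.support → w = y) : (p.append q).IsPath := by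
  rw [Walk.isPath_def, Walk.support_append]
  have hq' := hq.support_nodup
  rw [← Walk.cons_tail_support] at hq'
  rw [List.nodup_cons] at hq'
  refine List.Nodup.append hp.support_nodup hq'.2 ?_
  intro w hw1 hw2
  have := h w hw1 (List.mem_of_mem_tail hw2)
  subst this
  exact hq'.1 hw2

lemma last_hit (X : Set V) {x y : V} (p : G.Walk x y) (h : ∃ w ∈ p.support, w ∈ X) :
    ∃ u ∈ X, ∃ (q : G.Walk x u) (r : G.Walk u y), p = q.append r ∧
      ∀ w ∈ r.support, w ∈ X → w = u := by
  classical
  induction p with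
  | nil =>
    obtain ⟨w, hw, hX⟩ := h
    simp at hw
    subst hw
    exact ⟨w, hX, Walk.nil, Walk.nil, rfl, by simp⟩
  | @cons x v y hadj p ih =>
    by_cases hp : ∃ w ∈ p.support, w ∈ X
    · obtain ⟨u, hu, q, r, rfl, h3⟩ := ih hp
      exact ⟨u, hu, Walk.cons hadj q, r, by simp, h3⟩
    · push Not at hp
      obtain ⟨w, hw, hX⟩ := h
      simp only [Walk.support_cons, List.mem_cons] at hw
      rcases hw with rfl | hw
      · refine ⟨w, hX, Walk.nil, Walk.cons hadj p, rfl, ?_⟩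
        intro w' hw' hX'
        simp only [Walk.support_cons, List.mem_cons] at hw'
        rcases hw' with rfl | hw'
        · rfl
        · exact absurd hX' (hp _ hw')
      · exact absurd hX (hp _ hw)

lemma first_hit (X : Set V) {x y : V} (p : G.Walk x y) (h : ∃ w ∈ p.support, w ∈ X) :
    ∃ u ∈ X, ∃ (q : G.Walk x u) (r : G.Walk u y), p = q.append r ∧
      ∀ w ∈ q.support, w ∈ X → w = u := by
  obtain ⟨u, hu, q, r, h1, h2⟩ := last_hit X p.reverse (by simpa using h)
  refine ⟨u, hu, r.reverse, q.reverse, ?_, by simpa using h2⟩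
  rw [← Walk.reverse_append, ← h1, Walk.reverse_reverse]

lemma cycle_of_two {a b : V} (B1 B2 : G.Walk a b) (h1 : B1.IsPath) (h2 : B2.IsPath)
    (hab : a ≠ b) (hne : B1 ≠ B2)
    (hd : ∀ w ∈ B1.support, w ∈ B2.support → w = a ∨ w = b) :
    (B1.append B2.reverse).IsCycle := by
  cases B1 with
  | nil => exact absurd rfl hab
  | @cons _ v _ h p =>
    rw [Walk.cons_isPath_iff] at h1
    rw [Walk.cons_append, Walk.cons_isCycle_iff]
    constructor
    · apply app_path h1.1 h2.reverse
      intro w hw1 hw2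
      simp only [Walk.support_reverse, List.mem_reverse] at hw2
      rcases hd w (by simp [hw1]) hw2 with rfl | rfl
      · exact absurd hw1 h1.2
      · rfl
    · rw [Walk.edges_append, List.mem_append, Walk.edges_reverse, List.mem_reverse]
      rintro (he | he)
      · exact h1.2 (Walk.fst_mem_support_of_mem_edges _ he)
      · have hv := Walk.snd_mem_support_of_mem_edges _ he
        rcases hd v (by simp) hv with rfl | rfl
        · exact h.ne rfl
        · have : p = Walk.nil := (Walk.isPath_iff_nil.1 h1.1).eq_nil
          subst this
          apply hne
          cases B2 with
          | nil => exact absurd rfl hab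
          | @cons _ w _ h' p' =>
            rw [Walk.cons_isPath_iff] at h2
            rw [Walk.edges_cons, List.mem_cons] at he
            rcases he with he | he
            · have hw : v = w := by
                rcases Sym2.eq_iff.1 he with ⟨_, h⟩ | ⟨h, h'⟩
                · exact h
                · exact absurd h'.symm hab
              subst hw
              have : p' = Walk.nil := (Walk.isPath_iff_nil.1 h2.1).eq_nil
              subst this
              rfl
            · exact absurd (Walk.fst_mem_support_of_mem_edges _ he) h2.2

/-- An untracked entry-exit configuration inside the vertex set `U`. -/
def Bad (G : SimpleGraph V) (U T : Set V) (s t : V) : Prop :=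
  ∃ (v : V) (c : G.Walk v v) (a b : V) (P : G.Walk s a) (Q : G.Walk b t),
    c.IsCycle ∧ P.IsPath ∧ Q.IsPath ∧ a ∈ c.support ∧ b ∈ c.support ∧
    (∀ w ∈ P.support, w ∉ Q.support) ∧
    (∀ w ∈ P.support, w ∈ c.support → w = a) ∧
    (∀ w ∈ Q.support, w ∈ c.support → w = b) ∧
    (∀ w ∈ c.support, w ∈ T → w = a ∨ w = b) ∧
    (∀ w ∈ P.support, w ∈ U) ∧ (∀ w ∈ Q.support, w ∈ U) ∧ (∀ w ∈ c.support, w ∈ U)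

/-- A lasso from `s` through `a` to `b`. -/
structure Lasso (G : SimpleGraph V) (U : Set V) (s a b : V) where
  A : G.Walk s a
  B1 : G.Walk a b
  B2 : G.Walk a b
  hA : A.IsPath
  h1 : B1.IsPath
  h2 : B2.IsPath
  hab : a ≠ b
  hne : B1 ≠ B2
  hd : ∀ w ∈ B1.support, w ∈ B2.support → w = a ∨ w = b
  hA1 : ∀ w ∈ A.support, w ∈ B1.support → w = a
  hA2 : ∀ w ∈ A.support, w ∈ B2.support → w = a
  hU : ∀ w, w ∈ A.support ∨ w ∈ B1.support ∨ w ∈ B2.support → w ∈ U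

lemma exit_bad {U T : Set V} {s t a b : V} (L : Lasso G U s a b) {w : V} (W : G.Walk w t)
    (hw : w ∈ L.B1.support ∨ w ∈ L.B2.support)
    (hWA : ∀ x ∈ W.support, x ∉ L.A.support) (hWU : ∀ x ∈ W.support, x ∈ U)
    (hT : ∀ z ∈ W.support, (z ∈ L.B1.support ∨ z ∈ L.B2.support) →
      ∀ x, (x ∈ L.B1.support ∨ x ∈ L.B2.support) → x ∈ T → x = a ∨ x = z) :
    Bad G U T s t := by
  classical
  obtain ⟨z, hz, q, r, rfl, hr⟩ := last_hit {x | x ∈ L.B1.support ∨ x ∈ L.B2.support} W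
    ⟨w, W.start_mem_support, hw⟩
  have hsub : ∀ x, x ∈ r.bypass.support → x ∈ (q.append r).support := by
    intro x hx
    rw [Walk.mem_support_append_iff]
    exact Or.inr (r.support_bypass_subset_support hx)
  have hc : ∀ x, x ∈ (L.B1.append L.B2.reverse).support ↔
      x ∈ L.B1.support ∨ x ∈ L.B2.support := by
    intro x; simp [Walk.mem_support_append_iff]
  refine ⟨a, L.B1.append L.B2.reverse, a, z, L.A, r.bypass,
    cycle_of_two _ _ L.h1 L.h2 L.hab L.hne L.hd, L.hA, r.bypass_isPath, by simp, (hc z).2 hz,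
    ?_, ?_, ?_, ?_, ?_, ?_, ?_⟩
  · intro x hx hx'
    exact hWA x (hsub x hx') hx
  · intro x hx hx'
    rcases (hc x).1 hx' with h | h
    · exact L.hA1 x hx h
    · exact L.hA2 x hx h
  · intro x hx hx'
    exact hr x (r.support_bypass_subset_support hx) ((hc x).1 hx')
  · intro x hx hx'
    exact hT z (hsub z r.bypass.start_mem_support) hz x ((hc x).1 hx) hx'
  · exact fun x hx => L.hU x (Or.inl hx)
  · exact fun x hx => hWU x (hsub x hx)
  · exact fun x hx => L.hU x (Or.inr ((hc x).1 hx))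

lemma fork {s u1 u2 : V} (E1 : G.Walk s u1) (E2 : G.Walk s u2)
    (h1 : E1.IsPath) (h2 : E2.IsPath) :
    ∃ (a : V) (A : G.Walk s a) (F1 : G.Walk a u1) (F2 : G.Walk a u2),
      A.IsPath ∧ F1.IsPath ∧ F2.IsPath ∧
      (∀ w ∈ A.support, w ∈ F1.support → w = a) ∧
      (∀ w ∈ A.support, w ∈ F2.support → w = a) ∧
      (∀ w ∈ F1.support, w ∈ F2.support → w = a) ∧
      (∀ w ∈ A.support, w ∈ E2.support) ∧ (∀ w ∈ F1.support, w ∈ E1.support) ∧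
      (∀ w ∈ F2.support, w ∈ E2.support) := by
  classical
  obtain ⟨a, ha, q, F1, rfl, hF⟩ := last_hit {x | x ∈ E2.support} E1
    ⟨s, E1.start_mem_support, E2.start_mem_support⟩
  obtain ⟨A, F2, rfl⟩ := Walk.mem_support_iff_exists_append.1 ha
  simp only [Set.mem_ofPred_eq, Walk.mem_support_append_iff] at *
  exact ⟨a, A, F1, F2, h2.of_append_left, h1.of_append_right, h2.of_append_right,
    fun w hw hw' => hF w hw' (Or.inl hw), fun w hw hw' => app_disj h2 w hw hw',
    fun w hw hw' => hF w hw (Or.inr hw'), fun w hw => Or.inl hw, fun w hw => Or.inr hw,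
    fun w hw => Or.inr hw⟩

lemma seq_append [DecidableEq V] {T : Finset V} {x u t : V} (q : G.Walk x u) (r : G.Walk u t)
    (hp : (q.append r).IsPath) (hq : ∀ w ∈ q.support, w ∈ T → w = u) :
    trackerSeq T (q.append r) = trackerSeq T r := by
  induction q with
  | nil => rfl
  | @cons x v u h q ih =>
    rw [Walk.cons_append, Walk.cons_isPath_iff] at hp
    rw [Walk.cons_append]
    have hx : x ∉ T := by
      intro hx
      have := hq x (by simp) hx
      subst this
      exact hp.2 (by simp [Walk.mem_support_append_iff])
    have := ih r hp.1 (fun w hw => hq w (by simp [hw]))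
    unfold trackerSeq at *
    rw [Walk.support_cons, List.filter_cons_of_neg (by simpa using hx), this]

lemma first_seg [DecidableEq V] {T : Finset V} {y t : V} (P : G.Walk y t) (hP : P.IsPath)
    (hyt : y ≠ t) (ht : t ∈ T) :
    ∃ x ∈ T, ∃ (σ : G.Walk y x) (r : G.Walk x t), P = σ.append r ∧ y ≠ x ∧
      (∀ w ∈ σ.support, w ∈ T → w = y ∨ w = x) ∧
      trackerSeq T P = [y].filter (· ∈ T) ++ trackerSeq T r := by
  cases P with
  | nil => exact absurd rfl hyt
  | @cons _ v _ h p =>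
    obtain ⟨x, hx, q, r, rfl, hq⟩ := first_hit (T : Set V) p ⟨t, p.end_mem_support, ht⟩
    rw [Walk.cons_isPath_iff] at hP
    refine ⟨x, hx, Walk.cons h q, r, rfl, ?_, ?_, ?_⟩
    · rintro rfl
      exact hP.2 (by simp [Walk.mem_support_append_iff])
    · intro w hw hT
      simp only [Walk.support_cons, List.mem_cons] at hw
      rcases hw with rfl | hw
      · exact Or.inl rfl
      · exact Or.inr (hq w hw hT)
    · have := seq_append q r hP.1 hq
      unfold trackerSeq at *
      rw [Walk.support_cons, List.filter_cons, List.filter_cons, this]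
      split_ifs <;> simp

lemma seq_head [DecidableEq V] {T : Finset V} {y t : V} (P : G.Walk y t) (hy : y ∈ T) :
    (trackerSeq T P).head? = some y := by
  unfold trackerSeq
  rw [← Walk.cons_tail_support, List.filter_cons_of_pos (by simpa using hy)]
  rfl

lemma seq_start [DecidableEq V] {T : Finset V} {x x' t : V} (P : G.Walk x t) (P' : G.Walk x' t)
    (hx : x ∈ T) (hx' : x' ∈ T) (h : trackerSeq T P = trackerSeq T P') : x = x' := by
  have h1 := seq_head P hx
  rw [h, seq_head P' hx'] at h1
  exact (Option.some.inj h1).symm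

lemma two_seg [DecidableEq V] {T : Finset V} {y t : V} (P1 P2 : G.Walk y t) (h1 : P1.IsPath)
    (h2 : P2.IsPath) (hyt : y ≠ t) (ht : t ∈ T) (h : trackerSeq T P1 = trackerSeq T P2) :
    ∃ x ∈ T, ∃ (σ1 σ2 : G.Walk y x) (r1 r2 : G.Walk x t), P1 = σ1.append r1 ∧
      P2 = σ2.append r2 ∧ y ≠ x ∧
      (∀ w ∈ σ1.support, w ∈ T → w = y ∨ w = x) ∧
      (∀ w ∈ σ2.support, w ∈ T → w = y ∨ w = x) ∧
      trackerSeq T r1 = trackerSeq T r2 := by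
  obtain ⟨x, hx, σ1, r1, e1, n1, t1, s1⟩ := first_seg P1 h1 hyt ht
  obtain ⟨x', hx', σ2, r2, e2, n2, t2, s2⟩ := first_seg P2 h2 hyt ht
  rw [s1, s2] at h
  have h' := List.append_cancel_left h
  have := seq_start _ _ hx hx' h'
  subst this
  exact ⟨x, hx, σ1, σ2, r1, r2, e1, e2, n1, t1, t2, h'⟩

lemma split [DecidableEq V] {T : Finset V} {t : V} (ht : t ∈ T) (D : V → Prop) (hDt : D t)
    (n : ℕ) : ∀ {y : V} (P1 P2 : G.Walk y t), P1.length ≤ n → P1.IsPath → P2.IsPath → ¬ D y →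
      y ∈ T → trackerSeq T P1 = trackerSeq T P2 →
    ∃ x, ∃ x' ∈ T, ∃ (q1 q2 : G.Walk y x) (σ1 σ2 : G.Walk x x') (r1 r2 : G.Walk x' t),
      P1 = q1.append (σ1.append r1) ∧ P2 = q2.append (σ2.append r2) ∧ x ≠ x' ∧ ¬ D x ∧ D x' ∧
      (∀ w ∈ σ1.support, w ∈ T → w = x ∨ w = x') ∧
      (∀ w ∈ σ2.support, w ∈ T → w = x ∨ w = x') ∧
      trackerSeq T r1 = trackerSeq T r2 := by
  induction n with
  | zero =>
    intro y P1 P2 hl _ _ hD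
    have := Walk.eq_of_length_eq_zero (Nat.le_zero.1 hl)
    subst this
    exact absurd hDt hD
  | succ n ih =>
    intro y P1 P2 hl h1 h2 hD hy hs
    have hyt : y ≠ t := by rintro rfl; exact hD hDt
    obtain ⟨x, hx, σ1, σ2, r1, r2, rfl, rfl, n1, t1, t2, h'⟩ := two_seg P1 P2 h1 h2 hyt ht hs
    by_cases hDx : D x
    · exact ⟨y, x, hx, Walk.nil, Walk.nil, σ1, σ2, r1, r2, rfl, rfl, n1, hD, hDx, t1, t2, h'⟩
    · have hlen : 0 < σ1.length := by
        rcases Nat.eq_zero_or_pos σ1.length with h0 | h0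
        · exact absurd (Walk.eq_of_length_eq_zero h0) n1
        · exact h0
      obtain ⟨z, z', hz, q1, q2, τ1, τ2, g1, g2, rfl, rfl, rest⟩ := ih r1 r2
        (by rw [Walk.length_append] at hl; omega) h1.of_append_right h2.of_append_right hDx hx h'
      exact ⟨z, z', hz, σ1.append q1, σ2.append q2, τ1, τ2, g1, g2, by simp [Walk.append_assoc],
        by simp [Walk.append_assoc], rest⟩

lemma snd_app {x y z : V} (q : G.Walk x y) (r : G.Walk y z) (h : x ≠ y) :
    (q.append r).snd = q.snd := by
  cases q with
  | nil => exact absurd rfl h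
  | cons h q => simp

lemma join {U X T : Set V} {s t a u1 u2 x' : V} (A : G.Walk s a) (F1 : G.Walk a u1)
    (F2 : G.Walk a u2) (hA : A.IsPath) (hF1 : F1.IsPath) (hF2 : F2.IsPath)
    (hAF1 : ∀ w ∈ A.support, w ∈ F1.support → w = a)
    (hAF2 : ∀ w ∈ A.support, w ∈ F2.support → w = a)
    (hFF : ∀ w ∈ F1.support, w ∈ F2.support → w = a)
    (hAX : ∀ w ∈ A.support, w ∈ X) (hF1X : ∀ w ∈ F1.support, w ∈ X)
    (hF2X : ∀ w ∈ F2.support, w ∈ X) (hXU : ∀ w ∈ X, w ∈ U)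
    (τ1 : G.Walk u1 x') (τ2 : G.Walk u2 x') (hτ1 : τ1.IsPath) (hτ2 : τ2.IsPath)
    (hτ1X : ∀ w ∈ τ1.support, w ∈ X → w = u1) (hτ2X : ∀ w ∈ τ2.support, w ∈ X → w = u2)
    (hτ1U : ∀ w ∈ τ1.support, w ∈ U) (hτ2U : ∀ w ∈ τ2.support, w ∈ U)
    (hx' : x' ∉ X) (W : G.Walk x' t) (hWX : ∀ w ∈ W.support, w ∉ X)
    (hWU : ∀ w ∈ W.support, w ∈ U) (hTX : ∀ w ∈ X, w ∈ T → w = s)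
    (hT1 : ∀ w ∈ τ1.support, w ∈ T → w = x' ∨ w ∈ X)
    (hT2 : ∀ w ∈ τ2.support, w ∈ T → w = x' ∨ w ∈ X)
    (hne : u1 ≠ u2 ∨ τ1.snd ≠ τ2.snd) :
    Bad G U T s t ∨ ∃ L : Lasso G U s a x', ∀ w,
      (w ∈ L.A.support ∨ w ∈ L.B1.support ∨ w ∈ L.B2.support) →
        w ∈ X ∨ w ∈ τ1.support ∨ w ∈ τ2.support := by
  obtain ⟨b, ⟨hb2, hbX⟩, q1, r1, rfl, hq⟩ := first_hit {x | x ∈ τ2.support ∧ x ∉ X} τ1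
    ⟨x', τ1.end_mem_support, τ2.end_mem_support, hx'⟩
  obtain ⟨q2, r2, rfl⟩ := Walk.mem_support_iff_exists_append.1 hb2
  simp only [Set.mem_ofPred_eq, Walk.mem_support_append_iff] at *
  have hu1X : u1 ∈ X := hF1X _ F1.end_mem_support
  have hu2X : u2 ∈ X := hF2X _ F2.end_mem_support
  have haX : a ∈ X := hAX _ A.end_mem_support
  have hq1X : ∀ w ∈ q1.support, w ∈ X → w = u1 := fun w hw => hτ1X w (Or.inl hw)
  have hq2X : ∀ w ∈ q2.support, w ∈ X → w = u2 := fun w hw => hτ2X w (Or.inl hw)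
  have hu1b : u1 ≠ b := by rintro rfl; exact hbX hu1X
  have hu2b : u2 ≠ b := by rintro rfl; exact hbX hu2X
  have hBne : F1.append q1 ≠ F2.append q2 := by
    intro he
    by_cases huu : u1 = u2
    · subst huu
      have hu : u1 = a := hFF _ F1.end_mem_support F2.end_mem_support
      subst hu
      rw [Walk.isPath_iff_nil] at hF1 hF2
      rw [hF1.eq_nil, hF2.eq_nil] at he
      simp only [Walk.nil_append] at he
      subst he
      rw [snd_app _ _ hu1b, snd_app _ _ hu1b] at hne
      simp at hne
    · have k1 : u1 ∈ (F2.append q2).support := by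
        rw [← he, Walk.mem_support_append_iff]; exact Or.inl F1.end_mem_support
      have k2 : u2 ∈ (F1.append q1).support := by
        rw [he, Walk.mem_support_append_iff]; exact Or.inl F2.end_mem_support
      rw [Walk.mem_support_append_iff] at k1 k2
      have e1 : u1 = a := by
        rcases k1 with k | k
        · exact hFF _ F1.end_mem_support k
        · exact absurd (hq2X _ k hu1X) huu
      have e2 : u2 = a := by
        rcases k2 with k | k
        · exact hFF _ k F2.end_mem_support
        · exact absurd (hq1X _ k hu2X).symm huu
      exact huu (e1.trans e2.symm)
  let L : Lasso G U s a b :=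
    { A := A
      B1 := F1.append q1
      B2 := F2.append q2
      hA := hA
      h1 := app_path hF1 hτ1.of_append_left (fun w h h' => hq1X w h' (hF1X w h))
      h2 := app_path hF2 hτ2.of_append_left (fun w h h' => hq2X w h' (hF2X w h))
      hab := by rintro rfl; exact hbX haX
      hne := hBne
      hd := by
        intro w h h'
        rw [Walk.mem_support_append_iff] at h h'
        rcases h with h | h <;> rcases h' with h' | h'
        · exact Or.inl (hFF w h h')
        · have := hq2X w h' (hF1X w h)
          subst this
          exact Or.inl (hFF w h F2.end_mem_support)
        · have := hq1X w h (hF2X w h')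
          subst this
          exact Or.inl (hFF w F1.end_mem_support h')
        · by_cases hw : w ∈ X
          · have e1 := hq1X w h hw
            have e2 := hq2X w h' hw
            subst e1
            subst e2
            exact Or.inl (hFF w F1.end_mem_support F2.end_mem_support)
          · exact Or.inr (hq w h ⟨Or.inl h', hw⟩)
      hA1 := by
        intro w h h'
        rw [Walk.mem_support_append_iff] at h'
        rcases h' with h' | h'
        · exact hAF1 w h h'
        · have := hq1X w h' (hAX w h)
          subst this
          exact hAF1 w h F1.end_mem_support
      hA2 := by
        intro w h h'
        rw [Walk.mem_support_append_iff] at h'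
        rcases h' with h' | h'
        · exact hAF2 w h h'
        · have := hq2X w h' (hAX w h)
          subst this
          exact hAF2 w h F2.end_mem_support
      hU := by
        intro w h
        simp only [Walk.mem_support_append_iff] at h
        rcases h with h | (h | h) | (h | h)
        · exact hXU _ (hAX _ h)
        · exact hXU _ (hF1X _ h)
        · exact hτ1U _ (Or.inl h)
        · exact hXU _ (hF2X _ h)
        · exact hτ2U _ (Or.inl h) }
  have hL : ∀ w, (w ∈ L.B1.support ∨ w ∈ L.B2.support) →
      w ∈ F1.support ∨ w ∈ F2.support ∨ w ∈ q1.support ∨ w ∈ q2.support := by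
    intro w h
    rcases h with h | h
    · rcases (Walk.mem_support_append_iff F1 q1).1 h with h | h
      · exact Or.inl h
      · exact Or.inr (Or.inr (Or.inl h))
    · rcases (Walk.mem_support_append_iff F2 q2).1 h with h | h
      · exact Or.inr (Or.inl h)
      · exact Or.inr (Or.inr (Or.inr h))
  by_cases hbx : b = x'
  · subst hbx
    right
    refine ⟨L, ?_⟩
    intro w h
    rcases h with h | h
    · exact Or.inl (hAX w h)
    · rcases hL w h with h | h | h | h
      · exact Or.inl (hF1X w h)
      · exact Or.inl (hF2X w h)
      · exact Or.inr (Or.inl (Or.inl h))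
      · exact Or.inr (Or.inr (Or.inl h))
  · left
    refine exit_bad L (r1.append W) (Or.inl L.B1.end_mem_support) ?_ ?_ ?_
    · intro x hx hxA
      rw [Walk.mem_support_append_iff] at hx
      have hxX := hAX x hxA
      rcases hx with hx | hx
      · have := hτ1X x (Or.inr hx) hxX
        subst this
        exact hu1b (app_disj hτ1 _ q1.start_mem_support hx)
      · exact hWX x hx hxX
    · intro x hx
      rw [Walk.mem_support_append_iff] at hx
      rcases hx with hx | hx
      · exact hτ1U x (Or.inr hx)
      · exact hWU x hx
    · intro z _ _ x hx hxT
      left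
      have key : x ∈ X → x = a := by
        intro hxX
        have := hTX x hxX hxT
        subst this
        rcases hx with hx | hx
        · exact L.hA1 x A.start_mem_support hx
        · exact L.hA2 x A.start_mem_support hx
      rcases hL x hx with h | h | h | h
      · exact key (hF1X x h)
      · exact key (hF2X x h)
      · rcases hT1 x (Or.inl h) hxT with rfl | h'
        · exact absurd (app_disj hτ1 _ h r1.end_mem_support).symm hbx
        · exact key h'
      · rcases hT2 x (Or.inl h) hxT with rfl | h'
        · exact absurd (app_disj hτ2 _ h r2.end_mem_support).symm hbx
        · exact key h'

def Lasso.X {U : Set V} {s a b : V} (L : Lasso G U s a b) : Set V :=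
  {w | w ∈ L.A.support ∨ w ∈ L.B1.support ∨ w ∈ L.B2.support}

lemma Lasso.reach {U : Set V} {s a y : V} (L : Lasso G U s a y) {u : V} (hu : u ∈ L.X)
    (huy : u ≠ y) : ∃ E : G.Walk s u, E.IsPath ∧ ∀ w ∈ E.support, w ∈ L.X ∧ w ≠ y := by
  have hyA : ∀ w ∈ L.A.support, w ≠ y := by
    rintro w hw rfl
    exact L.hab (L.hA1 w hw L.B1.end_mem_support).symm
  rcases hu with hu | hu | hu
  · obtain ⟨p, q, h⟩ := Walk.mem_support_iff_exists_append.1 hu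
    have hp := L.hA
    rw [h] at hp
    refine ⟨p, hp.of_append_left, fun w hw => ?_⟩
    have : w ∈ L.A.support := by rw [h, Walk.mem_support_append_iff]; exact Or.inl hw
    exact ⟨Or.inl this, hyA w this⟩
  · obtain ⟨p, q, h⟩ := Walk.mem_support_iff_exists_append.1 hu
    have hp := L.h1
    rw [h] at hp
    have hs : ∀ w ∈ p.support, w ∈ L.B1.support := fun w hw => by
      rw [h, Walk.mem_support_append_iff]; exact Or.inl hw
    refine ⟨L.A.append p, app_path L.hA hp.of_append_left (fun w h h' => L.hA1 w h (hs w h')),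
      fun w hw => ?_⟩
    rw [Walk.mem_support_append_iff] at hw
    rcases hw with hw | hw
    · exact ⟨Or.inl hw, hyA w hw⟩
    · refine ⟨Or.inr (Or.inl (hs w hw)), ?_⟩
      rintro rfl
      exact huy (app_disj hp w hw q.end_mem_support).symm
  · obtain ⟨p, q, h⟩ := Walk.mem_support_iff_exists_append.1 hu
    have hp := L.h2
    rw [h] at hp
    have hs : ∀ w ∈ p.support, w ∈ L.B2.support := fun w hw => by
      rw [h, Walk.mem_support_append_iff]; exact Or.inl hw
    refine ⟨L.A.append p, app_path L.hA hp.of_append_left (fun w h h' => L.hA2 w h (hs w h')),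
      fun w hw => ?_⟩
    rw [Walk.mem_support_append_iff] at hw
    rcases hw with hw | hw
    · exact ⟨Or.inl hw, hyA w hw⟩
    · refine ⟨Or.inr (Or.inr (hs w hw)), ?_⟩
      rintro rfl
      exact huy (app_disj hp w hw q.end_mem_support).symm

lemma Lasso.y_exit {U T : Set V} {s t a y : V} (L : Lasso G U s a y) (W : G.Walk y t)
    (hW : ∀ x ∈ W.support, x ∈ L.X → x = y) (hWU : ∀ x ∈ W.support, x ∈ U)
    (hT : ∀ x ∈ L.X, x ∈ T → x = s ∨ x = y) : Bad G U T s t := by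
  refine exit_bad L W (Or.inl L.B1.end_mem_support) ?_ hWU ?_
  · intro x hx hxA
    have := hW x hx (Or.inl hxA)
    subst this
    exact L.hab (L.hA1 _ hxA L.B1.end_mem_support).symm
  · intro z hz hzC x hx hxT
    have := hW z hz (Or.inr hzC)
    subst this
    rcases hT x (Or.inr hx) hxT with rfl | rfl
    · left
      rcases hx with hx | hx
      · exact L.hA1 x L.A.start_mem_support hx
      · exact L.hA2 x L.A.start_mem_support hx
    · exact Or.inr rfl

lemma state_bad [DecidableEq V] {T : Finset V} {U : Set V} {s t : V} (ht : t ∈ T) (n : ℕ) :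
    ∀ {y a : V} (L : Lasso G U s a y) (P1 P2 : G.Walk y t), P1.length ≤ n → P1.IsPath →
      P2.IsPath → (∀ w ∈ P1.support, w ∈ U) → (∀ w ∈ P2.support, w ∈ U) → y ∈ T →
      trackerSeq T P1 = trackerSeq T P2 →
      (∀ w ∈ L.X, w ∈ P1.support → w ∈ P2.support → w = y) →
      (∀ w ∈ L.X, w ∈ (T : Set V) → w = s ∨ w = y) → Bad G U T s t := by
  induction n with
  | zero =>
    intro y a L P1 P2 hl _ _ hU _ _ _ _ hT
    have := Walk.eq_of_length_eq_zero (Nat.le_zero.1 hl)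
    subst this
    exact L.y_exit Walk.nil (by simp) (by simpa using hU y P1.start_mem_support) hT
  | succ n ih =>
    intro y a L P1 P2 hl h1 h2 hU1 hU2 hy hs hX hT
    by_cases hyt : y = t
    · subst hyt
      exact L.y_exit Walk.nil (by simp) (by simpa using hU1 y P1.start_mem_support) hT
    have hyX : y ∈ L.X := Or.inr (Or.inl L.B1.end_mem_support)
    have htX : t ∉ L.X := fun h => hyt (hX t h P1.end_mem_support P2.end_mem_support).symm
    obtain ⟨x, x', hx'T, q1, q2, σ1, σ2, r1, r2, rfl, rfl, hxx, hDx, ⟨W, hW⟩, t1, t2, hr⟩ :=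
      split ht (fun w => ∃ W : G.Walk w t, ∀ z ∈ W.support, z ∉ L.X ∧ z ∈ U)
        ⟨Walk.nil, by simpa using ⟨htX, hU1 t P1.end_mem_support⟩⟩ (n + 1) P1 P2 hl h1 h2
        (by rintro ⟨W, hW⟩; exact (hW y W.start_mem_support).1 hyX) hy hs
    have hσ1 : ∀ w ∈ σ1.support, w ∈ (q1.append (σ1.append r1)).support := fun w hw => by
      simp [Walk.mem_support_append_iff, hw]
    have hσ2 : ∀ w ∈ σ2.support, w ∈ (q2.append (σ2.append r2)).support := fun w hw => by
      simp [Walk.mem_support_append_iff, hw]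
    have hr1 : ∀ w ∈ r1.support, w ∈ (q1.append (σ1.append r1)).support := fun w hw => by
      simp [Walk.mem_support_append_iff, hw]
    have hr2 : ∀ w ∈ r2.support, w ∈ (q2.append (σ2.append r2)).support := fun w hw => by
      simp [Walk.mem_support_append_iff, hw]
    have hx'X : x' ∉ L.X := (hW x' W.start_mem_support).1
    have hit : ∀ σ : G.Walk x x', (∀ w ∈ σ.support, w ∈ U) → ∃ w ∈ σ.support, w ∈ L.X := by
      intro σ hσU
      by_contra hcon
      push Not at hcon
      apply hDx
      refine ⟨σ.append W, ?_⟩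
      intro z hz
      rw [Walk.mem_support_append_iff] at hz
      rcases hz with hz | hz
      · exact ⟨hcon z hz, hσU z hz⟩
      · exact hW z hz
    obtain ⟨u1, hu1, p1, τ1, e1, hτ1⟩ := last_hit L.X σ1 (hit σ1 fun w hw => hU1 w (hσ1 w hw))
    obtain ⟨u2, hu2, p2, τ2, e2, hτ2⟩ := last_hit L.X σ2 (hit σ2 fun w hw => hU2 w (hσ2 w hw))
    have hs1 : ∀ w ∈ τ1.support, w ∈ σ1.support := fun w hw => by
      rw [e1, Walk.mem_support_append_iff]; exact Or.inr hw
    have hs2 : ∀ w ∈ τ2.support, w ∈ σ2.support := fun w hw => by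
      rw [e2, Walk.mem_support_append_iff]; exact Or.inr hw
    have yex : ∀ τ : G.Walk y x', (∀ w ∈ τ.support, w ∈ L.X → w = y) →
        (∀ w ∈ τ.support, w ∈ U) → Bad G U T s t := by
      intro τ hτ hτU
      refine L.y_exit (τ.append W) ?_ ?_ hT
      · intro z hz hzX
        rw [Walk.mem_support_append_iff] at hz
        rcases hz with hz | hz
        · exact hτ z hz hzX
        · exact absurd hzX (hW z hz).1
      · intro z hz
        rw [Walk.mem_support_append_iff] at hz
        rcases hz with hz | hz
        · exact hτU z hz
        · exact (hW z hz).2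
    by_cases hu1y : u1 = y
    · subst hu1y
      exact yex τ1 hτ1 (fun w hw => hU1 w (hσ1 w (hs1 w hw)))
    by_cases hu2y : u2 = y
    · subst hu2y
      exact yex τ2 hτ2 (fun w hw => hU2 w (hσ2 w (hs2 w hw)))
    have huu : u1 ≠ u2 := by
      intro h
      apply hu1y
      refine hX u1 hu1 (hσ1 _ (hs1 _ τ1.start_mem_support)) ?_
      rw [h]
      exact hσ2 _ (hs2 _ τ2.start_mem_support)
    obtain ⟨E1, hE1, hE1X⟩ := L.reach hu1 hu1y
    obtain ⟨E2, hE2, hE2X⟩ := L.reach hu2 hu2y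
    obtain ⟨a', A, F1, F2, hA, hF1, hF2, hAF1, hAF2, hFF, hAE, hFE1, hFE2⟩ := fork E1 E2 hE1 hE2
    have hσp1 : σ1.IsPath := h1.of_append_right.of_append_left
    have hσp2 : σ2.IsPath := h2.of_append_right.of_append_left
    have hτp1 : τ1.IsPath := by rw [e1] at hσp1; exact hσp1.of_append_right
    have hτp2 : τ2.IsPath := by rw [e2] at hσp2; exact hσp2.of_append_right
    have hT1 : ∀ w ∈ τ1.support, w ∈ (T : Set V) → w = x' ∨ w ∈ L.X ∧ w ≠ y := by
      intro w hw hwT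
      rcases t1 w (hs1 w hw) hwT with rfl | h
      · right
        rw [e1] at hσp1
        have := app_disj hσp1 w p1.start_mem_support hw
        exact this ▸ ⟨hu1, hu1y⟩
      · exact Or.inl h
    have hT2 : ∀ w ∈ τ2.support, w ∈ (T : Set V) → w = x' ∨ w ∈ L.X ∧ w ≠ y := by
      intro w hw hwT
      rcases t2 w (hs2 w hw) hwT with rfl | h
      · right
        rw [e2] at hσp2
        have := app_disj hσp2 w p2.start_mem_support hw
        exact this ▸ ⟨hu2, hu2y⟩
      · exact Or.inl h
    have hTX : ∀ w, (w ∈ L.X ∧ w ≠ y) → w ∈ (T : Set V) → w = s := by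
      intro w hw hwT
      rcases hT w hw.1 hwT with h | h
      · exact h
      · exact absurd h hw.2
    rcases join (U := U) (X := {w | w ∈ L.X ∧ w ≠ y}) (T := (T : Set V)) A F1 F2 hA hF1 hF2
      hAF1 hAF2 hFF (fun w hw => hE2X w (hAE w hw)) (fun w hw => hE1X w (hFE1 w hw))
      (fun w hw => hE2X w (hFE2 w hw)) (fun w hw => L.hU w hw.1) τ1 τ2 hτp1 hτp2
      (fun w hw hw' => hτ1 w hw hw'.1) (fun w hw hw' => hτ2 w hw hw'.1)
      (fun w hw => hU1 w (hσ1 w (hs1 w hw))) (fun w hw => hU2 w (hσ2 w (hs2 w hw)))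
      (fun h => hx'X h.1) W (fun w hw h => (hW w hw).1 h.1) (fun w hw => (hW w hw).2)
      hTX hT1 hT2 (Or.inl huu) with hbad | ⟨L', hL'⟩
    · exact hbad
    · refine ih L' r1 r2 ?_ h1.of_append_right.of_append_right h2.of_append_right.of_append_right
        (fun w hw => hU1 w (hr1 w hw)) (fun w hw => hU2 w (hr2 w hw)) hx'T hr ?_ ?_
      · have hlen : 0 < σ1.length := by
          rcases Nat.eq_zero_or_pos σ1.length with h0 | h0
          · exact absurd (Walk.eq_of_length_eq_zero h0) hxx
          · exact h0
        rw [Walk.length_append, Walk.length_append] at hl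
        omega
      · intro w hw hw1 hw2
        rcases hL' w hw with h | h | h
        · exact absurd (hX w h.1 (hr1 w hw1) (hr2 w hw2)) h.2
        · exact app_disj h1.of_append_right w (hs1 w h) hw1
        · exact app_disj h2.of_append_right w (hs2 w h) hw2
      · intro w hw hwT
        rcases hL' w hw with h | h | h
        · exact Or.inl (hTX w h hwT)
        · rcases hT1 w h hwT with h | h
          · exact Or.inr h
          · exact Or.inl (hTX w h hwT)
        · rcases hT2 w h hwT with h | h
          · exact Or.inr h
          · exact Or.inl (hTX w h hwT)

lemma core [DecidableEq V] {T : Finset V} {U : Set V} {s t : V} (ht : t ∈ T) (hst : s ≠ t)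
    (P1 P2 : G.Walk s t) (h1 : P1.IsPath) (h2 : P2.IsPath)
    (hU1 : ∀ w ∈ P1.support, w ∈ U) (hU2 : ∀ w ∈ P2.support, w ∈ U)
    (hs : trackerSeq T P1 = trackerSeq T P2) (hne : P1.snd ≠ P2.snd) : Bad G U T s t := by
  obtain ⟨x, hx, σ1, σ2, r1, r2, rfl, rfl, hsx, t1, t2, hr⟩ := two_seg P1 P2 h1 h2 hst ht hs
  rw [snd_app _ _ hsx, snd_app _ _ hsx] at hne
  simp only [Walk.mem_support_append_iff] at hU1 hU2
  have hT1 : ∀ w ∈ σ1.support, w ∈ (T : Set V) → w = x ∨ w ∈ ({s} : Set V) :=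
    fun w hw hT => (t1 w hw hT).symm
  have hT2 : ∀ w ∈ σ2.support, w ∈ (T : Set V) → w = x ∨ w ∈ ({s} : Set V) :=
    fun w hw hT => (t2 w hw hT).symm
  have hsr1 : s ∉ r1.support := fun h => hsx (app_disj h1 s σ1.start_mem_support h)
  rcases join (U := U) (X := {s}) (T := (T : Set V)) (Walk.nil : G.Walk s s) Walk.nil Walk.nil
    Walk.IsPath.nil Walk.IsPath.nil Walk.IsPath.nil (by simp) (by simp) (by simp) (by simp)
    (by simp) (by simp) (by simpa using hU1 s (Or.inl σ1.start_mem_support)) σ1 σ2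
    h1.of_append_left h2.of_append_left (fun w _ h => h) (fun w _ h => h)
    (fun w hw => hU1 w (Or.inl hw)) (fun w hw => hU2 w (Or.inl hw)) (fun h => hsx h.symm) r1
    (fun w hw h => hsr1 (by rw [Set.mem_singleton_iff] at h; exact h ▸ hw))
    (fun w hw => hU1 w (Or.inr hw)) (fun w hw _ => hw) hT1 hT2 (Or.inr hne) with hbad | ⟨L, hL⟩
  · exact hbad
  · refine state_bad ht r1.length L r1 r2 le_rfl h1.of_append_right h2.of_append_right
      (fun w hw => hU1 w (Or.inr hw)) (fun w hw => hU2 w (Or.inr hw)) hx hr ?_ ?_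
    · intro w hw hw1 hw2
      rcases hL w hw with h | h | h
      · rw [Set.mem_singleton_iff] at h
        exact absurd (h ▸ hw1) hsr1
      · exact app_disj h1 w h hw1
      · exact app_disj h2 w h hw2
    · intro w hw hwT
      rcases hL w hw with h | h | h
      · exact Or.inl h
      · exact (hT1 w h hwT).symm
      · exact (hT2 w h hwT).symm

lemma main_s14 [DecidableEq V] {T : Finset V} {t : V} (ht : t ∈ T) {s : V} (P1 : G.Walk s t) :
    ∀ P2 : G.Walk s t, P1.IsPath → P2.IsPath → trackerSeq T P1 = trackerSeq T P2 → P1 ≠ P2 →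
      Bad G {w | w ∈ P1.support ∨ w ∈ P2.support} T s t := by
  induction P1 with
  | nil =>
    intro P2 _ h2 _ hne
    exact absurd (Walk.isPath_iff_nil.1 h2).eq_nil.symm hne
  | @cons s v t h p ih =>
    intro P2 h1 h2 hs hne
    have hst : s ≠ t := by
      rintro rfl
      exact ((Walk.cons_isPath_iff _ _).1 h1).2 p.end_mem_support
    by_cases hsnd : (Walk.cons h p).snd = P2.snd
    · cases P2 with
      | nil => exact absurd rfl hst
      | @cons _ v' _ h' p' =>
        simp only [Walk.snd_cons] at hsnd
        subst hsnd
        rw [Walk.cons_isPath_iff] at h1 h2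
        have hs' : trackerSeq T p = trackerSeq T p' := by
          unfold trackerSeq at *
          rw [Walk.support_cons, Walk.support_cons, List.filter_cons, List.filter_cons] at hs
          split_ifs at hs with hc
          · exact (List.cons.inj hs).2
          · exact hs
        obtain ⟨z, c, a, b, P, Q, hc, hP, hQ, hac, hbc, hPQ, hPc, hQc, hTc, hPU, hQU, hcU⟩ :=
          ih ht p' h1.1 h2.1 hs' (by rintro rfl; exact hne rfl)
        have hsU : s ∉ ({w | w ∈ p.support ∨ w ∈ p'.support} : Set V) := by
          rintro (h | h)
          · exact h1.2 h
          · exact h2.2 h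
        have up : ∀ w, w ∈ ({w | w ∈ p.support ∨ w ∈ p'.support} : Set V) →
            w ∈ (Walk.cons h p).support ∨ w ∈ (Walk.cons h' p').support := by
          rintro w (h | h)
          · exact Or.inl (by simp [h])
          · exact Or.inr (by simp [h])
        refine ⟨z, c, a, b, Walk.cons h P, Q, hc, ?_, hQ, hac, hbc, ?_, ?_, hQc, hTc, ?_,
          fun w hw => up w (hQU w hw), fun w hw => up w (hcU w hw)⟩
        · rw [Walk.cons_isPath_iff]
          exact ⟨hP, fun h => hsU (hPU s h)⟩
        · intro w hw hwQ
          simp only [Walk.support_cons, List.mem_cons] at hw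
          rcases hw with rfl | hw
          · exact hsU (hQU _ hwQ)
          · exact hPQ w hw hwQ
        · intro w hw hwc
          simp only [Walk.support_cons, List.mem_cons] at hw
          rcases hw with rfl | hw
          · exact absurd (hcU _ hwc) hsU
          · exact hPc w hw hwc
        · intro w hw
          simp only [Walk.support_cons, List.mem_cons] at hw
          rcases hw with rfl | hw
          · exact Or.inl (by simp)
          · exact up w (hPU w hw)
    · exact core ht hst _ P2 h1 h2 (fun w hw => Or.inl hw) (fun w hw => Or.inr hw) hs hsnd

lemma seq_insert [DecidableEq V] (T : Finset V) {s t : V} (P : G.Walk s t) (hP : P.IsPath)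
    (ht : t ∉ T) : trackerSeq (insert t T) P = trackerSeq T P ++ [t] := by
  induction P with
  | nil => simp [trackerSeq, ht]
  | @cons s v t h p ih =>
    rw [Walk.cons_isPath_iff] at hP
    have := ih hP.1 ht
    have hst : s ≠ t := by
      rintro rfl
      exact hP.2 p.end_mem_support
    unfold trackerSeq at *
    rw [Walk.support_cons, List.filter_cons, List.filter_cons, this]
    by_cases hsT : s ∈ T <;> simp [hsT, hst]

lemma seq_insert_eq [DecidableEq V] (T : Finset V) {s t : V} (P1 P2 : G.Walk s t)
    (h1 : P1.IsPath) (h2 : P2.IsPath) (h : trackerSeq T P1 = trackerSeq T P2) :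
    trackerSeq (insert t T) P1 = trackerSeq (insert t T) P2 := by
  by_cases ht : t ∈ T
  · rwa [Finset.insert_eq_self.2 ht]
  · rw [seq_insert T P1 h1 ht, seq_insert T P2 h2 ht, h]

end TrackAux

/-- Let `S ⊆ T` with `S` a feedback vertex set of `G`. If for every cycle
`C` of `G` and every local `s`-`t` pair `(a, b)` for `C` with `V(C) ∩ S ⊆ {a, b}` the set
`T ∩ (V(C) \ {a,b})` is nonempty, then `T` is a tracking set for `G`. -/
theorem trackingSet_of_cycle_condition
    {V : Type*} [Fintype V] [DecidableEq V]
    (G : SimpleGraph V) (s t : V)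
    (S T : Finset V) (hST : S ⊆ T)
    (hfvs : ∀ ⦃v : V⦄ (c : G.Walk v v), c.IsCycle → ∃ u ∈ S, u ∈ c.support)
    (hyp : ∀ ⦃v : V⦄ (c : G.Walk v v), c.IsCycle →
      ∀ a b : V, LocalSTPair G s t {x | x ∈ c.support} a b →
        {x | x ∈ c.support} ∩ ↑S ⊆ ({a, b} : Set V) →
        (↑T ∩ ({x | x ∈ c.support} \ {a, b})).Nonempty) :
    IsTrackingSet G s t T := by
  intro P₁ P₂ h1 h2 hs
  by_contra hne
  obtain ⟨z, c, a, b, P, Q, hc, hP, hQ, hac, hbc, hPQ, hPc, hQc, hTc, -, -, -⟩ :=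
    TrackAux.main_s14 (Finset.mem_insert_self t T) P₁ P₂ h1 h2
      (TrackAux.seq_insert_eq T P₁ P₂ h1 h2 hs) hne
  have hTc' : ∀ w ∈ c.support, w ∈ T → w = a ∨ w = b := fun w hw hwT =>
    hTc w hw (by simp [hwT])
  have e1 : {v | v ∈ P.support} ∩ {v | v ∈ Q.support} = (∅ : Set V) := by
    ext w
    simp only [Set.mem_inter_iff, Set.mem_ofPred_eq, Set.mem_empty_iff_false, iff_false]
    exact fun h => hPQ w h.1 h.2
  have e2 : {v | v ∈ P.support} ∩ {x | x ∈ c.support} = ({a} : Set V) := by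
    ext w
    constructor
    · exact fun h => hPc w h.1 h.2
    · rintro rfl
      exact ⟨P.end_mem_support, hac⟩
  have e3 : {v | v ∈ Q.support} ∩ {x | x ∈ c.support} = ({b} : Set V) := by
    ext w
    constructor
    · exact fun h => hQc w h.1 h.2
    · rintro rfl
      exact ⟨Q.start_mem_support, hbc⟩
  obtain ⟨w, hwT, hwc, hwab⟩ := hyp c hc a b ⟨hac, hbc, P, Q, hP, hQ, e1, e2, e3⟩
    (fun w h => hTc' w h.1 (hST h.2))
  exact hwab (hTc' w hwc hwT)
end
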